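/- arXiv:2409.10948 — 2 statements merged into one kernel-verified Lean document; each statement's English description precedes it below -/
import Mathlib

section
/- Let M ≥ 1 be an integer, let α_k, β_k > 0 for k = 1,…,M, let m and l be nonnegative integers with l < m, and suppose ∑_{k=1}^M α_k > m + (1/2)(M + 1/2) and λ ≥ π·∑_{k=1}^M β_k. Then ∫_0^∞ x^{2m}·J_{2l+1}(λx)·g_M(x) dx = 0. -/
open MeasureTheory Real

/-- Bessel function of the first kind of nonnegative integer order `n`. -/
noncomputable def besselJ (n : ℕ) (x : ℝ) : ℝ :=
  ∑' k : ℕ, (-1 : ℝ) ^ k / (Nat.factorial k * Nat.factorial (n + k)) * (x / 2) ^ (n + 2 * k)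

/-- The product of reciprocal Gamma functions `∏_{k<M} 1/(Γ(α k + β k x) Γ(α k - β k x))`. -/
noncomputable def gammaProd (M : ℕ) (α β : ℕ → ℝ) (x : ℝ) : ℝ :=
  ∏ k ∈ Finset.range M, (Real.Gamma (α k + β k * x) * Real.Gamma (α k - β k * x))⁻¹

/-- Recurrence for the moments of `(1 - t ^ 2) ^ p` on `[0, 1]`. -/
lemma integral_pow_mul_one_sub_sq_rpow_succ {p : ℝ} (hp : 0 < p) (k : ℕ) :
    (2 * k + 1) * ∫ t in (0 : ℝ)..1, t ^ (2 * k) * (1 - t ^ 2) ^ p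
      = (2 * k + 2 * p + 3) * ∫ t in (0 : ℝ)..1, t ^ (2 * (k + 1)) * (1 - t ^ 2) ^ p := by
  have hcont : ∀ j : ℕ, Continuous fun t : ℝ => t ^ j * (1 - t ^ 2) ^ p := fun j =>
    (continuous_pow j).mul ((by fun_prop : Continuous fun t : ℝ => 1 - t ^ 2).rpow_const
      fun _ => Or.inr hp.le)
  have hderiv : ∀ t ∈ Set.uIcc (0 : ℝ) 1,
      HasDerivAt (fun t : ℝ => t ^ (2 * k + 1) * (1 - t ^ 2) ^ (p + 1))
        ((2 * k + 1) * (t ^ (2 * k) * (1 - t ^ 2) ^ p)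
          - (2 * k + 2 * p + 3) * (t ^ (2 * (k + 1)) * (1 - t ^ 2) ^ p)) t := by
    intro t ht
    rw [Set.uIcc_of_le zero_le_one] at ht
    have h1 : HasDerivAt (fun t : ℝ => 1 - t ^ 2) (-(2 * t)) t := by
      simpa using (hasDerivAt_pow 2 t).const_sub 1
    have h2 := h1.rpow_const (p := p + 1) (Or.inr (by linarith))
    have h3 := (hasDerivAt_pow (2 * k + 1) t).mul h2
    have h0 : 0 ≤ 1 - t ^ 2 := by nlinarith [ht.1, ht.2]
    have h4 : (1 - t ^ 2) ^ (p + 1) = (1 - t ^ 2) ^ p * (1 - t ^ 2) := by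
      rw [Real.rpow_add_one' h0 (by linarith)]
    refine h3.congr_deriv ?_
    rw [h4, add_sub_cancel_right]
    push_cast
    ring
  have hinteg := intervalIntegral.integral_eq_sub_of_hasDerivAt hderiv
    (((hcont _).const_mul _).sub ((hcont _).const_mul _) |>.intervalIntegrable _ _)
  rw [intervalIntegral.integral_sub (((hcont _).const_mul _).intervalIntegrable _ _)
    (((hcont _).const_mul _).intervalIntegrable _ _), intervalIntegral.integral_const_mul,
    intervalIntegral.integral_const_mul] at hinteg
  have hz : (0 : ℝ) ^ (p + 1) = 0 := Real.zero_rpow (by linarith)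
  simp [hz] at hinteg
  linarith

lemma integral_one_sub_sq_rpow_pos {p : ℝ} (hp : 0 < p) :
    0 < ∫ t in (0 : ℝ)..1, (1 - t ^ 2) ^ p := by
  apply intervalIntegral.intervalIntegral_pos_of_pos_on _ _ zero_lt_one
  · exact ((by fun_prop : Continuous fun t : ℝ => 1 - t ^ 2).rpow_const
      fun _ => Or.inr hp.le).intervalIntegrable _ _
  · intro t ht
    exact Real.rpow_pos_of_pos (by nlinarith [ht.1, ht.2]) _

/-- Poisson's integral for `J_n`, up to the value of the constant. -/
lemma exists_besselJ_eq_mul_integral (n : ℕ) (hn : 1 ≤ n) :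
    ∃ C : ℝ, ∀ x : ℝ, besselJ n x
      = C * x ^ n * ∫ t in (0 : ℝ)..1, Real.cos (x * t) * (1 - t ^ 2) ^ ((n : ℝ) - 1 / 2) := by
  set p : ℝ := (n : ℝ) - 1 / 2 with hp_def
  have hp : 0 < p := by
    have : (1 : ℝ) ≤ n := by exact_mod_cast hn
    rw [hp_def]; linarith
  set B : ℕ → ℝ := fun k => ∫ t in (0 : ℝ)..1, t ^ (2 * k) * (1 - t ^ 2) ^ p with hB
  have hB0 : 0 < B 0 := by simpa [hB] using integral_one_sub_sq_rpow_pos hp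
  have hBk : ∀ k, B k * (k.factorial * (n + k).factorial * 4 ^ k)
      = B 0 * n.factorial * (2 * k).factorial := by
    intro k
    induction k with
    | zero => simp
    | succ k ih =>
      have hrec := integral_pow_mul_one_sub_sq_rpow_succ hp k
      change (2 * k + 1) * B k = (2 * k + 2 * p + 3) * B (k + 1) at hrec
      have e : 2 * (k : ℝ) + 2 * p + 3 = 2 * (n + k + 1) := by rw [hp_def]; ring
      rw [e] at hrec
      rw [show 2 * (k + 1) = 2 * k + 1 + 1 by ring, show n + (k + 1) = n + k + 1 by ring,
        Nat.factorial_succ k, Nat.factorial_succ (n + k), Nat.factorial_succ (2 * k + 1),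
        Nat.factorial_succ (2 * k)]
      push_cast
      linear_combination (2 * (k + 1)) * (2 * k + 1) * ih
        - (2 * (k + 1) * (k.factorial * (n + k).factorial * 4 ^ k : ℝ)) * hrec
  refine ⟨(B 0 * n.factorial * 2 ^ n)⁻¹, fun x => ?_⟩
  have hcont : Continuous fun t : ℝ => (1 - t ^ 2) ^ p :=
    (by fun_prop : Continuous fun t : ℝ => 1 - t ^ 2).rpow_const fun _ => Or.inr hp.le
  have hsum : HasSum (fun k : ℕ => ∫ t in (0 : ℝ)..1,
      ((-1) ^ k * (x * t) ^ (2 * k) / (2 * k).factorial) * (1 - t ^ 2) ^ p)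
      (∫ t in (0 : ℝ)..1, Real.cos (x * t) * (1 - t ^ 2) ^ p) := by
    refine intervalIntegral.hasSum_integral_of_dominated_convergence
      (fun k _ => |x| ^ (2 * k) / (2 * k).factorial) (fun k => ?_) (fun k => ?_) ?_ ?_ ?_
    · exact (Continuous.aestronglyMeasurable (by fun_prop))
    · refine Filter.Eventually.of_forall fun t ht => ?_
      rw [Set.uIoc_of_le zero_le_one] at ht
      have h0 : 0 ≤ 1 - t ^ 2 := by nlinarith [ht.1, ht.2]
      have h1 : (1 - t ^ 2) ^ p ≤ 1 := Real.rpow_le_one h0 (by nlinarith [ht.1]) hp.le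
      rw [norm_mul, Real.norm_of_nonneg (Real.rpow_nonneg h0 _)]
      have h2 : ‖(-1) ^ k * (x * t) ^ (2 * k) / ((2 * k).factorial : ℝ)‖
          ≤ |x| ^ (2 * k) / (2 * k).factorial := by
        rw [norm_div, norm_mul, norm_pow, norm_pow, norm_mul]
        simp only [norm_neg, norm_one, one_pow, one_mul, Nat.abs_cast, Real.norm_eq_abs]
        gcongr
        rw [abs_of_pos ht.1]
        exact mul_le_of_le_one_right (abs_nonneg _) ht.2
      calc _ ≤ |x| ^ (2 * k) / (2 * k).factorial * 1 := by
            gcongr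
        _ = _ := mul_one _
    · refine Filter.Eventually.of_forall fun t _ => ?_
      have := (Real.summable_pow_div_factorial |x|).comp_injective
        (i := fun k : ℕ => 2 * k) (fun a b h => by simpa using h)
      exact this
    · exact intervalIntegrable_const
    · exact Filter.Eventually.of_forall fun t _ => (Real.hasSum_cos (x * t)).mul_right _
  rw [besselJ, ← hsum.tsum_eq, ← tsum_mul_left]
  refine tsum_congr fun k => ?_
  have hterm : (∫ t in (0 : ℝ)..1,
      ((-1) ^ k * (x * t) ^ (2 * k) / (2 * k).factorial) * (1 - t ^ 2) ^ p)
      = (-1) ^ k * x ^ (2 * k) / (2 * k).factorial * B k := by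
    rw [hB, ← intervalIntegral.integral_const_mul]
    congr 1
    ext t
    rw [mul_pow]; ring
  rw [hterm]
  have h1 : ((2 * k).factorial : ℝ) ≠ 0 := by positivity
  have h2 : (k.factorial : ℝ) ≠ 0 := by positivity
  have h3 : ((n + k).factorial : ℝ) ≠ 0 := by positivity
  have h4 : (n.factorial : ℝ) ≠ 0 := by positivity
  have h5 : B k = B 0 * n.factorial * (2 * k).factorial
      / (k.factorial * (n + k).factorial * 4 ^ k) := by
    rw [eq_div_iff (by positivity), hBk k]
  rw [h5, div_pow, pow_add, pow_add, pow_mul 2 2 k]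
  norm_num
  field_simp

/-- The integral `∫₀^∞ e^{-u} (u² - 2iuz)^p du`, which continues
`z ↦ e^{-iz} ∫ e^{iζ} (z² - ζ²)^p dζ` over the ray from `z` to `z + i∞`. -/
noncomputable def hankelKernel (p : ℝ) (z : ℂ) : ℂ :=
  ∫ u in Set.Ioi (0 : ℝ),
    (Real.exp (-u) : ℂ) * ((u : ℂ) ^ 2 - 2 * Complex.I * u * z) ^ (p : ℂ)

lemma integrableOn_exp_neg_mul_rpow {p : ℝ} (hp : 0 < p) :
    IntegrableOn (fun u : ℝ => Real.exp (-u) * (u ^ 2 + 2 * u) ^ p) (Set.Ioi 0) := by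
  refine integrable_of_isBigO_exp_neg (b := 1 / 2) (by norm_num) ?_ ?_
  · exact ((by fun_prop : Continuous fun u : ℝ => Real.exp (-u)).mul
      ((by fun_prop : Continuous fun u : ℝ => u ^ 2 + 2 * u).rpow_const
        fun _ => Or.inr hp.le)).continuousOn
  · have h1 := (isLittleO_rpow_exp_pos_mul_atTop (2 * p) (b := 1 / 2) (by norm_num)).isBigO
    have h2 : (fun u : ℝ => (u ^ 2 + 2 * u) ^ p) =O[Filter.atTop] fun u : ℝ => u ^ (2 * p) := by
      refine Asymptotics.IsBigO.of_bound (2 ^ p) ?_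
      filter_upwards [Filter.eventually_ge_atTop 2] with u hu
      have hu0 : 0 ≤ u := by linarith
      rw [Real.norm_of_nonneg (by positivity), Real.norm_of_nonneg (by positivity),
        Real.rpow_mul hu0, ← Real.mul_rpow (by norm_num) (by positivity)]
      refine Real.rpow_le_rpow (by positivity) ?_ hp.le
      rw [Real.rpow_two]
      nlinarith
    have h3 := (Asymptotics.isBigO_refl (fun u : ℝ => Real.exp (-u)) Filter.atTop).mul
      (h2.trans h1)
    refine h3.congr_right fun u => ?_
    rw [← Real.exp_add]
    ring_nf

lemma norm_hankelKernel_integrand_le {p : ℝ} (hp : 0 < p) {u : ℝ} (hu : 0 < u) {z : ℂ} {K : ℝ}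
    (hz : ‖z‖ ≤ K) :
    ‖(Real.exp (-u) : ℂ) * ((u : ℂ) ^ 2 - 2 * Complex.I * u * z) ^ (p : ℂ)‖
      ≤ (1 + K) ^ p * (Real.exp (-u) * (u ^ 2 + 2 * u) ^ p) := by
  have hK : 0 ≤ K := (norm_nonneg z).trans hz
  have h1 : ‖(u : ℂ) ^ 2 - 2 * Complex.I * u * z‖ ≤ (1 + K) * (u ^ 2 + 2 * u) := by
    refine (norm_sub_le _ _).trans ?_
    simp only [norm_pow, norm_mul, Complex.norm_real, Complex.norm_I, Complex.norm_ofNat,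
      Real.norm_of_nonneg hu.le]
    nlinarith [mul_le_mul_of_nonneg_left hz hu.le, mul_nonneg hK (sq_nonneg u)]
  rw [norm_mul, Complex.norm_cpow_real, Complex.norm_real,
    Real.norm_of_nonneg (Real.exp_pos _).le]
  calc Real.exp (-u) * ‖(u : ℂ) ^ 2 - 2 * Complex.I * u * z‖ ^ p
      ≤ Real.exp (-u) * ((1 + K) * (u ^ 2 + 2 * u)) ^ p := by gcongr
    _ = _ := by rw [Real.mul_rpow (by positivity) (by positivity)]; ring

lemma aestronglyMeasurable_hankelKernel_integrand (p : ℝ) (z : ℂ) :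
    AEStronglyMeasurable (fun u : ℝ =>
      (Real.exp (-u) : ℂ) * ((u : ℂ) ^ 2 - 2 * Complex.I * u * z) ^ (p : ℂ))
      (volume.restrict (Set.Ioi 0)) := by
  refine Measurable.aestronglyMeasurable ?_
  fun_prop

lemma integrableOn_hankelKernel_integrand {p : ℝ} (hp : 0 < p) (z : ℂ) :
    IntegrableOn (fun u : ℝ =>
      (Real.exp (-u) : ℂ) * ((u : ℂ) ^ 2 - 2 * Complex.I * u * z) ^ (p : ℂ)) (Set.Ioi 0) := by
  refine Integrable.mono' ((integrableOn_exp_neg_mul_rpow hp).const_mul ((1 + ‖z‖) ^ p))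
    (aestronglyMeasurable_hankelKernel_integrand p z) ?_
  filter_upwards [ae_restrict_mem measurableSet_Ioi] with u hu
  exact norm_hankelKernel_integrand_le hp hu le_rfl

lemma exists_norm_hankelKernel_le {p : ℝ} (hp : 0 < p) :
    ∃ D : ℝ, 0 ≤ D ∧ ∀ z : ℂ, ‖hankelKernel p z‖ ≤ D * (1 + ‖z‖) ^ p := by
  refine ⟨∫ u in Set.Ioi (0 : ℝ), Real.exp (-u) * (u ^ 2 + 2 * u) ^ p, ?_, fun z => ?_⟩
  · refine setIntegral_nonneg measurableSet_Ioi fun u hu => ?_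
    have : (0 : ℝ) < u := hu
    positivity
  · rw [mul_comm, ← integral_const_mul]
    refine norm_integral_le_of_norm_le ((integrableOn_exp_neg_mul_rpow hp).const_mul _) ?_
    filter_upwards [ae_restrict_mem measurableSet_Ioi] with u hu
    exact norm_hankelKernel_integrand_le hp hu le_rfl

lemma hankelKernel_base_mem_slitPlane {u : ℝ} (hu : 0 < u) {z : ℂ} (hz : 0 ≤ z.im) :
    (u : ℂ) ^ 2 - 2 * Complex.I * u * z ∈ Complex.slitPlane := by
  refine Or.inl ?_
  simp [pow_two]
  nlinarith [mul_nonneg hu.le hz, mul_pos hu hu]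

lemma continuousAt_hankelKernel {p : ℝ} (hp : 0 < p) {z : ℂ} (hz : 0 ≤ z.im) :
    ContinuousAt (hankelKernel p) z := by
  refine continuousAt_of_dominated
    (bound := fun u => (1 + (‖z‖ + 1)) ^ p * (Real.exp (-u) * (u ^ 2 + 2 * u) ^ p))
    (Filter.Eventually.of_forall fun w => aestronglyMeasurable_hankelKernel_integrand p w) ?_
    ((integrableOn_exp_neg_mul_rpow hp).const_mul _) ?_
  · filter_upwards [Metric.ball_mem_nhds z one_pos] with w hw
    filter_upwards [ae_restrict_mem measurableSet_Ioi] with u hu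
    refine norm_hankelKernel_integrand_le hp hu ?_
    have := norm_sub_norm_le w z
    rw [Metric.mem_ball, dist_eq_norm] at hw
    linarith
  · filter_upwards [ae_restrict_mem measurableSet_Ioi] with u hu
    exact continuousAt_const.mul (ContinuousAt.cpow (by fun_prop) continuousAt_const
      (hankelKernel_base_mem_slitPlane hu hz))

lemma differentiableAt_hankelKernel {p : ℝ} (hp : 0 < p) {z : ℂ} (hz : 0 < z.im) :
    DifferentiableAt ℂ (hankelKernel p) z := by
  set δ : ℝ := z.im / 2 with hδ_def
  have hδ : 0 < δ := by positivity
  have hball : ∀ w ∈ Metric.ball z δ, δ ≤ w.im ∧ ‖w‖ ≤ ‖z‖ + δ := by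
    intro w hw
    rw [Metric.mem_ball, dist_eq_norm] at hw
    have h1 := norm_sub_norm_le w z
    have h2 := (Complex.abs_im_le_norm (w - z)).trans hw.le
    rw [Complex.sub_im, abs_le] at h2
    exact ⟨by linarith [h2.1], by linarith⟩
  refine (hasDerivAt_integral_of_dominated_loc_of_deriv_le
    (F := fun w u => (Real.exp (-u) : ℂ) * ((u : ℂ) ^ 2 - 2 * Complex.I * u * w) ^ (p : ℂ))
    (F' := fun w u => (Real.exp (-u) : ℂ) * ((p : ℂ) *
      ((u : ℂ) ^ 2 - 2 * Complex.I * u * w) ^ ((p : ℂ) - 1) * (-(2 * Complex.I * u))))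
    (bound := fun u => p / δ * ((1 + (‖z‖ + δ)) ^ p * (Real.exp (-u) * (u ^ 2 + 2 * u) ^ p)))
    (Metric.ball_mem_nhds z hδ)
    (Filter.Eventually.of_forall fun w => aestronglyMeasurable_hankelKernel_integrand p w)
    (integrableOn_hankelKernel_integrand hp z) ?_ ?_
    (((integrableOn_exp_neg_mul_rpow hp).const_mul _).const_mul _) ?_).2.differentiableAt
  · refine Measurable.aestronglyMeasurable ?_
    fun_prop
  · filter_upwards [ae_restrict_mem measurableSet_Ioi] with u hu w hw
    have hu : 0 < u := hu
    obtain ⟨hw1, hw2⟩ := hball w hw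
    refine le_trans ?_ (mul_le_mul_of_nonneg_left
      (norm_hankelKernel_integrand_le hp hu hw2) (by positivity : 0 ≤ p / δ))
    set b : ℂ := (u : ℂ) ^ 2 - 2 * Complex.I * u * w with hb_def
    have hre : 2 * u * δ ≤ ‖b‖ := by
      refine le_trans ?_ (Complex.re_le_norm b)
      simp [hb_def, pow_two]
      nlinarith [mul_le_mul_of_nonneg_left hw1 hu.le, mul_pos hu hu]
    have hbpos : 0 < ‖b‖ := lt_of_lt_of_le (by positivity) hre
    have hb0 : b ≠ 0 := norm_pos_iff.1 hbpos
    rw [Complex.cpow_sub _ _ hb0, Complex.cpow_one]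
    simp only [norm_mul, norm_div, norm_neg, Complex.norm_real, Complex.norm_I,
      Complex.norm_ofNat, Real.norm_of_nonneg hp.le, Real.norm_of_nonneg hu.le]
    have hkey : 2 * u / ‖b‖ ≤ 1 / δ := by
      rw [div_le_div_iff₀ hbpos hδ]
      linarith
    calc ‖Real.exp (-u)‖ * (p * (‖b ^ (p : ℂ)‖ / ‖b‖) * (2 * 1 * u))
        = (2 * u / ‖b‖) * (p * (‖Real.exp (-u)‖ * ‖b ^ (p : ℂ)‖)) := by ring
      _ ≤ (1 / δ) * (p * (‖Real.exp (-u)‖ * ‖b ^ (p : ℂ)‖)) := by gcongr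
      _ = _ := by ring
  · filter_upwards [ae_restrict_mem measurableSet_Ioi] with u hu w hw
    have h1 : HasDerivAt (fun w : ℂ => (u : ℂ) ^ 2 - 2 * Complex.I * u * w)
        (-(2 * Complex.I * u)) w := by
      simpa using ((hasDerivAt_id w).const_mul (2 * Complex.I * (u : ℂ))).const_sub ((u : ℂ) ^ 2)
    exact (h1.cpow_const (hankelKernel_base_mem_slitPlane hu
      (hδ.le.trans (hball w hw).1))).const_mul _

lemma hankelKernel_mul_I_im (p : ℝ) {y : ℝ} (hy : 0 ≤ y) :
    (hankelKernel p (y * Complex.I)).im = 0 := by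
  have : hankelKernel p (y * Complex.I)
      = ((∫ u in Set.Ioi (0 : ℝ), Real.exp (-u) * (u ^ 2 + 2 * u * y) ^ p : ℝ) : ℂ) := by
    rw [hankelKernel, ← integral_complex_ofReal]
    refine setIntegral_congr_fun measurableSet_Ioi fun u hu => ?_
    have hu : 0 < u := hu
    have e : (u : ℂ) ^ 2 - 2 * Complex.I * u * (y * Complex.I)
        = ((u ^ 2 + 2 * u * y : ℝ) : ℂ) := by
      push_cast
      linear_combination (-2 * (u : ℂ) * y) * Complex.I_mul_I
    rw [e, ← Complex.ofReal_cpow (by positivity), ← Complex.ofReal_mul]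
  rw [this, Complex.ofReal_im]

/-- Contour shift expressing a finite cosine integral through `hankelKernel`. -/
lemma integral_cos_mul_rpow_eq_re_hankelKernel {p : ℝ} (hp : 0 < p) {x : ℝ} (hx : 0 < x) :
    ∫ s in (0 : ℝ)..x, Real.cos s * (x ^ 2 - s ^ 2) ^ p
      = (-Complex.I * Complex.exp (Complex.I * x) * hankelKernel p x).re := by
  set F : ℂ → ℂ := fun ζ => Complex.exp (Complex.I * ζ) * ((x : ℂ) ^ 2 - ζ ^ 2) ^ (p : ℂ)
    with hF
  have hbase : ∀ ζ : ℂ, ((x : ℂ) ^ 2 - ζ ^ 2).re = x ^ 2 - ζ.re ^ 2 + ζ.im ^ 2 := by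
    intro ζ
    simp [pow_two]
    ring
  have hrect : ∀ R : ℝ, 0 < R →
      (∫ s in (0 : ℝ)..x, F s) - (∫ s in (0 : ℝ)..x, F (s + R * Complex.I))
        + Complex.I * (∫ u in (0 : ℝ)..R, F (x + u * Complex.I))
        - Complex.I * (∫ u in (0 : ℝ)..R, F (u * Complex.I)) = 0 := by
    intro R hR
    have h := Complex.integral_boundary_rect_eq_zero_of_continuousOn_of_differentiableOn F 0
      (x + R * Complex.I) ?_ ?_
    · simpa using h
    · intro ζ hζ
      simp only [Complex.mem_reProdIm, Complex.zero_re, Complex.zero_im, Complex.add_re,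
        Complex.add_im, Complex.mul_re, Complex.mul_im, Complex.ofReal_re, Complex.ofReal_im,
        Complex.I_re, Complex.I_im, mul_zero, mul_one, sub_self, add_zero, zero_add,
        Set.uIcc_of_le hx.le, Set.uIcc_of_le hR.le] at hζ
      refine ContinuousAt.continuousWithinAt (ContinuousAt.mul (by fun_prop) ?_)
      refine ContinuousAt.comp (f := fun ζ : ℂ => (x : ℂ) ^ 2 - ζ ^ 2)
        (g := fun w : ℂ => w ^ (p : ℂ))
        (Complex.continuousAt_cpow_const_of_re_pos (Or.inl ?_) (by simpa using hp)) (by fun_prop)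
      rw [hbase]
      nlinarith [hζ.1.1, hζ.1.2, sq_nonneg ζ.im]
    · intro ζ hζ
      simp only [Complex.mem_reProdIm, Complex.zero_re, Complex.zero_im, Complex.add_re,
        Complex.add_im, Complex.mul_re, Complex.mul_im, Complex.ofReal_re, Complex.ofReal_im,
        Complex.I_re, Complex.I_im, mul_zero, mul_one, sub_self, add_zero, zero_add,
        min_eq_left hx.le, min_eq_left hR.le, max_eq_right hx.le, max_eq_right hR.le] at hζ
      refine DifferentiableAt.differentiableWithinAt (DifferentiableAt.mul (by fun_prop) ?_)
      refine DifferentiableAt.cpow_const (by fun_prop) (Or.inl ?_)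
      rw [hbase]
      nlinarith [hζ.1.1, hζ.1.2, sq_nonneg ζ.im]
  have hleft : ∀ R : ℝ, (Complex.I * (∫ u in (0 : ℝ)..R, F (u * Complex.I))).re = 0 := by
    intro R
    have : ∀ u : ℝ, F (u * Complex.I) = ((Real.exp (-u) * (x ^ 2 + u ^ 2) ^ p : ℝ) : ℂ) := by
      intro u
      have e : (x : ℂ) ^ 2 - (u * Complex.I) ^ 2 = ((x ^ 2 + u ^ 2 : ℝ) : ℂ) := by
        push_cast
        rw [mul_pow, Complex.I_sq]
        ring
      have e' : Complex.I * (u * Complex.I) = ((-u : ℝ) : ℂ) := by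
        push_cast
        linear_combination (u : ℂ) * Complex.I_mul_I
      rw [hF]
      simp only
      rw [e, e', ← Complex.ofReal_cpow (by positivity), ← Complex.ofReal_exp,
        ← Complex.ofReal_mul]
    simp_rw [this]
    rw [intervalIntegral.integral_ofReal]
    simp
  have hbottom : (∫ s in (0 : ℝ)..x, F s).re
      = ∫ s in (0 : ℝ)..x, Real.cos s * (x ^ 2 - s ^ 2) ^ p := by
    have hcont : ∀ s ∈ Set.uIcc 0 x, F s = ((Real.cos s * (x ^ 2 - s ^ 2) ^ p : ℝ) : ℂ)
        + ((Real.sin s * (x ^ 2 - s ^ 2) ^ p : ℝ) : ℂ) * Complex.I := by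
      intro s hs
      rw [Set.uIcc_of_le hx.le] at hs
      have e : (x : ℂ) ^ 2 - (s : ℂ) ^ 2 = ((x ^ 2 - s ^ 2 : ℝ) : ℂ) := by push_cast; ring
      rw [hF]
      simp only
      rw [e, ← Complex.ofReal_cpow (by nlinarith [hs.1, hs.2]), mul_comm Complex.I,
        Complex.exp_mul_I]
      push_cast
      ring
    have hc : Continuous fun s : ℝ => (x ^ 2 - s ^ 2) ^ p :=
      (by fun_prop : Continuous fun s : ℝ => x ^ 2 - s ^ 2).rpow_const fun _ => Or.inr hp.le
    rw [intervalIntegral.integral_congr hcont, intervalIntegral.integral_add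
      (Continuous.intervalIntegrable (by fun_prop) _ _)
      (Continuous.intervalIntegrable (by fun_prop) _ _), intervalIntegral.integral_mul_const,
      intervalIntegral.integral_ofReal, intervalIntegral.integral_ofReal]
    simp
  have hright : ∀ u : ℝ, F (x + u * Complex.I) = Complex.exp (Complex.I * x)
      * ((Real.exp (-u) : ℂ) * ((u : ℂ) ^ 2 - 2 * Complex.I * u * x) ^ (p : ℂ)) := by
    intro u
    have e : (x : ℂ) ^ 2 - (x + u * Complex.I) ^ 2 = (u : ℂ) ^ 2 - 2 * Complex.I * u * x := by
      linear_combination (-(u : ℂ) ^ 2) * Complex.I_sq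
    have e' : Complex.I * (x + u * Complex.I) = Complex.I * x + ((-u : ℝ) : ℂ) := by
      push_cast
      linear_combination (u : ℂ) * Complex.I_mul_I
    rw [hF]
    simp only
    rw [e, e', Complex.exp_add, Complex.ofReal_exp, mul_assoc]
  have hlimR : Filter.Tendsto (fun R : ℝ => ∫ u in (0 : ℝ)..R, F (x + u * Complex.I))
      Filter.atTop (nhds (Complex.exp (Complex.I * x) * hankelKernel p x)) := by
    simp_rw [hright, intervalIntegral.integral_const_mul]
    exact (intervalIntegral_tendsto_integral_Ioi 0
      (integrableOn_hankelKernel_integrand hp (x : ℂ)) Filter.tendsto_id).const_mul _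
  have hlimT : Filter.Tendsto (fun R : ℝ => ∫ s in (0 : ℝ)..x, F (s + R * Complex.I))
      Filter.atTop (nhds 0) := by
    have hlim : Filter.Tendsto (fun R : ℝ => (5 ^ p * (R ^ (2 * p) * Real.exp (-1 * R))) * |x - 0|)
        Filter.atTop (nhds 0) := by
      have := ((tendsto_rpow_mul_exp_neg_mul_atTop_nhds_zero (2 * p) 1 one_pos).const_mul
        (5 ^ p : ℝ)).mul_const |x - 0|
      simpa using this
    refine squeeze_zero_norm' ?_ hlim
    filter_upwards [Filter.eventually_ge_atTop x] with R hR
    have hR0 : 0 < R := hx.trans_le hR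
    refine intervalIntegral.norm_integral_le_of_norm_le_const fun s hs => ?_
    rw [Set.uIoc_of_le hx.le] at hs
    rw [hF]
    simp only
    rw [norm_mul, Complex.norm_cpow_real, Complex.norm_exp]
    have e : (Complex.I * (s + R * Complex.I)).re = -1 * R := by simp
    have hle : ‖(x : ℂ) ^ 2 - (s + R * Complex.I) ^ 2‖ ≤ 5 * R ^ 2 := by
      have h1 : ‖(s : ℂ) + R * Complex.I‖ ≤ 2 * R := by
        refine (norm_add_le _ _).trans ?_
        rw [norm_mul, Complex.norm_real, Complex.norm_real, Complex.norm_I,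
          Real.norm_of_nonneg hs.1.le, Real.norm_of_nonneg hR0.le]
        linarith [hs.2]
      refine (norm_sub_le _ _).trans ?_
      rw [norm_pow, norm_pow, Complex.norm_real, Real.norm_of_nonneg hx.le]
      nlinarith [norm_nonneg ((s : ℂ) + R * Complex.I)]
    rw [e]
    calc Real.exp (-1 * R) * ‖(x : ℂ) ^ 2 - (s + R * Complex.I) ^ 2‖ ^ p
        ≤ Real.exp (-1 * R) * (5 * R ^ 2) ^ p := by gcongr
      _ = _ := by
        rw [Real.mul_rpow (by norm_num) (by positivity), Real.rpow_mul hR0.le, Real.rpow_two]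
        ring
  have hfinal : Filter.Tendsto (fun R : ℝ => (∫ s in (0 : ℝ)..x, F s).re
      - (∫ s in (0 : ℝ)..x, F (s + R * Complex.I)).re
      + (Complex.I * (∫ u in (0 : ℝ)..R, F (x + u * Complex.I))).re) Filter.atTop
      (nhds ((∫ s in (0 : ℝ)..x, F s).re - (0 : ℂ).re
        + (Complex.I * (Complex.exp (Complex.I * x) * hankelKernel p x)).re)) :=
    (tendsto_const_nhds.sub ((Complex.continuous_re.tendsto _).comp hlimT)).add
      ((Complex.continuous_re.tendsto _).comp (hlimR.const_mul Complex.I))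
  have hzero : ∀ᶠ R : ℝ in Filter.atTop, (0 : ℝ) = (∫ s in (0 : ℝ)..x, F s).re
      - (∫ s in (0 : ℝ)..x, F (s + R * Complex.I)).re
      + (Complex.I * (∫ u in (0 : ℝ)..R, F (x + u * Complex.I))).re := by
    filter_upwards [Filter.eventually_gt_atTop 0] with R hR
    have h := congrArg Complex.re (hrect R hR)
    simp only [Complex.sub_re, Complex.add_re, hleft R, Complex.zero_re, sub_zero] at h
    exact h.symm
  have heq := tendsto_nhds_unique (tendsto_const_nhds.congr' hzero) hfinal
  rw [hbottom, Complex.zero_re, sub_zero] at heq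
  rw [mul_assoc, neg_mul, Complex.neg_re]
  linarith

lemma Complex.norm_sin_le_exp_abs_im (z : ℂ) : ‖Complex.sin z‖ ≤ Real.exp |z.im| := by
  rw [Complex.sin, norm_div, norm_mul, Complex.norm_I, mul_one, Complex.norm_ofNat,
    div_le_iff₀ two_pos]
  refine (norm_sub_le _ _).trans ?_
  rw [Complex.norm_exp, Complex.norm_exp]
  have h1 : Real.exp (-z * Complex.I).re ≤ Real.exp |z.im| := by
    simpa using le_abs_self z.im
  have h2 : Real.exp (z * Complex.I).re ≤ Real.exp |z.im| := by
    simpa using neg_le_abs z.im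
  linarith

lemma Complex.norm_Gamma_le_Gamma_re {z : ℂ} (hz : 0 < z.re) :
    ‖Complex.Gamma z‖ ≤ Real.Gamma z.re := by
  rw [Complex.Gamma_eq_integral hz, Real.Gamma_eq_integral hz, Complex.GammaIntegral]
  refine norm_integral_le_of_norm_le (Real.GammaIntegral_convergent hz) ?_
  filter_upwards [ae_restrict_mem measurableSet_Ioi] with x hx
  rw [norm_mul, Complex.norm_cpow_eq_rpow_re_of_pos hx, Complex.norm_real,
    Real.norm_of_nonneg (Real.exp_pos _).le]
  simp

lemma Complex.norm_betaIntegral_le {u v : ℂ} (hu : 0 < u.re) (hv : 0 < v.re) :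
    ‖Complex.betaIntegral u v‖ ≤ Real.Gamma u.re * Real.Gamma v.re / Real.Gamma (u.re + v.re) := by
  have hreal : (∫ t in (0 : ℝ)..1, ‖(t : ℂ) ^ ((u.re : ℂ) - 1) * (1 - (t : ℂ)) ^ ((v.re : ℂ) - 1)‖)
      = Real.Gamma u.re * Real.Gamma v.re / Real.Gamma (u.re + v.re) := by
    have h := Complex.betaIntegral_eq_Gamma_mul_div (u.re : ℂ) (v.re : ℂ) (by simpa) (by simpa)
    rw [← Complex.ofReal_add, Complex.Gamma_ofReal, Complex.Gamma_ofReal, Complex.Gamma_ofReal,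
      ← Complex.ofReal_mul, ← Complex.ofReal_div] at h
    apply Complex.ofReal_injective
    rw [← h, Complex.betaIntegral, ← intervalIntegral.integral_ofReal]
    refine intervalIntegral.integral_congr fun t ht => ?_
    rw [Set.uIcc_of_le zero_le_one] at ht
    have e : (t : ℂ) ^ ((u.re : ℂ) - 1) * (1 - (t : ℂ)) ^ ((v.re : ℂ) - 1)
        = ((t ^ (u.re - 1) * (1 - t) ^ (v.re - 1) : ℝ) : ℂ) := by
      rw [Complex.ofReal_mul, Complex.ofReal_cpow ht.1, Complex.ofReal_cpow (by linarith [ht.2])]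
      push_cast
      rfl
    rw [e, Complex.norm_real, Real.norm_of_nonneg]
    exact mul_nonneg (Real.rpow_nonneg ht.1 _) (Real.rpow_nonneg (by linarith [ht.2]) _)
  rw [← hreal, Complex.betaIntegral]
  refine (intervalIntegral.norm_integral_le_integral_norm zero_le_one).trans_eq ?_
  rw [intervalIntegral.integral_of_le zero_le_one, intervalIntegral.integral_of_le zero_le_one,
    integral_Ioc_eq_integral_Ioo, integral_Ioc_eq_integral_Ioo]
  refine setIntegral_congr_fun measurableSet_Ioo fun t ht => ?_
  have ht1 : (0 : ℝ) < 1 - t := by linarith [ht.2]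
  simp only [norm_mul]
  rw [← Complex.ofReal_one, ← Complex.ofReal_sub, Complex.norm_cpow_eq_rpow_re_of_pos ht.1,
    Complex.norm_cpow_eq_rpow_re_of_pos ht.1, Complex.norm_cpow_eq_rpow_re_of_pos ht1,
    Complex.norm_cpow_eq_rpow_re_of_pos ht1]
  simp

lemma Complex.inv_Gamma_eq_of_re_lt_one {z : ℂ} (hz : z.re < 1) :
    (Complex.Gamma z)⁻¹ = Complex.Gamma (1 - z) * Complex.sin (π * z) / π := by
  have h := Complex.Gamma_mul_Gamma_one_sub z
  have h1 : Complex.Gamma (1 - z) ≠ 0 :=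
    Complex.Gamma_ne_zero_of_re_pos (by simpa using hz)
  have hpi : (π : ℂ) ≠ 0 := by exact_mod_cast Real.pi_ne_zero
  by_cases hs : Complex.sin (π * z) = 0
  · rw [hs, div_zero] at h
    rw [(mul_eq_zero.1 h).resolve_right h1, hs]
    simp
  · rw [eq_div_iff hs] at h
    have h2 : Complex.Gamma z ≠ 0 := by
      intro h0
      rw [h0] at h
      simp [hpi.symm] at h
    rw [inv_eq_iff_eq_inv, inv_div, eq_div_iff (mul_ne_zero h1 hs), ← mul_assoc]
    exact h

lemma Complex.norm_inv_Gamma_half_add_le {z : ℂ} (hz : z.re = 1 / 2) :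
    ‖(Complex.Gamma z)⁻¹‖ ≤ Real.exp (π * |z.im| / 2) / √π := by
  have h := Complex.inv_Gamma_eq_of_re_lt_one (z := z) (by rw [hz]; norm_num)
  have hconj : 1 - z = (starRingEnd ℂ) z := by
    apply Complex.ext
    · simp [hz]; norm_num
    · simp
  have hne : Complex.Gamma z ≠ 0 := Complex.Gamma_ne_zero_of_re_pos (by rw [hz]; norm_num)
  have hpos : 0 < ‖Complex.Gamma z‖ := norm_pos_iff.2 hne
  have h' := congrArg norm h
  rw [hconj, Complex.Gamma_conj, norm_div, norm_mul, RCLike.norm_conj, Complex.norm_real,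
    Real.norm_of_nonneg Real.pi_pos.le, norm_inv] at h'
  have hsin := Complex.norm_sin_le_exp_abs_im (π * z)
  have him : |((π : ℂ) * z).im| = π * |z.im| := by
    simp [abs_mul, abs_of_pos Real.pi_pos]
  rw [him] at hsin
  have hsq : ‖(Complex.Gamma z)⁻¹‖ ^ 2 ≤ (Real.exp (π * |z.im| / 2) / √π) ^ 2 := by
    rw [div_pow, Real.sq_sqrt Real.pi_pos.le, ← Real.exp_nat_mul, norm_inv, sq]
    nth_rw 1 [h']
    have e : ((2 : ℕ) : ℝ) * (π * |z.im| / 2) = π * |z.im| := by push_cast; ring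
    rw [e]
    have : ‖Complex.Gamma z‖ * ‖Complex.sin (π * z)‖ / π * ‖Complex.Gamma z‖⁻¹
        = ‖Complex.sin (π * z)‖ / π := by field_simp
    rw [this]
    gcongr
  exact le_of_sq_le_sq hsq (by positivity)

lemma Complex.norm_inv_Gamma_le_of_half_lt_re {z : ℂ} (hz : 1 / 2 < z.re) :
    ‖(Complex.Gamma z)⁻¹‖ ≤ Real.exp (π * |z.im| / 2) / Real.Gamma z.re := by
  set u : ℂ := ⟨1 / 2, z.im⟩ with hu
  set b : ℝ := z.re - 1 / 2 with hb
  have hb0 : 0 < b := by rw [hb]; linarith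
  have hsum : u + (b : ℂ) = z := by
    apply Complex.ext <;> simp [hu, hb]
  have hbeta := Complex.Gamma_mul_Gamma_eq_betaIntegral (s := u) (t := (b : ℂ))
    (by simp [hu]) (by simpa using hb0)
  rw [hsum] at hbeta
  have hnorm := Complex.norm_betaIntegral_le (u := u) (v := (b : ℂ))
    (by simp [hu]) (by simpa using hb0)
  have e1 : u.re = 1 / 2 := rfl
  have e2 : ((b : ℂ)).re = b := Complex.ofReal_re b
  have e3 : 1 / 2 + b = z.re := by rw [hb]; ring
  rw [e1, e2, e3, Real.Gamma_one_half_eq] at hnorm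
  have hhalf := Complex.norm_inv_Gamma_half_add_le (z := u) rfl
  have e4 : u.im = z.im := rfl
  rw [e4] at hhalf
  have hGb : 0 < Real.Gamma b := Real.Gamma_pos_of_pos hb0
  have hGz : 0 < Real.Gamma z.re := Real.Gamma_pos_of_pos (by linarith)
  have hpu : 0 < ‖Complex.Gamma u‖ :=
    norm_pos_iff.2 (Complex.Gamma_ne_zero_of_re_pos (by rw [e1]; norm_num))
  have hpz : 0 < ‖Complex.Gamma z‖ :=
    norm_pos_iff.2 (Complex.Gamma_ne_zero_of_re_pos (by linarith))
  have h1 := congrArg norm hbeta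
  rw [norm_mul, norm_mul, Complex.Gamma_ofReal, Complex.norm_real,
    Real.norm_of_nonneg hGb.le] at h1
  have h2 : ‖Complex.Gamma u‖ * Real.Gamma b
      ≤ ‖Complex.Gamma z‖ * (√π * Real.Gamma b / Real.Gamma z.re) := by
    rw [h1]
    gcongr
  have h3 : ‖Complex.Gamma u‖ ≤ ‖Complex.Gamma z‖ * (√π / Real.Gamma z.re) := by
    refine le_of_mul_le_mul_right (h2.trans_eq ?_) hGb
    ring
  have hs : 0 < √π := Real.sqrt_pos.2 Real.pi_pos
  rw [norm_inv] at hhalf ⊢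
  have h4 : ‖Complex.Gamma z‖⁻¹ ≤ √π / Real.Gamma z.re * ‖Complex.Gamma u‖⁻¹ := by
    rw [inv_le_iff_one_le_mul₀ hpz]
    have : 1 ≤ ‖Complex.Gamma z‖ * (√π / Real.Gamma z.re) * ‖Complex.Gamma u‖⁻¹ := by
      rw [← div_eq_mul_inv, le_div_iff₀ hpu, one_mul]
      exact h3
    linarith
  refine h4.trans ?_
  calc √π / Real.Gamma z.re * ‖Complex.Gamma u‖⁻¹
      ≤ √π / Real.Gamma z.re * (Real.exp (π * |z.im| / 2) / √π) := by gcongr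
    _ = _ := by field_simp

lemma Real.Gamma_le_exp_rpow {r : ℝ} (hr : 1 / 2 ≤ r) :
    Real.Gamma r ≤ 4 / 3 * Real.exp (2 * (r + 2) ^ (3 / 2 : ℝ)) := by
  have hr0 : 0 < r := by linarith
  have h1 : Real.Gamma (r + 2) = (r + 1) * (r * Real.Gamma r) := by
    rw [← Real.Gamma_add_one hr0.ne', ← Real.Gamma_add_one (by linarith)]
    ring_nf
  set n : ℕ := ⌈r⌉₊ + 1 with hn
  have hn1 : r + 1 ≤ n := by
    rw [hn]; push_cast; linarith [Nat.le_ceil r]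
  have hn2 : (n : ℝ) ≤ r + 2 := by
    rw [hn]; push_cast; linarith [Nat.ceil_lt_add_one hr0.le]
  have h2 : Real.Gamma (r + 2) ≤ (n.factorial : ℝ) := by
    rw [← Real.Gamma_nat_eq_factorial]
    exact Real.Gamma_strictMonoOn_Ici.monotoneOn (by simp; linarith) (by simp; linarith)
      (by linarith)
  have h3 : (n.factorial : ℝ) ≤ (r + 2) ^ (r + 2) := by
    calc (n.factorial : ℝ) ≤ (n : ℝ) ^ n := by exact_mod_cast Nat.factorial_le_pow n
      _ ≤ (r + 2) ^ n := by gcongr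
      _ = (r + 2) ^ (n : ℝ) := (Real.rpow_natCast _ _).symm
      _ ≤ (r + 2) ^ (r + 2) := Real.rpow_le_rpow_of_exponent_le (by linarith) hn2
  have h4 : (r + 2) ^ (r + 2) ≤ Real.exp (2 * (r + 2) ^ (3 / 2 : ℝ)) := by
    rw [Real.rpow_def_of_pos (by linarith), Real.exp_le_exp]
    have h := Real.log_le_rpow_div (x := r + 2) (ε := 1 / 2) (by linarith) (by norm_num)
    have e : (r + 2) ^ (3 / 2 : ℝ) = (r + 2) ^ (1 / 2 : ℝ) * (r + 2) := by
      rw [← Real.rpow_add_one (by linarith)]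
      norm_num
    rw [e]
    calc Real.log (r + 2) * (r + 2) ≤ ((r + 2) ^ (1 / 2 : ℝ) / (1 / 2)) * (r + 2) := by gcongr
      _ = _ := by ring
  have h5 : 3 / 4 * Real.Gamma r ≤ Real.Gamma (r + 2) := by
    rw [h1]
    nlinarith [Real.Gamma_pos_of_pos hr0,
      mul_nonneg (sub_nonneg.2 hr) (Real.Gamma_pos_of_pos hr0).le,
      mul_nonneg (mul_nonneg (sub_nonneg.2 hr) hr0.le) (Real.Gamma_pos_of_pos hr0).le]
  linarith

/-- The entire function `1 / Γ` has order less than two. -/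
lemma Complex.exists_norm_inv_Gamma_le_exp :
    ∃ A : ℝ, 0 ≤ A ∧ ∀ z : ℂ,
      ‖(Complex.Gamma z)⁻¹‖ ≤ A * Real.exp (6 * (3 + ‖z‖) ^ (3 / 2 : ℝ)) := by
  obtain ⟨x₀, hx₀, hmin⟩ := Real.exists_isMinOn_Gamma_Ioi
  have hG0 : 0 < Real.Gamma x₀ := Real.Gamma_pos_of_pos (by linarith [hx₀.1])
  refine ⟨4 / 3 + 1 / Real.Gamma x₀, by positivity, fun z => ?_⟩
  have hpi := Real.pi_lt_four
  have hlin : ‖z‖ ≤ (3 + ‖z‖) ^ (3 / 2 : ℝ) := by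
    calc ‖z‖ ≤ (3 + ‖z‖) ^ (1 : ℝ) := by rw [Real.rpow_one]; linarith
      _ ≤ _ := Real.rpow_le_rpow_of_exponent_le (by linarith [norm_nonneg z]) (by norm_num)
  have himz : π * |z.im| ≤ 4 * (3 + ‖z‖) ^ (3 / 2 : ℝ) := by
    calc π * |z.im| ≤ 4 * ‖z‖ := by
          gcongr
          exact Complex.abs_im_le_norm z
      _ ≤ _ := by gcongr
  have hy : 0 ≤ π * |z.im| := by positivity
  rcases lt_or_ge (1 / 2) z.re with hz | hz
  · refine (Complex.norm_inv_Gamma_le_of_half_lt_re hz).trans ?_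
    have h1 : Real.Gamma x₀ ≤ Real.Gamma z.re := hmin (by simp; linarith)
    calc Real.exp (π * |z.im| / 2) / Real.Gamma z.re
        ≤ Real.exp (6 * (3 + ‖z‖) ^ (3 / 2 : ℝ)) / Real.Gamma x₀ := by
          gcongr
          linarith
      _ = (0 + 1 / Real.Gamma x₀) * Real.exp (6 * (3 + ‖z‖) ^ (3 / 2 : ℝ)) := by ring
      _ ≤ _ := by
          gcongr
          norm_num
  · rw [Complex.inv_Gamma_eq_of_re_lt_one (by linarith), norm_div, norm_mul, Complex.norm_real,
      Real.norm_of_nonneg Real.pi_pos.le]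
    have h1 : ‖Complex.Gamma (1 - z)‖ ≤ 4 / 3 * Real.exp (2 * (3 + ‖z‖) ^ (3 / 2 : ℝ)) := by
      refine (Complex.norm_Gamma_le_Gamma_re (by simp; linarith)).trans ?_
      refine (Real.Gamma_le_exp_rpow (by simp; linarith)).trans ?_
      have hre := neg_le_of_abs_le (Complex.abs_re_le_norm z)
      have e : (1 - z).re + 2 = 3 - z.re := by simp; ring
      rw [e]
      gcongr
      · linarith
      · linarith
    have h2 : ‖Complex.sin (π * z)‖ ≤ Real.exp (4 * (3 + ‖z‖) ^ (3 / 2 : ℝ)) := by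
      refine (Complex.norm_sin_le_exp_abs_im _).trans ?_
      gcongr
      simpa [abs_mul, abs_of_pos Real.pi_pos] using himz
    calc ‖Complex.Gamma (1 - z)‖ * ‖Complex.sin (π * z)‖ / π
        ≤ ‖Complex.Gamma (1 - z)‖ * ‖Complex.sin (π * z)‖ :=
          div_le_self (by positivity) (by linarith [Real.pi_gt_three])
      _ ≤ (4 / 3 * Real.exp (2 * (3 + ‖z‖) ^ (3 / 2 : ℝ)))
          * Real.exp (4 * (3 + ‖z‖) ^ (3 / 2 : ℝ)) := by gcongr
      _ = (4 / 3 + 0) * Real.exp (6 * (3 + ‖z‖) ^ (3 / 2 : ℝ)) := by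
          rw [mul_assoc, ← Real.exp_add]
          ring_nf
      _ ≤ _ := by
          gcongr
          positivity

lemma Real.add_const_isTheta_atTop (a : ℝ) :
    (fun x : ℝ => x + a) =Θ[Filter.atTop] fun x : ℝ => x :=
  (Asymptotics.IsEquivalent.refl.add_isLittleO
    (Asymptotics.isLittleO_const_id_atTop a)).isTheta

lemma Real.Gamma_add_isBigO_rpow_mul_Gamma (a : ℝ) :
    (fun x : ℝ => Real.Gamma (x + a)) =O[Filter.atTop] fun x : ℝ => x ^ a * Real.Gamma x := by
  have hfract : ∀ s : ℝ, 0 ≤ s → s < 1 →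
      (fun x : ℝ => Real.Gamma (x + s)) =O[Filter.atTop] fun x : ℝ => x ^ s * Real.Gamma x := by
    intro s hs0 hs1
    rcases hs0.eq_or_lt with rfl | hs0
    · simpa using Asymptotics.isBigO_refl (fun x : ℝ => Real.Gamma x) Filter.atTop
    refine Asymptotics.IsBigO.of_bound 1 ?_
    filter_upwards [Filter.eventually_gt_atTop 0] with x hx
    have hG := Real.Gamma_pos_of_pos hx
    rw [one_mul, Real.norm_of_nonneg (Real.Gamma_nonneg_of_nonneg (by positivity)),
      Real.norm_of_nonneg (by positivity)]
    have h := Real.Gamma_mul_add_mul_le_rpow_Gamma_mul_rpow_Gamma (s := x) (t := x + 1)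
      (a := 1 - s) (b := s) hx (by linarith) (by linarith) hs0 (by ring)
    rw [show (1 - s) * x + s * (x + 1) = x + s by ring, Real.Gamma_add_one hx.ne',
      Real.mul_rpow hx.le hG.le, mul_left_comm, ← Real.rpow_add hG, sub_add_cancel,
      Real.rpow_one] at h
    exact h
  have hshift : ∀ (b : ℝ) (n : ℤ), (fun x : ℝ => Real.Gamma (x + (b + n))) =O[Filter.atTop]
      (fun x : ℝ => x ^ (b + n) * Real.Gamma x) ↔
      (fun x : ℝ => Real.Gamma (x + (b + n + 1))) =O[Filter.atTop]
      (fun x : ℝ => x ^ (b + n + 1) * Real.Gamma x) := by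
    intro b n
    set c := b + n
    have e1 : (fun x : ℝ => Real.Gamma (x + (c + 1))) =ᶠ[Filter.atTop]
        fun x : ℝ => (x + c) * Real.Gamma (x + c) := by
      filter_upwards [Filter.eventually_gt_atTop (-c)] with x hx
      rw [← Real.Gamma_add_one (by linarith)]
      congr 1
      ring
    have e2 : (fun x : ℝ => x ^ (c + 1) * Real.Gamma x) =ᶠ[Filter.atTop]
        fun x : ℝ => x * (x ^ c * Real.Gamma x) := by
      filter_upwards [Filter.eventually_gt_atTop 0] with x hx
      rw [Real.rpow_add_one hx.ne']
      ring
    have hθ := Real.add_const_isTheta_atTop c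
    constructor
    · intro h
      exact (hθ.isBigO.mul h).congr' e1.symm e2.symm
    · intro h
      have h' := hθ.inv.isBigO.mul (h.congr' e1 e2)
      refine h'.congr' ?_ ?_
      · filter_upwards [Filter.eventually_gt_atTop (-c)] with x hx
        have : x + c ≠ 0 := by linarith
        field_simp
      · filter_upwards [Filter.eventually_gt_atTop 0] with x hx
        field_simp
  have hall : ∀ (b : ℝ), 0 ≤ b → b < 1 → ∀ n : ℤ, (fun x : ℝ => Real.Gamma (x + (b + n)))
      =O[Filter.atTop] (fun x : ℝ => x ^ (b + n) * Real.Gamma x) := by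
    intro b hb0 hb1 n
    induction n with
    | zero => simpa using hfract b hb0 hb1
    | succ n ih =>
      have := (hshift b n).1 ih
      push_cast at this ⊢
      simpa only [add_assoc] using this
    | pred n ih =>
      refine (hshift b _).2 ?_
      convert ih using 4 <;> push_cast <;> ring
  have := hall (Int.fract a) (Int.fract_nonneg a) (Int.fract_lt_one a) ⌊a⌋
  simpa only [Int.fract_add_floor] using this

lemma Real.Gamma_add_isBigO_rpow_mul_Gamma_add (a b : ℝ) :
    (fun x : ℝ => Real.Gamma (x + a)) =O[Filter.atTop]
      fun x : ℝ => x ^ (a - b) * Real.Gamma (x + b) := by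
  have h := (Real.Gamma_add_isBigO_rpow_mul_Gamma (a - b)).comp_tendsto
    (Filter.tendsto_atTop_add_const_right Filter.atTop b Filter.tendsto_id)
  have h1 : (fun x : ℝ => Real.Gamma (x + a)) =O[Filter.atTop]
      fun x : ℝ => (x + b) ^ (a - b) * Real.Gamma (x + b) := by
    refine h.congr_left fun x => ?_
    simp only [Function.comp, id]
    congr 1
    ring
  have hθ := (Real.add_const_isTheta_atTop b).rpow (r := a - b)
    (by filter_upwards [Filter.eventually_gt_atTop (-b)] with x hx; simp; linarith)
    (Filter.eventually_ge_atTop 0)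
  exact h1.trans (hθ.isBigO.mul (Asymptotics.isBigO_refl _ _))

lemma Real.rpow_le_mul_rpow_of_le_mul {K a b : ℝ} (hK : 1 ≤ K) (ha : 0 < a) (hb : 0 < b)
    (hab : a ≤ K * b) (hba : b ≤ K * a) (s : ℝ) : b ^ s ≤ K ^ |s| * a ^ s := by
  have hK0 : 0 < K := by linarith
  rcases le_total 0 s with hs | hs
  · rw [abs_of_nonneg hs, ← Real.mul_rpow hK0.le ha.le]
    exact Real.rpow_le_rpow hb.le hba hs
  · rw [abs_of_nonpos hs, Real.rpow_neg hK0.le, ← Real.inv_rpow hK0.le,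
      ← Real.mul_rpow (by positivity) ha.le]
    refine Real.rpow_le_rpow_of_nonpos (by positivity) ?_ hs
    rw [inv_mul_le_iff₀ hK0]
    exact hab

/-- The even entire function `1 / (Γ(a + z) Γ(a - z))`. -/
noncomputable def gammaFactor (a : ℝ) (z : ℂ) : ℂ :=
  (Complex.Gamma (a + z) * Complex.Gamma (a - z))⁻¹

lemma gammaFactor_neg (a : ℝ) (z : ℂ) : gammaFactor a (-z) = gammaFactor a z := by
  simp only [gammaFactor, sub_neg_eq_add, ← sub_eq_add_neg, mul_comm]

lemma differentiable_gammaFactor (a : ℝ) : Differentiable ℂ (gammaFactor a) := by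
  have e : gammaFactor a
      = fun z => (Complex.Gamma (a + z))⁻¹ * (Complex.Gamma (a - z))⁻¹ := by
    ext z
    rw [gammaFactor, mul_inv]
  rw [e]
  exact (Complex.differentiable_one_div_Gamma.comp (by fun_prop :
    Differentiable ℂ fun z : ℂ => (a : ℂ) + z)).mul
    (Complex.differentiable_one_div_Gamma.comp (by fun_prop :
      Differentiable ℂ fun z : ℂ => (a : ℂ) - z))

lemma gammaFactor_ofReal (a x : ℝ) :
    gammaFactor a x = ((Real.Gamma (a + x) * Real.Gamma (a - x))⁻¹ : ℝ) := by
  rw [gammaFactor, ← Complex.ofReal_add, ← Complex.ofReal_sub, Complex.Gamma_ofReal,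
    Complex.Gamma_ofReal]
  push_cast
  rfl

lemma gammaFactor_mul_I_im (a y : ℝ) : (gammaFactor a (y * Complex.I)).im = 0 := by
  rw [← Complex.conj_eq_iff_im, gammaFactor, map_inv₀, map_mul, ← Complex.Gamma_conj,
    ← Complex.Gamma_conj]
  simp only [map_add, map_sub, map_mul, Complex.conj_ofReal, Complex.conj_I, mul_neg,
    sub_neg_eq_add, ← sub_eq_add_neg]
  rw [mul_comm]

lemma gammaFactor_ofReal_isBigO (a : ℝ) :
    (fun x : ℝ => gammaFactor a x) =O[Filter.atTop] fun x : ℝ => x ^ (1 - 2 * a) := by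
  have h := Real.Gamma_add_isBigO_rpow_mul_Gamma_add (1 - a) a
  have h1 := h.mul (Asymptotics.isBigO_refl (fun x : ℝ => (Real.Gamma (x + a))⁻¹) Filter.atTop)
  have h2 : (fun x : ℝ => Real.Gamma (x + (1 - a)) * (Real.Gamma (x + a))⁻¹)
      =O[Filter.atTop] fun x : ℝ => x ^ (1 - 2 * a) := by
    refine h1.congr' Filter.EventuallyEq.rfl ?_
    filter_upwards [Filter.eventually_gt_atTop (-a)] with x hx
    have : Real.Gamma (x + a) ≠ 0 := (Real.Gamma_pos_of_pos (by linarith)).ne'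
    rw [mul_inv_cancel_right₀ this]
    ring_nf
  refine Asymptotics.IsBigO.trans (Asymptotics.IsBigO.of_bound 1 ?_) h2
  filter_upwards [Filter.eventually_gt_atTop (a - 1)] with x hx
  rw [gammaFactor, mul_inv, Complex.inv_Gamma_eq_of_re_lt_one (z := (a : ℂ) - x)
    (by simp; linarith), norm_mul, norm_div, norm_mul, one_mul]
  have e1 : (1 : ℂ) - (a - x) = ((x + (1 - a) : ℝ) : ℂ) := by push_cast; ring
  have e2 : (a : ℂ) + x = ((x + a : ℝ) : ℂ) := by push_cast; ring
  have hsin : ‖Complex.sin (π * (a - x))‖ ≤ 1 := by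
    refine (Complex.norm_sin_le_exp_abs_im _).trans_eq ?_
    simp
  rw [e1, e2, Complex.Gamma_ofReal, Complex.Gamma_ofReal, norm_inv, Complex.norm_real,
    Complex.norm_real, Complex.norm_real, norm_mul, norm_inv,
    Real.norm_of_nonneg Real.pi_pos.le, mul_comm]
  refine mul_le_mul_of_nonneg_right ?_ (by positivity)
  calc ‖Real.Gamma (x + (1 - a))‖ * ‖Complex.sin (π * (a - x))‖ / π
      ≤ ‖Real.Gamma (x + (1 - a))‖ * ‖Complex.sin (π * (a - x))‖ :=
        div_le_self (by positivity) (by linarith [Real.pi_gt_three])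
    _ ≤ ‖Real.Gamma (x + (1 - a))‖ * 1 := by gcongr
    _ = _ := mul_one _

lemma norm_one_add_mul_I_le (x : ℝ) : ‖(1 : ℂ) + x * Complex.I‖ ≤ 1 + |x| := by
  refine (norm_add_le _ _).trans_eq ?_
  simp

lemma exists_norm_gammaFactor_ofReal_mul_le (a : ℝ) :
    ∃ C : ℝ, ∀ x : ℝ,
      ‖gammaFactor a x‖ * ‖(1 : ℂ) + x * Complex.I‖ ^ (2 * a - 1) ≤ C := by
  set φ : ℝ → ℝ := fun x => ‖gammaFactor a x‖ * ‖(1 : ℂ) + x * Complex.I‖ ^ (2 * a - 1) with hφ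
  have hne : ∀ x : ℝ, (1 : ℂ) + x * Complex.I ≠ 0 := by
    intro x h
    have := congrArg Complex.re h
    simp at this
  have hcont : Continuous φ := by
    refine ((differentiable_gammaFactor a).continuous.comp Complex.continuous_ofReal).norm.mul
      (Continuous.rpow_const (by fun_prop) fun x => Or.inl ?_)
    exact norm_ne_zero_iff.2 (hne x)
  have heven : ∀ x, φ (-x) = φ x := by
    intro x
    have e : (1 : ℂ) + ((-x : ℝ) : ℂ) * Complex.I = (starRingEnd ℂ) (1 + x * Complex.I) := by
      simp
    simp only [hφ]
    rw [e, RCLike.norm_conj, Complex.ofReal_neg, gammaFactor_neg]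
  have hbig : φ =O[Filter.atTop] fun _ : ℝ => (1 : ℝ) := by
    have h1 : (fun x : ℝ => ‖(1 : ℂ) + x * Complex.I‖ ^ (2 * a - 1)) =O[Filter.atTop]
        fun x : ℝ => x ^ (2 * a - 1) := by
      refine Asymptotics.IsBigO.of_bound (2 ^ |2 * a - 1|) ?_
      filter_upwards [Filter.eventually_ge_atTop 1] with x hx
      have hx0 : 0 < x := by linarith
      rw [Real.norm_of_nonneg (by positivity), Real.norm_of_nonneg (by positivity)]
      refine Real.rpow_le_mul_rpow_of_le_mul one_le_two hx0 (norm_pos_iff.2 (hne x)) ?_ ?_ _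
      · have := Complex.im_le_norm ((1 : ℂ) + x * Complex.I)
        simp at this
        linarith
      · have := norm_one_add_mul_I_le x
        rw [abs_of_pos hx0] at this
        linarith
    have h2 := (gammaFactor_ofReal_isBigO a).norm_left.mul h1
    refine h2.congr' Filter.EventuallyEq.rfl ?_
    filter_upwards [Filter.eventually_gt_atTop 0] with x hx
    rw [← Real.rpow_add hx]
    ring_nf
    simp
  obtain ⟨c, hc⟩ := hbig.bound
  obtain ⟨X, hX⟩ := Filter.eventually_atTop.1 hc
  obtain ⟨C', hC'⟩ := (isCompact_Icc (a := 0) (b := max X 0)).exists_bound_of_continuousOn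
    hcont.continuousOn
  have hnonneg : ∀ x, 0 ≤ x → φ x ≤ max c C' := by
    intro x hx
    rcases le_total x (max X 0) with h | h
    · exact (le_abs_self _).trans ((hC' x ⟨hx, h⟩).trans (le_max_right _ _))
    · have := hX x ((le_max_left _ _).trans h)
      simp only [norm_one, mul_one] at this
      exact (le_abs_self _).trans (this.trans (le_max_left _ _))
  refine ⟨max c C', fun x => ?_⟩
  rcases le_total 0 x with hx | hx
  · exact hnonneg x hx
  · exact (heven x).symm.le.trans (hnonneg (-x) (by linarith))

lemma norm_gammaFactor_mul_I_le {a : ℝ} (ha : 0 < a) (y : ℝ) :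
    ‖gammaFactor a (y * Complex.I)‖
      ≤ ((a + |y|) / Real.Gamma (a + 1)) ^ 2 * Real.exp (π * |y|) := by
  have hG : 0 < Real.Gamma (a + 1) := Real.Gamma_pos_of_pos (by linarith)
  have h : ∀ z : ℂ, z.re = a → |z.im| = |y| → ‖(Complex.Gamma z)⁻¹‖
      ≤ (a + |y|) / Real.Gamma (a + 1) * Real.exp (π * |y| / 2) := by
    intro z hz1 hz2
    have e := Complex.one_div_Gamma_eq_self_mul_one_div_Gamma_add_one z
    have h1 := Complex.norm_inv_Gamma_le_of_half_lt_re (z := z + 1) (by simp [hz1]; linarith)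
    have e1 : (z + 1).re = a + 1 := by simp [hz1]
    have e2 : |(z + 1).im| = |y| := by simp [hz2]
    rw [e1, e2] at h1
    have h2 : ‖z‖ ≤ a + |y| := by
      have := Complex.norm_le_abs_re_add_abs_im z
      rwa [hz1, hz2, abs_of_pos ha] at this
    rw [e, norm_mul]
    calc ‖z‖ * ‖(Complex.Gamma (z + 1))⁻¹‖
        ≤ (a + |y|) * (Real.exp (π * |y| / 2) / Real.Gamma (a + 1)) := by gcongr
      _ = _ := by ring
  rw [gammaFactor, mul_inv, norm_mul]
  calc _ ≤ ((a + |y|) / Real.Gamma (a + 1) * Real.exp (π * |y| / 2))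
        * ((a + |y|) / Real.Gamma (a + 1) * Real.exp (π * |y| / 2)) := by
        gcongr
        · exact h _ (by simp) (by simp)
        · exact h _ (by simp) (by simp)
    _ = ((a + |y|) / Real.Gamma (a + 1)) ^ 2
        * (Real.exp (π * |y| / 2) * Real.exp (π * |y| / 2)) := by ring
    _ = _ := by rw [← Real.exp_add]; ring_nf

lemma exists_norm_gammaFactor_le_exp (a : ℝ) : ∃ A : ℝ, 0 ≤ A ∧ ∀ z : ℂ,
    ‖gammaFactor a z‖ ≤ A * Real.exp (12 * (3 + |a| + ‖z‖) ^ (3 / 2 : ℝ)) := by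
  obtain ⟨A, hA0, hA⟩ := Complex.exists_norm_inv_Gamma_le_exp
  refine ⟨A * A, by positivity, fun z => ?_⟩
  have h : ∀ w : ℂ, ‖w‖ ≤ |a| + ‖z‖ → ‖(Complex.Gamma w)⁻¹‖
      ≤ A * Real.exp (6 * (3 + |a| + ‖z‖) ^ (3 / 2 : ℝ)) := by
    intro w hw
    refine (hA w).trans ?_
    have : 3 + ‖w‖ ≤ 3 + |a| + ‖z‖ := by linarith
    gcongr
  have h1 := h (a + z) ((norm_add_le _ _).trans_eq (by simp))
  have h2 := h (a - z) ((norm_sub_le _ _).trans_eq (by simp))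
  rw [gammaFactor, mul_inv, norm_mul]
  refine (mul_le_mul h1 h2 (by positivity) (by positivity)).trans_eq ?_
  rw [mul_mul_mul_comm, ← Real.exp_add]
  ring_nf

lemma Real.rpow_le_exp_abs_mul {x y : ℝ} (hx : 1 ≤ x) (hxy : x ≤ Real.exp y) (s : ℝ) :
    x ^ s ≤ Real.exp (|s| * y) := by
  calc x ^ s ≤ x ^ |s| := Real.rpow_le_rpow_of_exponent_le hx (le_abs_self s)
    _ ≤ Real.exp y ^ |s| := by gcongr
    _ = _ := by rw [← Real.exp_mul, mul_comm]

/-- Phragmén–Lindelöf bound for `gammaFactor` after damping by `exp (-(π + ε) w)`. -/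
lemma exists_norm_gammaFactor_I_mul_mul_exp_le {a : ℝ} (ha : 0 < a) : ∃ C : ℝ, ∀ ε : ℝ, 0 < ε →
    ∀ w : ℂ, 0 ≤ w.re → ‖gammaFactor a (Complex.I * w)
      * Complex.exp (-((π + ε : ℝ) : ℂ) * w) * (w + 1) ^ ((2 * a - 1 : ℝ) : ℂ)‖ ≤ C := by
  obtain ⟨C, hC⟩ := exists_norm_gammaFactor_ofReal_mul_le a
  obtain ⟨A, hA0, hA⟩ := exists_norm_gammaFactor_le_exp a
  refine ⟨C, fun ε hε w hw => ?_⟩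
  set f : ℂ → ℂ := fun w => gammaFactor a (Complex.I * w)
      * Complex.exp (-((π + ε : ℝ) : ℂ) * w) * (w + 1) ^ ((2 * a - 1 : ℝ) : ℂ) with hf
  have hslit : ∀ w : ℂ, 0 ≤ w.re → w + 1 ∈ Complex.slitPlane := by
    intro w hw
    left
    simp
    linarith
  have hnorm : ∀ w : ℂ, 0 ≤ w.re → ‖f w‖ = ‖gammaFactor a (Complex.I * w)‖
      * Real.exp (-((π + ε) * w.re)) * ‖w + 1‖ ^ (2 * a - 1) := by
    intro w hw
    simp only [hf]
    rw [norm_mul, norm_mul, Complex.norm_exp, Complex.norm_cpow_real, ← Complex.ofReal_neg,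
      Complex.re_ofReal_mul, neg_mul]
  have hdiff : ∀ w : ℂ, 0 ≤ w.re → DifferentiableAt ℂ f w := by
    intro w hw
    refine DifferentiableAt.mul (DifferentiableAt.mul ?_ (by fun_prop)) ?_
    · exact ((differentiable_gammaFactor a).comp (by fun_prop :
        Differentiable ℂ fun w : ℂ => Complex.I * w)).differentiableAt
    · exact DifferentiableAt.cpow_const (by fun_prop) (hslit w hw)
  refine PhragmenLindelof.right_half_plane_of_bounded_on_real (f := f) (C := C)
    ?_ ?_ ?_ ?_ hw
  · refine DifferentiableOn.diffContOnCl fun z hz => ?_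
    rw [Complex.closure_setOfPred_lt_re] at hz
    exact (hdiff z hz).differentiableWithinAt
  · refine ⟨3 / 2, by norm_num, 12 * 2 ^ (3 / 2 : ℝ) + |2 * a - 1|,
      Asymptotics.IsBigO.of_bound A ?_⟩
    rw [Filter.eventually_inf_principal]
    filter_upwards [tendsto_norm_cobounded_atTop.eventually_ge_atTop (3 + |a|)] with w hw hre
    have hre : 0 < w.re := hre
    have hw3 : 1 ≤ ‖w‖ := by linarith [abs_nonneg a]
    rw [hnorm w hre.le, Real.norm_of_nonneg (by positivity),
      add_mul (12 * 2 ^ (3 / 2 : ℝ)), Real.exp_add, ← mul_assoc]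
    have hg : ‖gammaFactor a (Complex.I * w)‖
        ≤ A * Real.exp (12 * 2 ^ (3 / 2 : ℝ) * ‖w‖ ^ (3 / 2 : ℝ)) := by
      refine (hA _).trans ?_
      rw [norm_mul, Complex.norm_I, one_mul, mul_assoc (12 : ℝ),
        ← Real.mul_rpow (by norm_num) (by positivity)]
      gcongr
      linarith
    have he : Real.exp (-((π + ε) * w.re)) ≤ 1 := by
      rw [Real.exp_le_one_iff]
      have := Real.pi_pos
      have : 0 ≤ (π + ε) * w.re := by positivity
      linarith
    have hone : 1 ≤ ‖w + 1‖ := by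
      have := Complex.re_le_norm (w + 1)
      simp at this
      linarith
    have hp : ‖w + 1‖ ^ (2 * a - 1) ≤ Real.exp (|2 * a - 1| * ‖w‖ ^ (3 / 2 : ℝ)) := by
      refine Real.rpow_le_exp_abs_mul hone ?_ _
      have h1 : ‖w + 1‖ ≤ ‖w‖ + 1 := (norm_add_le _ _).trans_eq (by simp)
      have h2 : ‖w‖ ≤ ‖w‖ ^ (3 / 2 : ℝ) :=
        Real.self_le_rpow_of_one_le hw3 (by norm_num)
      linarith [Real.add_one_le_exp (‖w‖ ^ (3 / 2 : ℝ))]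
    calc _ ≤ (A * Real.exp (12 * 2 ^ (3 / 2 : ℝ) * ‖w‖ ^ (3 / 2 : ℝ))) * 1
          * Real.exp (|2 * a - 1| * ‖w‖ ^ (3 / 2 : ℝ)) := by gcongr
      _ = _ := by ring
  · have hG : 0 < Real.Gamma (a + 1) := Real.Gamma_pos_of_pos (by linarith)
    have hlim : Filter.Tendsto (fun x : ℝ => (2 / Real.Gamma (a + 1)) ^ 2 * 2 ^ |2 * a - 1|
        * (x ^ (2 + (2 * a - 1)) * Real.exp (-ε * x))) Filter.atTop
        (nhds ((2 / Real.Gamma (a + 1)) ^ 2 * 2 ^ |2 * a - 1| * 0)) :=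
      (tendsto_rpow_mul_exp_neg_mul_atTop_nhds_zero _ ε hε).const_mul _
    refine hlim.isBoundedUnder_le.mono_le ?_
    filter_upwards [Filter.eventually_ge_atTop (max a 1)] with x hx
    have hxa : a ≤ x := (le_max_left _ _).trans hx
    have hx1 : 1 ≤ x := (le_max_right _ _).trans hx
    have hx0 : 0 < x := by linarith
    have h1 := norm_gammaFactor_mul_I_le ha x
    rw [abs_of_pos hx0] at h1
    rw [hnorm _ (by simpa using hx0.le), mul_comm Complex.I]
    have h2 : ‖(x : ℂ) + 1‖ ^ (2 * a - 1) ≤ 2 ^ |2 * a - 1| * x ^ (2 * a - 1) := by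
      have e : ‖(x : ℂ) + 1‖ = x + 1 := by
        rw [← Complex.ofReal_one, ← Complex.ofReal_add, Complex.norm_real,
          Real.norm_of_nonneg (by positivity)]
      rw [e]
      exact Real.rpow_le_mul_rpow_of_le_mul one_le_two hx0 (by linarith) (by linarith)
        (by linarith) _
    calc _ ≤ (((a + x) / Real.Gamma (a + 1)) ^ 2 * Real.exp (π * x))
          * Real.exp (-((π + ε) * (x : ℂ).re)) * (2 ^ |2 * a - 1| * x ^ (2 * a - 1)) := by
          gcongr
      _ ≤ ((2 * x / Real.Gamma (a + 1)) ^ 2 * Real.exp (π * x))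
          * Real.exp (-((π + ε) * (x : ℂ).re)) * (2 ^ |2 * a - 1| * x ^ (2 * a - 1)) := by
          gcongr
          linarith
      _ = (2 / Real.Gamma (a + 1)) ^ 2 * 2 ^ |2 * a - 1| * ((x ^ (2 : ℕ) * x ^ (2 * a - 1))
          * (Real.exp (π * x) * Real.exp (-((π + ε) * x)))) := by
          rw [Complex.ofReal_re]
          ring
      _ = _ := by
          rw [← Real.exp_add, ← Real.rpow_natCast x, ← Real.rpow_add hx0]
          push_cast
          ring_nf
  · intro x
    rw [hnorm _ (by simp)]
    have e : Complex.I * (x * Complex.I) = -(x : ℂ) := by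
      rw [mul_left_comm, Complex.I_mul_I]
      ring
    rw [e, gammaFactor_neg, add_comm _ (1 : ℂ)]
    simpa using hC x

/-- Growth of `1 / (Γ(a + z) Γ(a - z))` in the closed upper half-plane. -/
lemma exists_norm_gammaFactor_le {a : ℝ} (ha : 0 < a) : ∃ C : ℝ, 0 ≤ C ∧ ∀ z : ℂ, 0 ≤ z.im →
    ‖gammaFactor a z‖ ≤ C * (1 + ‖z‖) ^ (1 - 2 * a) * Real.exp (π * z.im) := by
  obtain ⟨C, hC⟩ := exists_norm_gammaFactor_I_mul_mul_exp_le ha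
  have hC0 : 0 ≤ C := (norm_nonneg _).trans (hC 1 one_pos 0 (by simp))
  refine ⟨C * 2 ^ |1 - 2 * a|, by positivity, fun z hz => ?_⟩
  set w : ℂ := -Complex.I * z with hw
  have hwre : w.re = z.im := by simp [hw]
  have hwz : Complex.I * w = z := by
    rw [hw, ← mul_assoc]
    simp
  have hwn : ‖w‖ = ‖z‖ := by simp [hw]
  have hre1 : 1 ≤ ‖w + 1‖ := by
    have := Complex.re_le_norm (w + 1)
    simp only [Complex.add_re, Complex.one_re, hwre] at this
    linarith
  have hpos : 0 < ‖w + 1‖ := by linarith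
  have hlim : ‖gammaFactor a z‖ * Real.exp (-(π * z.im)) * ‖w + 1‖ ^ (2 * a - 1) ≤ C := by
    have ht : Filter.Tendsto (fun ε : ℝ => ‖gammaFactor a z‖ * Real.exp (-((π + ε) * z.im))
        * ‖w + 1‖ ^ (2 * a - 1)) (nhdsWithin 0 (Set.Ioi 0))
        (nhds (‖gammaFactor a z‖ * Real.exp (-((π + 0) * z.im)) * ‖w + 1‖ ^ (2 * a - 1))) :=
      (Continuous.tendsto (by fun_prop) 0).mono_left nhdsWithin_le_nhds
    rw [add_zero] at ht
    refine le_of_tendsto ht ?_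
    filter_upwards [self_mem_nhdsWithin] with ε hε
    have h := hC ε hε w (by rw [hwre]; exact hz)
    rwa [norm_mul, norm_mul, Complex.norm_exp, Complex.norm_cpow_real, hwz, ← Complex.ofReal_neg,
      Complex.re_ofReal_mul, neg_mul, hwre] at h
  have hcmp : ‖w + 1‖ ^ (1 - 2 * a) ≤ 2 ^ |1 - 2 * a| * (1 + ‖z‖) ^ (1 - 2 * a) := by
    refine Real.rpow_le_mul_rpow_of_le_mul one_le_two (by positivity) hpos ?_ ?_ _
    · have h1 : ‖w‖ ≤ ‖w + 1‖ := by
        rw [← sq_le_sq₀ (norm_nonneg _) (norm_nonneg _), ← Complex.normSq_eq_norm_sq,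
          ← Complex.normSq_eq_norm_sq, Complex.normSq_apply, Complex.normSq_apply]
        simp only [Complex.add_re, Complex.one_re, Complex.add_im, Complex.one_im, hwre]
        nlinarith
      linarith
    · have h1 : ‖w + 1‖ ≤ ‖w‖ + 1 := (norm_add_le _ _).trans_eq (by simp)
      linarith [norm_nonneg z]
  have hcancel : ‖w + 1‖ ^ (2 * a - 1) * ‖w + 1‖ ^ (1 - 2 * a) = 1 := by
    rw [← Real.rpow_add hpos]
    simp
  have hexp : Real.exp (-(π * z.im)) * Real.exp (π * z.im) = 1 := by
    rw [← Real.exp_add]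
    simp
  calc ‖gammaFactor a z‖ = ‖gammaFactor a z‖
        * (Real.exp (-(π * z.im)) * Real.exp (π * z.im))
        * (‖w + 1‖ ^ (2 * a - 1) * ‖w + 1‖ ^ (1 - 2 * a)) := by rw [hcancel, hexp]; ring
    _ = (‖gammaFactor a z‖ * Real.exp (-(π * z.im)) * ‖w + 1‖ ^ (2 * a - 1))
        * ‖w + 1‖ ^ (1 - 2 * a) * Real.exp (π * z.im) := by ring
    _ ≤ C * (2 ^ |1 - 2 * a| * (1 + ‖z‖) ^ (1 - 2 * a)) * Real.exp (π * z.im) := by gcongr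
    _ = _ := by ring

lemma Real.exists_one_add_mul_rpow_le {b : ℝ} (hb : 0 < b) (s : ℝ) :
    ∃ C : ℝ, 0 ≤ C ∧ ∀ r : ℝ, 0 ≤ r → (1 + b * r) ^ s ≤ C * (1 + r) ^ s := by
  have hi : 0 < b⁻¹ := by positivity
  refine ⟨(1 + b + b⁻¹) ^ |s|, by positivity, fun r hr => ?_⟩
  refine Real.rpow_le_mul_rpow_of_le_mul (by linarith) (by positivity) (by positivity) ?_ ?_ s
  · have : b⁻¹ * (b * r) = r := by field_simp
    nlinarith [mul_nonneg hb.le hr, mul_nonneg hb.le (mul_nonneg hb.le hr)]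
  · nlinarith [mul_nonneg hi.le hr]

lemma exists_norm_prod_gammaFactor_le (s : Finset ℕ) {α β : ℕ → ℝ}
    (hα : ∀ k ∈ s, 0 < α k) (hβ : ∀ k ∈ s, 0 < β k) :
    ∃ C : ℝ, 0 ≤ C ∧ ∀ z : ℂ, 0 ≤ z.im → ‖∏ k ∈ s, gammaFactor (α k) (β k * z)‖
      ≤ C * (1 + ‖z‖) ^ ((s.card : ℝ) - 2 * ∑ k ∈ s, α k)
        * Real.exp (π * (∑ k ∈ s, β k) * z.im) := by
  have hone : ∀ k ∈ s, ∃ C : ℝ, 0 ≤ C ∧ ∀ z : ℂ, 0 ≤ z.im → ‖gammaFactor (α k) (β k * z)‖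
      ≤ C * (1 + ‖z‖) ^ (1 - 2 * α k) * Real.exp (π * β k * z.im) := by
    intro k hk
    obtain ⟨C, hC0, hC⟩ := exists_norm_gammaFactor_le (hα k hk)
    obtain ⟨K, hK0, hK⟩ := Real.exists_one_add_mul_rpow_le (hβ k hk) (1 - 2 * α k)
    refine ⟨C * K, by positivity, fun z hz => ?_⟩
    have h := hC (β k * z) (by simpa using mul_nonneg (hβ k hk).le hz)
    rw [norm_mul, Complex.norm_real, Real.norm_of_nonneg (hβ k hk).le,
      Complex.im_ofReal_mul] at h
    refine h.trans ?_
    rw [mul_assoc C K, mul_assoc π]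
    gcongr
    exact hK _ (norm_nonneg z)
  choose! C hC0 hC using hone
  refine ⟨∏ k ∈ s, C k, Finset.prod_nonneg hC0, fun z hz => ?_⟩
  rw [norm_prod]
  refine (Finset.prod_le_prod (fun _ _ => norm_nonneg _) fun k hk => hC k hk z hz).trans_eq ?_
  rw [Finset.prod_mul_distrib, Finset.prod_mul_distrib, ← Real.exp_sum,
    ← Real.rpow_sum_of_pos (by positivity), Finset.sum_sub_distrib, ← Finset.mul_sum,
    ← Finset.sum_mul, ← Finset.mul_sum]
  simp

/-- Cauchy's theorem on the squares `[0, R] × [0, R]` for a function that decays faster than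
`1 / ‖z‖` in the upper half-plane and is real on the positive imaginary axis. -/
lemma tendsto_intervalIntegral_re_of_norm_le_rpow {F : ℂ → ℂ} {C e : ℝ} (he : e < -1)
    (hcont : ∀ z : ℂ, 0 ≤ z.im → ContinuousAt F z)
    (hdiff : ∀ z : ℂ, 0 < z.im → DifferentiableAt ℂ F z)
    (hbound : ∀ z : ℂ, 0 ≤ z.im → ‖F z‖ ≤ C * (1 + ‖z‖) ^ e)
    (himag : ∀ y : ℝ, 0 ≤ y → (F (y * Complex.I)).im = 0) :
    Filter.Tendsto (fun R : ℝ => ∫ x in (0 : ℝ)..R, (F x).re) Filter.atTop (nhds 0) := by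
  have hC0 : 0 ≤ C := by
    have := (norm_nonneg _).trans (hbound 0 (by simp))
    simpa using this
  have hlim : Filter.Tendsto (fun R : ℝ => 2 * C * R ^ (e + 1)) Filter.atTop (nhds 0) := by
    have := (tendsto_rpow_neg_atTop (y := -(e + 1)) (by linarith)).const_mul (2 * C)
    simpa using this
  refine squeeze_zero_norm' ?_ hlim
  filter_upwards [Filter.eventually_gt_atTop 0] with R hR
  have hrect := Complex.integral_boundary_rect_eq_zero_of_continuousOn_of_differentiableOn F 0
    (R + R * Complex.I) ?_ ?_
  rotate_left
  · intro z hz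
    have hz2 := hz.2
    simp only [Set.mem_preimage, Complex.zero_im, Complex.add_im, Complex.ofReal_im,
      Complex.im_ofReal_mul, Complex.I_im, mul_one, zero_add, Set.uIcc_of_le hR.le] at hz2
    exact (hcont z hz2.1).continuousWithinAt
  · intro z hz
    have hz2 := hz.2
    simp only [Set.mem_preimage, Complex.zero_im, Complex.add_im, Complex.ofReal_im,
      Complex.im_ofReal_mul, Complex.I_im, mul_one, zero_add, min_eq_left hR.le] at hz2
    exact (hdiff z hz2.1).differentiableWithinAt
  simp only [Complex.zero_re, Complex.zero_im, Complex.add_re, Complex.add_im, Complex.ofReal_re,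
    Complex.ofReal_im, Complex.re_ofReal_mul, Complex.im_ofReal_mul, Complex.I_re, Complex.I_im,
    mul_zero, mul_one, add_zero, zero_add, Complex.ofReal_zero, zero_mul, smul_eq_mul] at hrect
  have hle : ∀ z : ℂ, 0 ≤ z.im → R ≤ ‖z‖ → ‖F z‖ ≤ C * R ^ e := by
    intro z hz hRz
    refine (hbound z hz).trans (mul_le_mul_of_nonneg_left ?_ hC0)
    exact Real.rpow_le_rpow_of_nonpos hR (by linarith) (by linarith)
  have htop : ‖∫ x in (0 : ℝ)..R, F (x + R * Complex.I)‖ ≤ C * R ^ e * |R - 0| := by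
    refine intervalIntegral.norm_integral_le_of_norm_le_const fun x _ => ?_
    refine hle _ (by simpa using hR.le) ?_
    simpa using Complex.im_le_norm ((x : ℂ) + R * Complex.I)
  have hright : ‖∫ y in (0 : ℝ)..R, F (R + y * Complex.I)‖ ≤ C * R ^ e * |R - 0| := by
    refine intervalIntegral.norm_integral_le_of_norm_le_const fun y hy => ?_
    rw [Set.uIoc_of_le hR.le] at hy
    refine hle _ (by simpa using hy.1.le) ?_
    simpa using Complex.re_le_norm ((R : ℂ) + y * Complex.I)
  have hleft : (∫ y in (0 : ℝ)..R, F (y * Complex.I)).im = 0 := by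
    have hc : ContinuousOn (fun y : ℝ => F (y * Complex.I)) (Set.uIcc 0 R) := by
      intro y hy
      rw [Set.uIcc_of_le hR.le] at hy
      refine (ContinuousAt.comp (g := F) (f := fun y : ℝ => (y : ℂ) * Complex.I)
        (hcont _ (by simpa using hy.1)) (by fun_prop)).continuousWithinAt
    have h := Complex.imCLM.intervalIntegral_comp_comm (μ := volume) hc.intervalIntegrable
    simp only [Complex.imCLM_apply] at h
    rw [← h]
    refine intervalIntegral.integral_zero_ae (Filter.Eventually.of_forall fun y hy => ?_)
    rw [Set.uIoc_of_le hR.le] at hy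
    exact himag y hy.1.le
  have hbottom : ∫ x in (0 : ℝ)..R, (F x).re = (∫ x in (0 : ℝ)..R, F x).re := by
    have hc : ContinuousOn (fun x : ℝ => F x) (Set.uIcc 0 R) := fun x _ =>
      (ContinuousAt.comp (g := F) (f := fun x : ℝ => (x : ℂ))
        (hcont _ (by simp)) (by fun_prop)).continuousWithinAt
    have h := Complex.reCLM.intervalIntegral_comp_comm (μ := volume) hc.intervalIntegrable
    simpa only [Complex.reCLM_apply] using h
  have hsplit : ∫ x in (0 : ℝ)..R, (F x).re = (∫ x in (0 : ℝ)..R, F (x + R * Complex.I)).re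
      + (∫ y in (0 : ℝ)..R, F (R + y * Complex.I)).im := by
    have h := congrArg Complex.re hrect
    simp only [Complex.sub_re, Complex.add_re, Complex.I_mul_re, hleft, Complex.zero_re] at h
    rw [hbottom]
    linarith
  rw [hsplit, Real.norm_eq_abs]
  calc _ ≤ C * R ^ e * |R - 0| + C * R ^ e * |R - 0| :=
        (abs_add_le _ _).trans (add_le_add ((Complex.abs_re_le_norm _).trans htop)
          ((Complex.abs_im_le_norm _).trans hright))
    _ = 2 * C * R ^ (e + 1) := by
        rw [sub_zero, abs_of_pos hR, Real.rpow_add_one hR.ne']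
        ring

lemma exists_pow_mul_besselJ_eq_re_hankelKernel {n : ℕ} (hn : 1 ≤ n) :
    ∃ C : ℝ, ∀ x : ℝ, 0 < x → x ^ n * besselJ n x
      = C * (-Complex.I * Complex.exp (Complex.I * x) * hankelKernel ((n : ℝ) - 1 / 2) x).re := by
  obtain ⟨C, hC⟩ := exists_besselJ_eq_mul_integral n hn
  have hp : (0 : ℝ) < (n : ℝ) - 1 / 2 := by
    have : (1 : ℝ) ≤ n := by exact_mod_cast hn
    linarith
  refine ⟨C, fun x hx => ?_⟩
  rw [← integral_cos_mul_rpow_eq_re_hankelKernel hp hx, hC]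
  have hsub := intervalIntegral.mul_integral_comp_mul_left (a := 0) (b := 1)
    (f := fun s : ℝ => Real.cos s * (x ^ 2 - s ^ 2) ^ ((n : ℝ) - 1 / 2)) x
  rw [mul_zero, mul_one] at hsub
  have hcongr : ∫ t in (0 : ℝ)..1, Real.cos (x * t) * (x ^ 2 - (x * t) ^ 2) ^ ((n : ℝ) - 1 / 2)
      = (x ^ 2) ^ ((n : ℝ) - 1 / 2)
        * ∫ t in (0 : ℝ)..1, Real.cos (x * t) * (1 - t ^ 2) ^ ((n : ℝ) - 1 / 2) := by
    rw [← intervalIntegral.integral_const_mul]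
    refine intervalIntegral.integral_congr fun t ht => ?_
    rw [Set.uIcc_of_le zero_le_one] at ht
    have h1 : 0 ≤ 1 - t ^ 2 := by nlinarith [ht.1, ht.2]
    rw [show x ^ 2 - (x * t) ^ 2 = x ^ 2 * (1 - t ^ 2) by ring, Real.mul_rpow (by positivity) h1]
    ring
  have hpow : x * (x ^ 2) ^ ((n : ℝ) - 1 / 2) = x ^ n * x ^ n := by
    rw [← Real.rpow_natCast x 2, ← Real.rpow_mul hx.le, ← pow_add, ← Real.rpow_natCast x (n + n),
      ← Real.rpow_one_add' hx.le]
    · congr 1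
      push_cast
      ring
    · push_cast
      linarith
  rw [← hsub, hcongr, ← mul_assoc x, hpow]
  ring

theorem hankel_gamma_vanishes_odd_order
    (M : ℕ) (hM : 1 ≤ M) (α β : ℕ → ℝ)
    (hα : ∀ k ∈ Finset.range M, 0 < α k) (hβ : ∀ k ∈ Finset.range M, 0 < β k)
    (m l : ℕ) (hl : l < m)
    (hαsum : (m : ℝ) + (1 / 2) * ((M : ℝ) + 1 / 2) < ∑ k ∈ Finset.range M, α k)
    (lam : ℝ) (hlam : π * ∑ k ∈ Finset.range M, β k ≤ lam) :
    ∫ x in Set.Ioi (0 : ℝ), x ^ (2 * m) * besselJ (2 * l + 1) (lam * x) * gammaProd M α β x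
      = 0 := by
  by_cases hinteg : IntegrableOn (fun x : ℝ => x ^ (2 * m) * besselJ (2 * l + 1) (lam * x)
    * gammaProd M α β x) (Set.Ioi 0)
  swap
  · exact integral_undef hinteg
  refine tendsto_nhds_unique (intervalIntegral_tendsto_integral_Ioi 0 hinteg Filter.tendsto_id) ?_
  have hlam0 : 0 < lam := by
    refine lt_of_lt_of_le (mul_pos Real.pi_pos (Finset.sum_pos hβ ?_)) hlam
    exact Finset.nonempty_range_iff.2 (by omega)
  obtain ⟨r, rfl⟩ : ∃ r, m = l + 1 + r := ⟨m - (l + 1), by omega⟩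
  set n : ℕ := 2 * l + 1 with hn
  set p : ℝ := (n : ℝ) - 1 / 2 with hp_def
  have hp : 0 < p := by
    have : (1 : ℝ) ≤ n := by exact_mod_cast (by omega : 1 ≤ n)
    linarith
  obtain ⟨C, hC⟩ := exists_pow_mul_besselJ_eq_re_hankelKernel (n := n) (by omega)
  obtain ⟨D, hD0, hD⟩ := exists_norm_hankelKernel_le hp
  obtain ⟨K, hK0, hK⟩ := Real.exists_one_add_mul_rpow_le hlam0 p
  obtain ⟨G, hG0, hG⟩ := exists_norm_prod_gammaFactor_le (Finset.range M) hα hβ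
  set c : ℝ := C / lam ^ n with hc
  set W : ℂ → ℂ := fun z => c * z ^ (2 * r + 1)
    * (-Complex.I * Complex.exp (Complex.I * (lam * z)) * hankelKernel p (lam * z))
    * ∏ k ∈ Finset.range M, gammaFactor (α k) (β k * z) with hW
  have hprod : Differentiable ℂ fun z : ℂ =>
      ∏ k ∈ Finset.range M, gammaFactor (α k) (β k * z) := by
    refine Differentiable.fun_finsetProd fun k _ => ?_
    exact (differentiable_gammaFactor (α k)).comp (by fun_prop :
      Differentiable ℂ fun z : ℂ => (β k : ℂ) * z)
  have him : ∀ z : ℂ, ((lam : ℂ) * z).im = lam * z.im := fun z => Complex.im_ofReal_mul lam z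
  have hreal : ∀ x : ℝ, 0 < x → (W x).re
      = x ^ (2 * (l + 1 + r)) * besselJ n (lam * x) * gammaProd M α β x := by
    intro x hx
    have hJ := hC (lam * x) (by positivity)
    have hg : ∏ k ∈ Finset.range M, gammaFactor (α k) (β k * x) = (gammaProd M α β x : ℂ) := by
      rw [gammaProd, Complex.ofReal_prod]
      refine Finset.prod_congr rfl fun k _ => ?_
      rw [← Complex.ofReal_mul, gammaFactor_ofReal]
    simp only [hW]
    rw [hg, Complex.re_mul_ofReal, ← Complex.ofReal_pow, ← Complex.ofReal_mul,
      Complex.re_ofReal_mul, ← Complex.ofReal_mul]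
    congr 1
    rw [hc, div_mul_eq_mul_div, div_mul_eq_mul_div, div_eq_iff (by positivity)]
    calc _ = x ^ (2 * r + 1) * (C * (-Complex.I * Complex.exp (Complex.I * ((lam * x : ℝ) : ℂ))
          * hankelKernel p ((lam * x : ℝ) : ℂ)).re) := by ring
      _ = x ^ (2 * r + 1) * ((lam * x) ^ n * besselJ n (lam * x)) := by rw [hJ]
      _ = _ := by
        rw [mul_pow, show 2 * (l + 1 + r) = (2 * r + 1) + n by omega, pow_add]
        ring
  have hlimW : Filter.Tendsto (fun R : ℝ => ∫ x in (0 : ℝ)..R, (W x).re) Filter.atTop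
      (nhds 0) := by
    refine tendsto_intervalIntegral_re_of_norm_le_rpow (C := |c| * (D * K) * G)
      (e := (2 * r + 1) + p + (M - 2 * ∑ k ∈ Finset.range M, α k)) ?_ ?_ ?_ ?_ ?_
    · rw [hp_def, hn]
      push_cast at hαsum ⊢
      linarith
    · intro z hz
      have hk : ContinuousAt (fun z : ℂ => hankelKernel p (lam * z)) z :=
        ContinuousAt.comp (g := hankelKernel p) (f := fun z : ℂ => (lam : ℂ) * z)
          (continuousAt_hankelKernel hp (by rw [him]; positivity)) (by fun_prop)
      exact (ContinuousAt.mul (by fun_prop) (ContinuousAt.mul (by fun_prop) hk)).mul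
        hprod.continuous.continuousAt
    · intro z hz
      have hk : DifferentiableAt ℂ (fun z : ℂ => hankelKernel p (lam * z)) z :=
        DifferentiableAt.comp z (g := hankelKernel p) (f := fun z : ℂ => (lam : ℂ) * z)
          (differentiableAt_hankelKernel hp (by rw [him]; positivity)) (by fun_prop)
      exact (DifferentiableAt.mul (by fun_prop) (DifferentiableAt.mul (by fun_prop) hk)).mul
        hprod.differentiableAt
    · intro z hz
      have hpos : 0 < 1 + ‖z‖ := by positivity
      have hH : ‖hankelKernel p (lam * z)‖ ≤ D * K * (1 + ‖z‖) ^ p := by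
        refine (hD _).trans ?_
        rw [norm_mul, Complex.norm_real, Real.norm_of_nonneg hlam0.le, mul_assoc]
        exact mul_le_mul_of_nonneg_left (hK _ (norm_nonneg z)) hD0
      have hexp : ‖Complex.exp (Complex.I * (lam * z))‖ = Real.exp (-(lam * z.im)) := by
        rw [Complex.norm_exp, Complex.I_mul_re, him]
      have hz1 : ‖z‖ ^ (2 * r + 1) ≤ (1 + ‖z‖) ^ ((2 * r + 1 : ℝ)) := by
        rw [show (2 * r + 1 : ℝ) = ((2 * r + 1 : ℕ) : ℝ) by push_cast; ring, Real.rpow_natCast]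
        gcongr
        linarith
      have hdecay : Real.exp (-(lam * z.im))
          * Real.exp (π * (∑ k ∈ Finset.range M, β k) * z.im) ≤ 1 := by
        rw [← Real.exp_add, Real.exp_le_one_iff]
        nlinarith [mul_le_mul_of_nonneg_right hlam hz]
      have hGz := hG z hz
      rw [Finset.card_range] at hGz
      simp only [hW]
      rw [norm_mul, norm_mul, norm_mul, norm_mul, norm_mul, norm_pow, norm_neg, Complex.norm_I,
        one_mul, hexp, Complex.norm_real, Real.norm_eq_abs]
      calc _ ≤ |c| * (1 + ‖z‖) ^ ((2 * r + 1 : ℝ))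
            * (Real.exp (-(lam * z.im)) * (D * K * (1 + ‖z‖) ^ p))
            * (G * (1 + ‖z‖) ^ ((M : ℝ) - 2 * ∑ k ∈ Finset.range M, α k)
              * Real.exp (π * (∑ k ∈ Finset.range M, β k) * z.im)) := by gcongr
        _ = |c| * (D * K) * G * ((1 + ‖z‖) ^ ((2 * r + 1 : ℝ)) * (1 + ‖z‖) ^ p
              * (1 + ‖z‖) ^ ((M : ℝ) - 2 * ∑ k ∈ Finset.range M, α k))
            * (Real.exp (-(lam * z.im))
              * Real.exp (π * (∑ k ∈ Finset.range M, β k) * z.im)) := by ring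
        _ ≤ |c| * (D * K) * G * ((1 + ‖z‖) ^ ((2 * r + 1 : ℝ)) * (1 + ‖z‖) ^ p
              * (1 + ‖z‖) ^ ((M : ℝ) - 2 * ∑ k ∈ Finset.range M, α k)) * 1 := by gcongr
        _ = _ := by rw [mul_one, ← Real.rpow_add hpos, ← Real.rpow_add hpos]
    · intro y hy
      have hg : (∏ k ∈ Finset.range M, gammaFactor (α k) (β k * (y * Complex.I))).im = 0 := by
        rw [← Complex.conj_eq_iff_im, map_prod]
        refine Finset.prod_congr rfl fun k _ => ?_
        rw [Complex.conj_eq_iff_im, ← mul_assoc, ← Complex.ofReal_mul]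
        exact gammaFactor_mul_I_im _ _
      have hH : (hankelKernel p (lam * (y * Complex.I))).im = 0 := by
        rw [← mul_assoc, ← Complex.ofReal_mul]
        exact hankelKernel_mul_I_im p (by positivity)
      have hexp : Complex.exp (Complex.I * (lam * (y * Complex.I)))
          = (Real.exp (-(lam * y)) : ℂ) := by
        rw [Complex.ofReal_exp]
        congr 1
        push_cast
        linear_combination (lam * y : ℂ) * Complex.I_sq
      have hpow : (y * Complex.I) ^ (2 * r + 1) * -Complex.I
          = ((y ^ (2 * r + 1) * (-1) ^ r : ℝ) : ℂ) := by
        rw [mul_pow, pow_succ Complex.I, pow_mul, Complex.I_sq]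
        push_cast
        linear_combination (-(y : ℂ) ^ (2 * r + 1) * (-1) ^ r) * Complex.I_sq
      rw [← Complex.conj_eq_iff_im] at hg hH ⊢
      have hform : W (y * Complex.I) = c * ((y ^ (2 * r + 1) * (-1) ^ r : ℝ) : ℂ)
          * (Real.exp (-(lam * y)) : ℂ) * hankelKernel p (lam * (y * Complex.I))
          * ∏ k ∈ Finset.range M, gammaFactor (α k) (β k * (y * Complex.I)) := by
        simp only [hW]
        rw [hexp, ← hpow]
        ring
      rw [hform]
      simp only [map_mul, hg, hH, Complex.conj_ofReal]
  refine hlimW.congr' ?_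
  filter_upwards [Filter.eventually_ge_atTop 0] with R hR
  refine intervalIntegral.integral_congr_ae (Filter.Eventually.of_forall fun x hx => ?_)
  rw [Set.uIoc_of_le hR] at hx
  exact hreal x hx.1
end

section
/- Let M ≥ 1 be an integer, let α_k, β_k > 0 for k = 1,…,M, let m be a nonnegative integer, and suppose ∑_{k=1}^M α_k > m + (1/2)(M + 3/2) and λ ≥ π·∑_{k=1}^M β_k. Then ∫_0^∞ x^{2m+1}·J_{2m+2}(λx)·g_M(x) dx = ((2m+1)! / (2·∏_{k=1}^M Γ(α_k)^2)) · (2/λ)^{2(m+1)}. -/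
open MeasureTheory Real

open Filter Topology Set

/-- The entire function `∑ y ^ j / (j! (k + j)!)`, so that
`J_k(x) = (x/2)^k * besselE k (-x²/4)`. -/
noncomputable def besselE (k : ℕ) (y : ℝ) : ℝ :=
  ∑' j : ℕ, y ^ j / (Nat.factorial j * Nat.factorial (k + j))

lemma summable_besselE (k : ℕ) (y : ℝ) :
    Summable fun j : ℕ ↦ y ^ j / (Nat.factorial j * Nat.factorial (k + j) : ℝ) := by
  refine Summable.of_norm_bounded (g := fun j ↦ |y| ^ j / (Nat.factorial j : ℝ))
    (Real.summable_pow_div_factorial |y|) fun j ↦ ?_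
  rw [norm_div, norm_pow, Real.norm_eq_abs, norm_mul, Real.norm_natCast, Real.norm_natCast]
  have h : (1 : ℝ) ≤ (Nat.factorial (k + j) : ℝ) := by exact_mod_cast Nat.factorial_pos _
  have h' : (0 : ℝ) < (Nat.factorial j : ℝ) := by positivity
  gcongr
  nlinarith

lemma besselJ_eq (k : ℕ) (x : ℝ) : besselJ k x = (x / 2) ^ k * besselE k (-(x ^ 2 / 4)) := by
  rw [besselJ, besselE, ← tsum_mul_left]
  refine tsum_congr fun j ↦ ?_
  have : -(x ^ 2 / 4) = -1 * (x / 2) ^ 2 := by ring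
  rw [this, mul_pow, ← pow_mul, pow_add]
  ring

lemma hasDerivAt_besselE (k : ℕ) (y : ℝ) : HasDerivAt (besselE k) (besselE (k + 1) y) y := by
  have hshift : ∀ (j : ℕ) (z : ℝ),
      ((j + 1 : ℕ) : ℝ) * z ^ j / (Nat.factorial (j + 1) * Nat.factorial (k + (j + 1)))
        = z ^ j / (Nat.factorial j * Nat.factorial (k + 1 + j)) := by
    intro j z
    rw [Nat.factorial_succ, show k + (j + 1) = k + 1 + j by ring]
    push_cast
    have : (j : ℝ) + 1 ≠ 0 := by positivity
    field_simp
  have hu : Summable fun j : ℕ ↦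
      (j : ℝ) * (|y| + 1) ^ (j - 1) / (Nat.factorial j * Nat.factorial (k + j)) := by
    rw [← summable_nat_add_iff 1]
    refine (summable_besselE (k + 1) (|y| + 1)).congr fun j ↦ ?_
    exact (hshift j (|y| + 1)).symm
  have h := hasDerivAt_tsum_of_isPreconnected (𝕜 := ℝ)
    (g := fun j z ↦ z ^ j / (Nat.factorial j * Nat.factorial (k + j) : ℝ))
    (g' := fun j z ↦ (j : ℝ) * z ^ (j - 1) / (Nat.factorial j * Nat.factorial (k + j) : ℝ))
    (t := Metric.ball 0 (|y| + 1)) (y₀ := y) (y := y) hu Metric.isOpen_ball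
    (convex_ball _ _).isPreconnected
    (fun n z _ ↦ (hasDerivAt_pow n z).div_const _)
    (fun n z hz ↦ by
      have hz' : |z| ≤ |y| + 1 := by
        rw [mem_ball_zero_iff, Real.norm_eq_abs] at hz; exact hz.le
      rw [norm_div, norm_mul, norm_mul, norm_pow, Real.norm_natCast, Real.norm_natCast,
        Real.norm_natCast, Real.norm_eq_abs]
      gcongr)
    (by simp) (summable_besselE k y) (by simp)
  refine h.congr_deriv ?_
  have hs : Summable fun j : ℕ ↦
      (j : ℝ) * y ^ (j - 1) / (Nat.factorial j * Nat.factorial (k + j)) := by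
    rw [← summable_nat_add_iff 1]
    exact (summable_besselE (k + 1) y).congr fun j ↦ (hshift j y).symm
  rw [hs.tsum_eq_zero_add, besselE]
  simp only [Nat.cast_zero, zero_mul, zero_div, zero_add, Nat.add_sub_cancel]
  exact tsum_congr fun j ↦ hshift j y

lemma besselE_recurrence (k : ℕ) (y : ℝ) :
    besselE k y = (k + 1) * besselE (k + 1) y + y * besselE (k + 2) y := by
  have h2 : HasSum (fun j : ℕ ↦ (j : ℝ) * y ^ j / (Nat.factorial j * Nat.factorial (k + 1 + j)))
      (y * besselE (k + 2) y) := by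
    rw [← hasSum_nat_add_iff' 1]
    simp only [Finset.range_one, Finset.sum_singleton, Nat.cast_zero, zero_mul, zero_div, sub_zero]
    refine ((summable_besselE (k + 2) y).hasSum.mul_left y).congr_fun fun j ↦ ?_
    rw [Nat.factorial_succ, show k + 1 + (j + 1) = k + 2 + j by ring, pow_succ]
    push_cast
    have : (j : ℝ) + 1 ≠ 0 := by positivity
    field_simp
  refine (((summable_besselE (k + 1) y).hasSum.mul_left ((k : ℝ) + 1)).add h2).tsum_eq ▸ ?_
  rw [besselE]
  refine tsum_congr fun j ↦ ?_
  rw [show k + 1 + j = (k + j) + 1 by ring, Nat.factorial_succ]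
  push_cast
  have : (k : ℝ) + j + 1 ≠ 0 := by positivity
  field_simp
  ring

lemma hasDerivAt_besselE_comp (k : ℕ) (x : ℝ) :
    HasDerivAt (fun x ↦ besselE k (-(x ^ 2 / 4))) (-(x / 2) * besselE (k + 1) (-(x ^ 2 / 4))) x := by
  have h : HasDerivAt (fun x : ℝ ↦ -(x ^ 2 / 4)) (-(x / 2)) x := by
    have := ((hasDerivAt_pow 2 x).div_const 4).neg
    refine this.congr_deriv ?_
    norm_num; ring
  exact ((hasDerivAt_besselE k _).comp x h).congr_deriv (by ring)

lemma hasDerivAt_besselJ_down (k : ℕ) {x : ℝ} (hx : x ≠ 0) :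
    HasDerivAt (besselJ k) (k / x * besselJ k x - besselJ (k + 1) x) x := by
  have h := (((hasDerivAt_id x).div_const 2).pow k).mul (hasDerivAt_besselE_comp k x)
  have e : besselJ k = (fun x ↦ id x / 2) ^ k * fun x ↦ besselE k (-(x ^ 2 / 4)) := by
    ext x; simp [besselJ_eq]
  rw [e]
  refine h.congr_deriv ?_
  rw [← e]
  simp only [besselJ_eq, Pi.pow_apply, id]
  rcases k with _ | k
  · simp
  · simp only [Nat.add_sub_cancel]
    field_simp
    ring

lemma hasDerivAt_besselJ_up (k : ℕ) {x : ℝ} (hx : x ≠ 0) :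
    HasDerivAt (besselJ (k + 1)) (besselJ k x - (k + 1) / x * besselJ (k + 1) x) x := by
  refine (hasDerivAt_besselJ_down (k + 1) hx).congr_deriv ?_
  rw [besselJ_eq, besselJ_eq, besselJ_eq, besselE_recurrence k (-(x ^ 2 / 4)), pow_succ (x / 2),
    pow_succ (x / 2)]
  push_cast
  field_simp
  ring

lemma hasDerivAt_besselJ_zero (x : ℝ) : HasDerivAt (besselJ 0) (-besselJ 1 x) x := by
  have e : besselJ 0 = fun x ↦ besselE 0 (-(x ^ 2 / 4)) := by ext x; simp [besselJ_eq]
  rw [e]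
  exact (hasDerivAt_besselE_comp 0 x).congr_deriv (by simp [besselJ_eq])

lemma continuous_besselJ (k : ℕ) : Continuous (besselJ k) := by
  have e : besselJ k = fun x ↦ (x / 2) ^ k * besselE k (-(x ^ 2 / 4)) := funext (besselJ_eq k)
  have h : Continuous (fun x : ℝ ↦ besselE k (-(x ^ 2 / 4))) :=
    continuous_iff_continuousAt.2 fun x ↦ (hasDerivAt_besselE_comp k x).continuousAt
  rw [e]
  fun_prop

lemma besselJ_zero_zero : besselJ 0 0 = 1 := by
  rw [besselJ_eq, besselE, tsum_eq_single 0]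
  · simp
  · intro j hj; simp [hj]

/-- The energy `x (J_k² + J_{k+1}²) - (2 k + 1) J_k J_{k+1}`, corrected by an exponential factor, is
nonincreasing for large `x`. -/
lemma exists_besselJ_sq_bound (k : ℕ) :
    ∃ C, ∀ x : ℝ, 2 * k + 1 ≤ x → x * (besselJ k x ^ 2 + besselJ (k + 1) x ^ 2) ≤ C := by
  set c : ℝ := 2 * k + 1 with hc
  have hc0 : 0 < c := by positivity
  set E : ℝ → ℝ := fun x ↦ (x * (besselJ k x ^ 2 + besselJ (k + 1) x ^ 2)
    - c * (besselJ k x * besselJ (k + 1) x)) with hE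
  set F : ℝ → ℝ := fun x ↦ E x * Real.exp (c / x) with hF
  have hEd : ∀ x, 0 < x → HasDerivAt E (c / x * (besselJ k x * besselJ (k + 1) x)) x := by
    intro x hx
    have h1 := hasDerivAt_besselJ_down k hx.ne'
    have h2 := hasDerivAt_besselJ_up k hx.ne'
    have := ((hasDerivAt_id x).mul ((h1.pow 2).add (h2.pow 2))).sub ((h1.mul h2).const_mul c)
    refine this.congr_deriv ?_
    simp only [id, hc, Pi.add_apply, Pi.pow_apply]
    push_cast
    field_simp
    ring
  have hFd : ∀ x, 0 < x → HasDerivAt F ((c / x * (besselJ k x * besselJ (k + 1) x)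
      - c / x ^ 2 * E x) * Real.exp (c / x)) x := by
    intro x hx
    have h1 : HasDerivAt (fun x : ℝ ↦ c / x) (-(c / x ^ 2)) x := by
      have := (hasDerivAt_inv hx.ne').const_mul c
      simpa [div_eq_mul_inv] using this
    exact ((hEd x hx).mul h1.exp).congr_deriv (by ring)
  have hElow : ∀ x, c ≤ x → x / 2 * (besselJ k x ^ 2 + besselJ (k + 1) x ^ 2) ≤ E x := by
    intro x hx
    simp only [hE]
    nlinarith [mul_nonneg hc0.le (sq_nonneg (besselJ k x - besselJ (k + 1) x)),
      mul_nonneg (sub_nonneg.2 hx) (add_nonneg (sq_nonneg (besselJ k x))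
        (sq_nonneg (besselJ (k + 1) x)))]
  have hanti : AntitoneOn F (Ici c) := by
    refine antitoneOn_of_deriv_nonpos (convex_Ici c)
      (fun x hx ↦ (hFd x (hc0.trans_le hx)).continuousAt.continuousWithinAt)
      (fun x hx ↦ ?_) (fun x hx ↦ ?_)
    · rw [interior_Ici] at hx
      exact (hFd x (hc0.trans hx)).differentiableAt.differentiableWithinAt
    · rw [interior_Ici] at hx
      have hx0 : 0 < x := hc0.trans hx
      rw [(hFd x hx0).deriv]
      refine mul_nonpos_of_nonpos_of_nonneg ?_ (Real.exp_pos _).le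
      have h1 := hElow x (le_of_lt hx)
      have h2 : besselJ k x * besselJ (k + 1) x ≤ E x / x := by
        rw [le_div_iff₀ hx0]
        nlinarith [mul_nonneg hx0.le (sq_nonneg (besselJ k x - besselJ (k + 1) x))]
      have h3 : c / x * (besselJ k x * besselJ (k + 1) x) ≤ c / x * (E x / x) := by gcongr
      have h4 : c / x * (E x / x) = c / x ^ 2 * E x := by field_simp
      linarith
  refine ⟨2 * F c, fun x hx ↦ ?_⟩
  have hx0 : 0 < x := hc0.trans_le hx
  have h1 := hElow x hx
  have h2 : F x ≤ F c := hanti (mem_Ici.2 le_rfl) (mem_Ici.2 hx) hx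
  have h3 : 0 ≤ E x := le_trans (by positivity) h1
  have h4 : E x ≤ F x := le_mul_of_one_le_right h3 (Real.one_le_exp (by positivity))
  linarith

lemma exists_besselJ_bound (k : ℕ) :
    ∃ C, 0 < C ∧ ∀ x : ℝ, 0 < x → |besselJ k x| ≤ C * x ^ (-(1 / 2) : ℝ) := by
  obtain ⟨C, hC⟩ := exists_besselJ_sq_bound k
  have hcont : ContinuousOn (fun x ↦ x * besselJ k x ^ 2) (Icc 0 (2 * k + 1)) :=
    (continuous_id.mul ((continuous_besselJ k).pow 2)).continuousOn
  obtain ⟨D, hD⟩ := isCompact_Icc.exists_bound_of_continuousOn hcont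
  set B := max 1 (max C D) with hB
  have hB1 : 1 ≤ B := le_max_left _ _
  have hsq : ∀ x, 0 < x → x * besselJ k x ^ 2 ≤ B := by
    intro x hx
    rcases le_total x (2 * k + 1) with h | h
    · exact (le_abs_self _).trans ((hD x ⟨hx.le, h⟩).trans
        ((le_max_right _ _).trans (le_max_right _ _)))
    · refine le_trans ?_ ((hC x h).trans ((le_max_left _ _).trans (le_max_right _ _)))
      gcongr
      exact le_add_of_nonneg_right (sq_nonneg _)
  refine ⟨√B, by positivity, fun x hx ↦ ?_⟩
  rw [Real.rpow_neg hx.le, ← Real.sqrt_eq_rpow, ← div_eq_mul_inv,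
    ← Real.sqrt_div (by positivity)]
  refine Real.abs_le_sqrt ?_
  rw [le_div_iff₀ hx]
  linarith [hsq x hx]

/-- The Laplace transform of `x ^ n * K x` over the half line. -/
noncomputable def laplaceMoment (K : ℝ → ℂ) (n : ℕ) (s : ℂ) : ℂ :=
  ∫ x in Ioi (0 : ℝ), (x : ℂ) ^ n * Complex.exp (-s * x) * K x

lemma integrableOn_laplaceMoment {K : ℝ → ℂ}
    (hK : ∀ ε : ℝ, 0 < ε → IntegrableOn (fun x : ℝ ↦ Complex.exp (-ε * x) * K x) (Ioi 0))
    (n : ℕ) {s : ℂ} (hs : 0 < s.re) :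
    IntegrableOn (fun x : ℝ ↦ (x : ℂ) ^ n * Complex.exp (-s * x) * K x) (Ioi 0) := by
  have hε : 0 < s.re / 2 := by positivity
  have h := (hK _ hε).bdd_mul (c := (Nat.factorial n : ℝ) / (s.re / 2) ^ n)
    (f := fun x : ℝ ↦ (x : ℂ) ^ n * Complex.exp (-(s - (s.re / 2 : ℝ)) * x))
    (Continuous.aestronglyMeasurable (by fun_prop)) ?_
  · refine h.congr (ae_of_all _ fun x ↦ ?_)
    simp only
    rw [← mul_assoc, mul_assoc ((x : ℂ) ^ n), ← Complex.exp_add]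
    congr 3
    ring
  · refine (ae_restrict_iff' measurableSet_Ioi).2 (ae_of_all _ fun x (hx : 0 < x) ↦ ?_)
    rw [norm_mul, norm_pow, Complex.norm_real, Complex.norm_exp, Real.norm_of_nonneg hx.le]
    have e : (-(s - (s.re / 2 : ℝ)) * x : ℂ).re = -(s.re / 2 * x) := by
      simp; ring
    rw [e, Real.exp_neg, ← div_eq_mul_inv, div_le_div_iff₀ (Real.exp_pos _) (by positivity),
      ← mul_pow]
    have := Real.pow_div_factorial_le_exp (s.re / 2 * x) (by positivity) n
    rw [div_le_iff₀ (by positivity)] at this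
    rw [mul_comm x, mul_comm (Nat.factorial n : ℝ)]
    exact this

lemma hasDerivAt_laplaceMoment {K : ℝ → ℂ}
    (hK : ∀ ε : ℝ, 0 < ε → IntegrableOn (fun x : ℝ ↦ Complex.exp (-ε * x) * K x) (Ioi 0))
    (n : ℕ) {s : ℂ} (hs : 0 < s.re) :
    HasDerivAt (laplaceMoment K n) (-laplaceMoment K (n + 1) s) s := by
  have hmem : {z : ℂ | s.re / 2 < z.re} ∈ 𝓝 s :=
    (isOpen_lt continuous_const Complex.continuous_re).mem_nhds
      (show s.re / 2 < s.re by linarith)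
  have hb := (integrableOn_laplaceMoment hK (n + 1) (s := ((s.re / 2 : ℝ) : ℂ))
    (by rw [Complex.ofReal_re]; positivity)).norm
  have hd := hasDerivAt_integral_of_dominated_loc_of_deriv_le (𝕜 := ℂ)
    (μ := volume.restrict (Ioi (0 : ℝ)))
    (F := fun s x ↦ (x : ℂ) ^ n * Complex.exp (-s * x) * K x)
    (F' := fun s x ↦ -((x : ℂ) ^ (n + 1) * Complex.exp (-s * x) * K x)) hmem ?_
    (integrableOn_laplaceMoment hK n hs)
    (integrableOn_laplaceMoment hK (n + 1) hs).neg.aestronglyMeasurable ?_ hb ?_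
  · rw [laplaceMoment, ← integral_neg]
    exact hd.2
  · filter_upwards [hmem] with z hz
    exact (integrableOn_laplaceMoment hK n
      (lt_trans (by positivity) (show s.re / 2 < z.re from hz))).aestronglyMeasurable
  · refine (ae_restrict_iff' measurableSet_Ioi).2 (ae_of_all _ fun x (hx : 0 < x) z hz ↦ ?_)
    have hz : s.re / 2 < z.re := hz
    rw [norm_neg, norm_mul, norm_mul, norm_mul, norm_mul, Complex.norm_exp, Complex.norm_exp]
    have e1 : (-z * x).re = -(z.re * x) := by simp
    have e2 : (-((s.re / 2 : ℝ) : ℂ) * x).re = -(s.re / 2 * x) := by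
      rw [← Complex.ofReal_neg, ← Complex.ofReal_mul, Complex.ofReal_re, neg_mul]
    rw [e1, e2]
    gcongr
  · refine ae_of_all _ fun x z _ ↦ ?_
    have h1 : HasDerivAt (fun z : ℂ ↦ -z * (x : ℂ)) (-(x : ℂ)) z := by
      simpa using ((hasDerivAt_id z).neg.mul_const (x : ℂ))
    refine ((h1.cexp.const_mul ((x : ℂ) ^ n)).mul_const (K x)).congr_deriv ?_
    ring

lemma integrableOn_exp_mul_besselJ (k : ℕ) (ε : ℝ) (hε : 0 < ε) :
    IntegrableOn (fun x : ℝ ↦ Complex.exp (-ε * x) * (besselJ k x : ℂ)) (Ioi 0) := by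
  obtain ⟨C, hC0, hC⟩ := exists_besselJ_bound k
  have hi := (integrableOn_rpow_mul_exp_neg_mul_rpow (p := 1) (s := -(1 / 2)) (b := ε)
    (by norm_num) one_pos hε).const_mul C
  refine hi.mono' ?_ ?_
  · have := continuous_besselJ k
    exact Continuous.aestronglyMeasurable (by fun_prop)
  · refine (ae_restrict_iff' measurableSet_Ioi).2 (ae_of_all _ fun x (hx : 0 < x) ↦ ?_)
    rw [norm_mul, Complex.norm_exp, Complex.norm_real, Real.norm_eq_abs, Real.rpow_one]
    have e : (-(ε : ℂ) * x).re = -ε * x := by simp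
    rw [e, ← mul_assoc, mul_comm]
    gcongr
    exact hC x hx

lemma tendsto_pow_mul_exp_mul_besselJ (k n : ℕ) {s : ℂ} (hs : 0 < s.re) :
    Tendsto (fun x : ℝ ↦ (x : ℂ) ^ n * Complex.exp (-s * x) * (besselJ k x : ℂ)) atTop (𝓝 0) := by
  obtain ⟨C, hC0, hC⟩ := exists_besselJ_bound k
  rw [tendsto_zero_iff_norm_tendsto_zero]
  have h1 : Tendsto (fun x : ℝ ↦ C * (x ^ (n : ℝ) * Real.exp (-s.re * x))) atTop (𝓝 0) := by
    simpa using (tendsto_rpow_mul_exp_neg_mul_atTop_nhds_zero (n : ℝ) s.re hs).const_mul C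
  refine squeeze_zero' (Eventually.of_forall fun x ↦ norm_nonneg _) ?_ h1
  filter_upwards [eventually_ge_atTop 1] with x hx
  have hx0 : 0 < x := by linarith
  rw [norm_mul, norm_mul, norm_pow, Complex.norm_exp, Complex.norm_real, Complex.norm_real,
    Real.norm_of_nonneg hx0.le, Real.rpow_natCast, mul_comm C]
  have e : (-s * x).re = -s.re * x := by simp
  rw [e]
  gcongr
  refine (hC x hx0).trans (mul_le_of_le_one_right hC0.le ?_)
  exact Real.rpow_le_one_of_one_le_of_nonpos hx (by norm_num)

lemma hasDerivAt_cexp_neg_mul (s : ℂ) (x : ℝ) :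
    HasDerivAt (fun x : ℝ ↦ Complex.exp (-s * x)) (-s * Complex.exp (-s * x)) x := by
  have h : HasDerivAt (fun x : ℝ ↦ -s * (x : ℂ)) (-s) x := by
    simpa using (Complex.ofRealCLM.hasDerivAt (x := x)).const_mul (-s)
  exact h.cexp.congr_deriv (by ring)

lemma laplace_besselJ_zero {s : ℂ} (hs : 0 < s.re) :
    s * laplaceMoment (fun x ↦ (besselJ 0 x : ℂ)) 0 s
      = 1 - laplaceMoment (fun x ↦ (besselJ 1 x : ℂ)) 0 s := by
  have i0 := integrableOn_laplaceMoment (integrableOn_exp_mul_besselJ 0) 0 hs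
  have i1 := integrableOn_laplaceMoment (integrableOn_exp_mul_besselJ 1) 0 hs
  have h := integral_Ioi_of_hasDerivAt_of_tendsto (a := 0) (m := 0)
    (f := fun x : ℝ ↦ (x : ℂ) ^ 0 * Complex.exp (-s * x) * (besselJ 0 x : ℂ))
    (f' := fun x : ℝ ↦ -s * ((x : ℂ) ^ 0 * Complex.exp (-s * x) * (besselJ 0 x : ℂ))
      - (x : ℂ) ^ 0 * Complex.exp (-s * x) * (besselJ 1 x : ℂ)) ?_ ?_ ?_
    (tendsto_pow_mul_exp_mul_besselJ 0 0 hs)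
  · rw [integral_sub (i0.const_mul (-s)) i1, integral_const_mul] at h
    simp only [laplaceMoment]
    simp [besselJ_zero_zero] at h ⊢
    linear_combination -h
  · have := continuous_besselJ 0
    exact Continuous.continuousWithinAt (by fun_prop)
  · intro x _
    simp only [pow_zero, one_mul]
    refine ((hasDerivAt_cexp_neg_mul s x).mul
      (hasDerivAt_besselJ_zero x).ofReal_comp).congr_deriv ?_
    push_cast
    ring
  · exact (i0.const_mul (-s)).sub i1

lemma laplace_mul_besselJ_one {s : ℂ} (hs : 0 < s.re) :
    s * laplaceMoment (fun x ↦ (besselJ 1 x : ℂ)) 1 s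
      = laplaceMoment (fun x ↦ (besselJ 0 x : ℂ)) 1 s := by
  have i0 := integrableOn_laplaceMoment (integrableOn_exp_mul_besselJ 0) 1 hs
  have i1 := integrableOn_laplaceMoment (integrableOn_exp_mul_besselJ 1) 1 hs
  have h := integral_Ioi_of_hasDerivAt_of_tendsto (a := 0) (m := 0)
    (f := fun x : ℝ ↦ (x : ℂ) ^ 1 * Complex.exp (-s * x) * (besselJ 1 x : ℂ))
    (f' := fun x : ℝ ↦ -s * ((x : ℂ) ^ 1 * Complex.exp (-s * x) * (besselJ 1 x : ℂ))
      + (x : ℂ) ^ 1 * Complex.exp (-s * x) * (besselJ 0 x : ℂ)) ?_ ?_ ?_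
    (tendsto_pow_mul_exp_mul_besselJ 1 1 hs)
  · rw [integral_add (i1.const_mul (-s)) i0, integral_const_mul] at h
    simp only [laplaceMoment]
    simp at h ⊢
    linear_combination -h
  · have := continuous_besselJ 1
    exact Continuous.continuousWithinAt (by fun_prop)
  · intro x (hx : 0 < x)
    simp only [pow_one]
    refine (((Complex.ofRealCLM.hasDerivAt (x := x)).mul (hasDerivAt_cexp_neg_mul s x)).mul
      (hasDerivAt_besselJ_up 0 hx.ne').ofReal_comp).congr_deriv ?_
    have : (x : ℂ) ≠ 0 := by exact_mod_cast hx.ne'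
    simp
    field_simp
    ring
  · exact (i1.const_mul (-s)).add i0

lemma one_add_sq_mem_slitPlane {s : ℂ} (hs : s.re ≠ 0 ∨ |s.im| < 1) :
    1 + s ^ 2 ∈ Complex.slitPlane := by
  rw [Complex.mem_slitPlane_iff]
  by_contra! h
  obtain ⟨h1, h2⟩ := h
  simp [pow_two] at h1 h2
  rcases hs with hs | hs
  · have : s.im = 0 := by
      have : s.re * s.im = 0 := by linarith
      simpa [hs] using this
    rw [this] at h1
    nlinarith [sq_nonneg s.re]
  · have := (sq_lt_one_iff_abs_lt_one s.im).2 hs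
    nlinarith [sq_nonneg s.re]

/-- The analytic continuation `1 - s / √(1 + s²)` of the Laplace transform of `J_1`. -/
noncomputable def besselSymbol (s : ℂ) : ℂ := 1 - s * (1 + s ^ 2) ^ (-(1 / 2) : ℂ)

lemma tendsto_laplace_besselJ_one :
    Tendsto (fun t : ℝ ↦ laplaceMoment (fun x ↦ (besselJ 1 x : ℂ)) 0 t) atTop (𝓝 0) := by
  obtain ⟨C, hC0, hC⟩ := exists_besselJ_bound 1
  have h1 : Tendsto (fun t : ℝ ↦ C * ((1 / t) ^ (1 / 2 : ℝ) * Real.Gamma (1 / 2))) atTop (𝓝 0) := by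
    have h := (tendsto_rpow_neg_atTop (y := 1 / 2) (by norm_num)).mul_const (Real.Gamma (1 / 2))
    have h := h.const_mul C
    simp only [zero_mul, mul_zero] at h
    refine h.congr' ?_
    filter_upwards [eventually_gt_atTop 0] with t ht
    rw [one_div t, Real.inv_rpow ht.le, Real.rpow_neg ht.le]
  refine squeeze_zero_norm' ?_ h1
  filter_upwards [eventually_gt_atTop 0] with t ht
  rw [← Real.integral_rpow_mul_exp_neg_mul_Ioi (by norm_num) ht, ← integral_const_mul]
  have hi := (integrableOn_rpow_mul_exp_neg_mul_rpow (p := 1) (s := -(1 / 2)) (b := t)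
    (by norm_num) one_pos ht).const_mul C
  refine norm_integral_le_of_norm_le (hi.congr (ae_of_all _ fun x ↦ ?_)) ?_
  · simp only [Real.rpow_one]; norm_num
  · refine (ae_restrict_iff' measurableSet_Ioi).2 (ae_of_all _ fun x (hx : 0 < x) ↦ ?_)
    rw [norm_mul, norm_mul, Complex.norm_exp, Complex.norm_real, Real.norm_eq_abs]
    have e : (-(t : ℂ) * x).re = -(t * x) := by simp
    rw [e, ← mul_assoc, mul_comm]
    simp only [pow_zero, norm_one, one_mul]
    gcongr
    rw [show (1 / 2 - 1 : ℝ) = -(1 / 2) by norm_num]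
    exact hC x hx

lemma laplace_besselJ_one {s : ℂ} (hs : 0 < s.re) :
    laplaceMoment (fun x ↦ (besselJ 1 x : ℂ)) 0 s = besselSymbol s := by
  set F0 := laplaceMoment (fun x ↦ (besselJ 0 x : ℂ)) 0 with hF0
  set F1 := laplaceMoment (fun x ↦ (besselJ 1 x : ℂ)) 0 with hF1
  set D0 := laplaceMoment (fun x ↦ (besselJ 0 x : ℂ)) 1
  set D1 := laplaceMoment (fun x ↦ (besselJ 1 x : ℂ)) 1
  set H : Set ℂ := {z | 0 < z.re} with hH
  have hHo : IsOpen H := isOpen_lt continuous_const Complex.continuous_re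
  have d0 : ∀ z ∈ H, HasDerivAt F0 (-D0 z) z := fun z hz ↦
    hasDerivAt_laplaceMoment (integrableOn_exp_mul_besselJ 0) 0 hz
  have d1 : ∀ z ∈ H, HasDerivAt F1 (-D1 z) z := fun z hz ↦
    hasDerivAt_laplaceMoment (integrableOn_exp_mul_besselJ 1) 0 hz
  have hode : ∀ z ∈ H, (1 + z ^ 2) * D0 z = z * F0 z := by
    intro z hz
    have e1 : HasDerivAt (fun z ↦ z * F0 z) (1 * F0 z + z * -D0 z) z :=
      (hasDerivAt_id z).mul (d0 z hz)
    have e2 : HasDerivAt (fun z ↦ z * F0 z) (-(-D1 z)) z := by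
      refine ((d1 z hz).const_sub 1).congr_of_eventuallyEq ?_
      filter_upwards [hHo.mem_nhds hz] with w hw using laplace_besselJ_zero hw
    have e3 := e1.unique e2
    have e4 : z * D1 z = D0 z := laplace_mul_besselJ_one hz
    linear_combination -z * e3 - e4
  set q : ℂ → ℂ := fun z ↦ (1 + z ^ 2) ^ (1 / 2 : ℂ) with hq
  have hslit : ∀ z ∈ H, 1 + z ^ 2 ∈ Complex.slitPlane := fun z hz ↦
    one_add_sq_mem_slitPlane (Or.inl (ne_of_gt hz))
  have hne : ∀ z ∈ H, 1 + z ^ 2 ≠ 0 := fun z hz ↦ Complex.slitPlane_ne_zero (hslit z hz)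
  have dq : ∀ z ∈ H, HasDerivAt q (z * (q z / (1 + z ^ 2))) z := by
    intro z hz
    have h1 : HasDerivAt (fun z : ℂ ↦ 1 + z ^ 2) (2 * z) z := by
      simpa using (hasDerivAt_pow 2 z).const_add 1
    refine (h1.cpow_const (c := 1 / 2) (hslit z hz)).congr_deriv ?_
    rw [Complex.cpow_sub _ _ (hne z hz), Complex.cpow_one]
    simp only [hq]
    ring
  have dG : ∀ z ∈ H, HasDerivAt (fun z ↦ F0 z * q z) 0 z := by
    intro z hz
    refine ((d0 z hz).mul (dq z hz)).congr_deriv ?_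
    have := hne z hz
    field_simp
    linear_combination -q z * hode z hz
  obtain ⟨c, hc⟩ := hHo.exists_is_const_of_deriv_eq_zero (convex_halfSpace_re_gt 0).isPreconnected
    (fun z hz ↦ (dG z hz).differentiableAt.differentiableWithinAt)
    (fun z hz ↦ (dG z hz).deriv)
  have hc1 : c = 1 := by
    have l1 : Tendsto (fun t : ℝ ↦ (1 - F1 t) * ((√(1 + (t⁻¹) ^ 2) : ℝ) : ℂ)) atTop
        (𝓝 ((1 - 0) * ((√(1 + 0 ^ 2) : ℝ) : ℂ))) := by
      refine (tendsto_const_nhds.sub tendsto_laplace_besselJ_one).mul ?_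
      refine (Complex.continuous_ofReal.tendsto _).comp ?_
      have : Continuous fun u : ℝ ↦ √(1 + u ^ 2) := by fun_prop
      exact (this.tendsto 0).comp tendsto_inv_atTop_zero
    have l2 : Tendsto (fun t : ℝ ↦ (1 - F1 t) * ((√(1 + (t⁻¹) ^ 2) : ℝ) : ℂ)) atTop (𝓝 c) := by
      refine tendsto_const_nhds.congr' ?_
      filter_upwards [eventually_gt_atTop 0] with t ht
      have htH : (t : ℂ) ∈ H := by simpa [hH] using ht
      rw [← hc t htH, ← laplace_besselJ_zero htH]
      have e : q t = t * ((√(1 + (t⁻¹) ^ 2) : ℝ) : ℂ) := by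
        have e1 : (1 + (t : ℂ) ^ 2) = ((1 + t ^ 2 : ℝ) : ℂ) := by push_cast; rfl
        have e2 : (1 / 2 : ℂ) = ((1 / 2 : ℝ) : ℂ) := by push_cast; rfl
        simp only [hq]
        rw [e1, e2, ← Complex.ofReal_cpow (by positivity), ← Complex.ofReal_mul,
          ← Real.sqrt_eq_rpow]
        congr 1
        rw [← Real.sqrt_sq ht.le, ← Real.sqrt_mul (by positivity), Real.sqrt_sq ht.le]
        congr 1
        field_simp
        ring
      rw [e]
      ring
    simpa using tendsto_nhds_unique l2 l1
  have hmain := hc s hs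
  have hF : F1 s = 1 - s * F0 s := by rw [laplace_besselJ_zero hs]; ring
  have hq0 : q s ≠ 0 := by
    intro h
    rw [h, hc1, mul_zero] at hmain
    exact zero_ne_one hmain
  rw [hF, besselSymbol, Complex.cpow_neg, ← eq_inv_of_mul_eq_one_left (hc1 ▸ hmain)]

/-- The derivatives at the origin of an entire function of exponential type `σ` grow at most
geometrically, with any ratio `τ > σ`. -/
lemma norm_iteratedDeriv_zero_le {g : ℂ → ℂ} (hg : Differentiable ℂ g) {C σ τ : ℝ}
    (hσ : 0 < σ) (hτ : σ < τ) (hbound : ∀ z, ‖g z‖ ≤ C * Real.exp (σ * ‖z‖)) (n : ℕ) :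
    ‖iteratedDeriv n g 0‖ ≤ C * τ / (τ - σ) * τ ^ n := by
  have hτ0 : 0 < τ := hσ.trans hτ
  have hd : 0 < τ - σ := sub_pos.2 hτ
  have hcauchy : ∀ r ∈ Ioi (0 : ℝ), ‖iteratedDeriv n g 0‖ * (r ^ ((n + 1 : ℝ) - 1)
      * Real.exp (-(τ * r))) ≤ Nat.factorial n * C
        * (r ^ ((1 : ℝ) - 1) * Real.exp (-((τ - σ) * r))) := by
    intro r hr
    have hr : 0 < r := hr
    have h := Complex.norm_iteratedDeriv_le_of_forall_mem_sphere_norm_le (c := 0) (f := g) n hr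
      hg.diffContOnCl (C := C * Real.exp (σ * r)) (fun z hz ↦ by
        rw [mem_sphere_zero_iff_norm] at hz
        simpa [hz] using hbound z)
    rw [le_div_iff₀ (by positivity)] at h
    rw [add_sub_cancel_right, sub_self, Real.rpow_zero, Real.rpow_natCast, ← mul_assoc]
    refine (mul_le_mul_of_nonneg_right h (Real.exp_pos _).le).trans_eq ?_
    rw [mul_assoc, mul_assoc, ← Real.exp_add, one_mul, mul_assoc]
    congr 3
    ring
  have hJg : ∀ (a r : ℝ), 0 < a → 0 < r →
      IntegrableOn (fun t : ℝ ↦ t ^ (a - 1) * Real.exp (-(r * t))) (Ioi 0) := by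
    intro a r ha hr
    simpa using integrableOn_rpow_mul_exp_neg_mul_rpow (p := 1) (s := a - 1) (b := r)
      (by linarith) one_pos hr
  have h := setIntegral_mono_on ((hJg (n + 1) τ (by positivity) hτ0).const_mul _)
    ((hJg 1 (τ - σ) one_pos hd).const_mul _) measurableSet_Ioi hcauchy
  rw [integral_const_mul, integral_const_mul,
    Real.integral_rpow_mul_exp_neg_mul_Ioi (by positivity) hτ0,
    Real.integral_rpow_mul_exp_neg_mul_Ioi one_pos hd, Real.Gamma_nat_eq_factorial,
    Real.Gamma_one, Real.rpow_one, one_div, one_div, Real.inv_rpow hτ0.le] at h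
  have hf : (0 : ℝ) < Nat.factorial n := by positivity
  have e : (τ : ℝ) ^ ((n : ℝ) + 1) = τ ^ n * τ := by
    rw [Real.rpow_add_one hτ0.ne', Real.rpow_natCast]
  rw [e] at h
  have h2 : ‖iteratedDeriv n g 0‖ * (τ ^ n * τ)⁻¹ ≤ C * (τ - σ)⁻¹ := by
    refine le_of_mul_le_mul_left ?_ hf
    linarith
  rw [← div_eq_mul_inv, div_le_iff₀ (by positivity)] at h2
  refine h2.trans_eq ?_
  ring

lemma iteratedDeriv_besselSymbol (n : ℕ) {s : ℂ} (hs : 0 < s.re) :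
    iteratedDeriv n besselSymbol s
      = (-1) ^ n * laplaceMoment (fun x ↦ (besselJ 1 x : ℂ)) n s := by
  induction n generalizing s with
  | zero => simp [laplace_besselJ_one hs]
  | succ n ih =>
    have hev : iteratedDeriv n besselSymbol =ᶠ[𝓝 s]
        fun s ↦ (-1) ^ n * laplaceMoment (fun x ↦ (besselJ 1 x : ℂ)) n s := by
      filter_upwards [(isOpen_lt continuous_const Complex.continuous_re).mem_nhds
        (show (0 : ℝ) < s.re from hs)] with z hz using ih hz
    rw [iteratedDeriv_succ, hev.deriv_eq, ((hasDerivAt_laplaceMoment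
      (integrableOn_exp_mul_besselJ 1) n hs).const_mul ((-1) ^ n)).deriv]
    ring

lemma differentiableAt_besselSymbol {s : ℂ} (hs : |s.im| < 1) :
    DifferentiableAt ℂ besselSymbol s := by
  unfold besselSymbol
  refine (differentiableAt_const _).sub (differentiableAt_id.mul ?_)
  exact DifferentiableAt.cpow_const (by fun_prop) (one_add_sq_mem_slitPlane (Or.inr hs))

lemma iteratedDeriv_besselSymbol_zero_of_even {n : ℕ} (hn : Even n) (hn0 : n ≠ 0) :
    iteratedDeriv n besselSymbol 0 = 0 := by
  have h := iteratedDeriv_comp_neg n besselSymbol 0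
  have e : (fun x ↦ besselSymbol (-x)) = fun x ↦ 2 - besselSymbol x := by
    ext x
    simp only [besselSymbol, neg_sq]
    ring
  rw [e, iteratedDeriv_const_sub (Nat.pos_of_ne_zero hn0), iteratedDeriv_neg, hn.neg_one_pow,
    one_smul, neg_zero] at h
  exact CharZero.eq_neg_self_iff.1 h.symm

lemma iteratedDeriv_zero_of_odd {g : ℂ → ℂ} (heven : ∀ z, g (-z) = g z) {n : ℕ} (hn : Odd n) :
    iteratedDeriv n g 0 = 0 := by
  have h := iteratedDeriv_comp_neg n g 0
  rw [funext heven, hn.neg_one_pow, neg_zero, neg_one_smul] at h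
  exact CharZero.eq_neg_self_iff.1 h

lemma hasSum_laplaceMoment_besselJ_mul {g : ℂ → ℂ} (hg : Differentiable ℂ g) {C τ : ℝ}
    (hC : ∀ n, ‖iteratedDeriv n g 0‖ ≤ C * τ ^ n) {s : ℂ} (hτ : 0 < τ) (hs : τ < s.re) :
    HasSum (fun n ↦ (Nat.factorial n : ℂ)⁻¹ * iteratedDeriv n g 0
        * laplaceMoment (fun x ↦ (besselJ 1 x : ℂ)) n s)
      (laplaceMoment (fun x ↦ (besselJ 1 x : ℂ) * g x) 0 s) := by
  have hs0 : 0 < s.re := hτ.trans hs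
  have hsum : ∀ x : ℝ, HasSum (fun n ↦ C * ((Nat.factorial n : ℝ)⁻¹ * (τ * x) ^ n)
      * ‖Complex.exp (-s * x) * (besselJ 1 x : ℂ)‖)
      (C * Real.exp (τ * x) * ‖Complex.exp (-s * x) * (besselJ 1 x : ℂ)‖) := by
    intro x
    have h := NormedSpace.expSeries_div_hasSum_exp (𝔸 := ℝ) (τ * x)
    rw [← Real.exp_eq_exp_ℝ] at h
    refine HasSum.mul_right _ (HasSum.mul_left _ (h.congr_fun fun n ↦ ?_))
    ring
  have key := hasSum_integral_of_dominated_convergence (μ := volume.restrict (Ioi (0 : ℝ)))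
    (F := fun n x ↦ (Nat.factorial n : ℂ)⁻¹ * iteratedDeriv n g 0
      * ((x : ℂ) ^ n * Complex.exp (-s * x) * (besselJ 1 x : ℂ)))
    (f := fun x ↦ (x : ℂ) ^ 0 * Complex.exp (-s * x) * ((besselJ 1 x : ℂ) * g x))
    (fun n x ↦ C * ((Nat.factorial n : ℝ)⁻¹ * (τ * x) ^ n)
      * ‖Complex.exp (-s * x) * (besselJ 1 x : ℂ)‖)
    (fun n ↦ ((integrableOn_laplaceMoment (integrableOn_exp_mul_besselJ 1) n
      hs0).const_mul _).aestronglyMeasurable) (fun n ↦ ?_) (ae_of_all _ fun x ↦ (hsum x).summable)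
    ?_ (ae_of_all _ fun x ↦ ?_)
  · refine (key.congr_fun fun n ↦ ?_)
    rw [integral_const_mul, laplaceMoment]
  · refine (ae_restrict_iff' measurableSet_Ioi).2 (ae_of_all _ fun x (hx : 0 < x) ↦ ?_)
    rw [mul_assoc ((x : ℂ) ^ n), norm_mul, norm_mul, norm_mul ((x : ℂ) ^ n), norm_inv,
      Complex.norm_natCast, norm_pow, Complex.norm_real, Real.norm_of_nonneg hx.le, mul_pow]
    have : (Nat.factorial n : ℝ)⁻¹ * ‖iteratedDeriv n g 0‖ * x ^ n
        ≤ C * ((Nat.factorial n : ℝ)⁻¹ * (τ ^ n * x ^ n)) := by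
      have := mul_le_mul_of_nonneg_left (hC n)
        (show 0 ≤ (Nat.factorial n : ℝ)⁻¹ * x ^ n by positivity)
      linarith
    rw [← mul_assoc]
    gcongr
  · simp only [fun x ↦ (hsum x).tsum_eq]
    have hi := (integrableOn_laplaceMoment (integrableOn_exp_mul_besselJ 1) 0
      (s := s - τ) (by simpa using hs)).norm.const_mul C
    refine hi.congr (ae_of_all _ fun x ↦ ?_)
    simp only [pow_zero, one_mul, norm_mul, Complex.norm_exp]
    have e : (-(s - τ) * x).re = τ * x + (-s * x).re := by simp; ring
    rw [e, Real.exp_add]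
    ring
  · have h := (Complex.hasSum_taylorSeries_of_entire hg 0 x).mul_left
      ((x : ℂ) ^ 0 * Complex.exp (-s * x) * (besselJ 1 x : ℂ))
    rw [mul_assoc _ (besselJ 1 x : ℂ)] at h
    refine h.congr_fun fun n ↦ ?_
    simp only [sub_zero, smul_eq_mul, pow_zero, one_mul]
    ring

lemma DifferentiableOn.iteratedDeriv_complex {f : ℂ → ℂ} {V : Set ℂ} (hf : DifferentiableOn ℂ f V)
    (hV : IsOpen V) (n : ℕ) : DifferentiableOn ℂ (iteratedDeriv n f) V := by
  induction n with
  | zero => simpa using hf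
  | succ n ih => rw [iteratedDeriv_succ]; exact ih.deriv hV

/-- Near the origin, `∑ g⁽ⁿ⁾(0) / n! * (-1)ⁿ Φ⁽ⁿ⁾(s)` defines a holomorphic function, where `Φ` is the
continuation of the Laplace transform of `J_1`. -/
lemma differentiableOn_tsum_besselSymbol {d : ℕ → ℂ} {C τ ρ δ : ℝ} (hτ : 0 < τ) (hτρ : τ < ρ)
    (hδ : 0 < δ) (hρδ : ρ + δ < 1) (hd : ∀ n, ‖d n‖ ≤ C * τ ^ n) :
    DifferentiableOn ℂ (fun s ↦ ∑' n : ℕ, (Nat.factorial n : ℂ)⁻¹ * d n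
        * ((-1) ^ n * iteratedDeriv n besselSymbol s))
      {z | -1 < z.re ∧ z.re < 2 ∧ |z.im| < δ} := by
  have hρ : 0 < ρ := hτ.trans hτρ
  set K : Set ℂ := Icc (-3 : ℝ) 3 ×ℂ Icc (-(ρ + δ)) (ρ + δ) with hK
  have hKc : IsCompact K := isCompact_Icc.reProdIm isCompact_Icc
  have hKim : ∀ z ∈ K, |z.im| < 1 := fun z hz ↦
    (abs_le.2 ⟨(Complex.mem_reProdIm.1 hz).2.1, (Complex.mem_reProdIm.1 hz).2.2⟩).trans_lt hρδ
  obtain ⟨B, hB⟩ := hKc.exists_bound_of_continuousOn (f := besselSymbol) fun z hz ↦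
    (differentiableAt_besselSymbol (hKim z hz)).continuousAt.continuousWithinAt
  have hball : ∀ s ∈ {z : ℂ | -1 < z.re ∧ z.re < 2 ∧ |z.im| < δ},
      Metric.closedBall s ρ ⊆ K := by
    rintro s ⟨h1, h2, h3⟩ z hz
    rw [mem_closedBall_iff_norm] at hz
    have hre := abs_le.1 ((Complex.abs_re_le_norm (z - s)).trans hz)
    have him := abs_le.1 ((Complex.abs_im_le_norm (z - s)).trans hz)
    rw [Complex.sub_re] at hre
    rw [Complex.sub_im] at him
    have h3' := abs_lt.1 h3
    refine Complex.mem_reProdIm.2 ⟨⟨?_, ?_⟩, ⟨?_, ?_⟩⟩ <;> linarith [hre.1, hre.2, him.1, him.2,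
      h3'.1, h3'.2]
  have hVopen : IsOpen {z : ℂ | |z.im| < 1} :=
    isOpen_lt (continuous_abs.comp Complex.continuous_im) continuous_const
  have hVdiff : DifferentiableOn ℂ besselSymbol {z : ℂ | |z.im| < 1} := fun z hz ↦
    (differentiableAt_besselSymbol hz).differentiableWithinAt
  have hUopen : IsOpen {z : ℂ | -1 < z.re ∧ z.re < 2 ∧ |z.im| < δ} :=
    (isOpen_lt continuous_const Complex.continuous_re).inter
      ((isOpen_lt Complex.continuous_re continuous_const).inter
        (isOpen_lt (continuous_abs.comp Complex.continuous_im) continuous_const))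
  refine Complex.differentiableOn_tsum_of_summable_norm (u := fun n ↦ C * B * (τ / ρ) ^ n)
    ((summable_geometric_of_lt_one (by positivity) ((div_lt_one hρ).2 hτρ)).mul_left _)
    (fun n ↦ ?_) hUopen (fun n s hs ↦ ?_)
  · refine ((((hVdiff.iteratedDeriv_complex hVopen n).mono ?_).const_mul _).const_mul _)
    intro z hz
    have : |z.im| < δ := hz.2.2
    show |z.im| < 1
    linarith
  · have h1 : ‖iteratedDeriv n besselSymbol s‖ ≤ Nat.factorial n * B / ρ ^ n := by
      refine Complex.norm_iteratedDeriv_le_of_forall_mem_sphere_norm_le n hρ ?_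
        fun z hz ↦ hB z (hball s hs (Metric.sphere_subset_closedBall hz))
      refine DifferentiableOn.diffContOnCl ?_
      rw [closure_ball s hρ.ne']
      exact hVdiff.mono fun z hz ↦ hKim z (hball s hs hz)
    have hf : (0 : ℝ) < Nat.factorial n := by positivity
    rw [norm_mul, norm_mul, norm_mul, norm_inv, Complex.norm_natCast, norm_pow, norm_neg, norm_one,
      one_pow, one_mul]
    calc (Nat.factorial n : ℝ)⁻¹ * ‖d n‖ * ‖iteratedDeriv n besselSymbol s‖
        ≤ (Nat.factorial n : ℝ)⁻¹ * (C * τ ^ n) * (Nat.factorial n * B / ρ ^ n) := by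
          have := (norm_nonneg _).trans (hd n)
          gcongr
          exact hd n
      _ = C * B * (τ / ρ) ^ n := by
          rw [div_pow]
          field_simp

/-- For an even entire function `g` of exponential type less than one such that `J_1 g` is
integrable, `∫₀^∞ J_1(x) g(x) dx = g(0)`. -/
theorem integral_besselJ_one_mul {g : ℂ → ℂ} (hg : Differentiable ℂ g)
    (heven : ∀ z, g (-z) = g z) {C σ : ℝ} (hσ0 : 0 < σ) (hσ : σ < 1)
    (hbound : ∀ z, ‖g z‖ ≤ C * Real.exp (σ * ‖z‖))
    (hJg : IntegrableOn (fun x : ℝ ↦ (besselJ 1 x : ℂ) * g x) (Ioi 0)) :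
    ∫ x in Ioi (0 : ℝ), (besselJ 1 x : ℂ) * g x = g 0 := by
  obtain ⟨τ, hστ, hτ1⟩ := exists_between hσ
  obtain ⟨ρ, hτρ, hρ1⟩ := exists_between hτ1
  obtain ⟨δ', hδ1, hδ2⟩ := exists_between hρ1
  set δ := δ' - ρ with hδ
  have hδ0 : 0 < δ := sub_pos.2 hδ1
  have hτ0 : 0 < τ := hσ0.trans hστ
  have hd := norm_iteratedDeriv_zero_le hg hσ0 hστ hbound
  have hT := differentiableOn_tsum_besselSymbol hτ0 hτρ hδ0 (by linarith : ρ + δ < 1) hd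
  set T : ℂ → ℂ := fun s ↦ ∑' n : ℕ, (Nat.factorial n : ℂ)⁻¹ * iteratedDeriv n g 0
        * ((-1) ^ n * iteratedDeriv n besselSymbol s) with hTdef
  set U : Set ℂ := {z | -1 < z.re ∧ z.re < 2 ∧ |z.im| < δ} with hU
  have hUopen : IsOpen U :=
    (isOpen_lt continuous_const Complex.continuous_re).inter
      ((isOpen_lt Complex.continuous_re continuous_const).inter
        (isOpen_lt (continuous_abs.comp Complex.continuous_im) continuous_const))
  set W : Set ℂ := Ioo (0 : ℝ) 2 ×ℂ Ioo (-δ) δ with hW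
  have hWopen : IsOpen W := isOpen_Ioo.reProdIm isOpen_Ioo
  have hWconv : Convex ℝ W :=
    ((convex_Ioo (𝕜 := ℝ) (0 : ℝ) 2).linear_preimage Complex.reLm).inter
      ((convex_Ioo (𝕜 := ℝ) (-δ) δ).linear_preimage Complex.imLm)
  have hWU : W ⊆ U := fun z hz ↦ by
    obtain ⟨h1, h2⟩ := Complex.mem_reProdIm.1 hz
    exact ⟨by linarith [h1.1], h1.2, abs_lt.2 h2⟩
  have hK : ∀ ε : ℝ, 0 < ε → IntegrableOn
      (fun x : ℝ ↦ Complex.exp (-ε * x) * ((besselJ 1 x : ℂ) * g x)) (Ioi 0) := by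
    intro ε hε
    refine Integrable.bdd_mul (c := 1) hJg (Continuous.aestronglyMeasurable (by fun_prop)) ?_
    refine (ae_restrict_iff' measurableSet_Ioi).2 (ae_of_all _ fun x (hx : 0 < x) ↦ ?_)
    rw [Complex.norm_exp]
    refine Real.exp_le_one_iff.2 ?_
    rw [← Complex.ofReal_neg, ← Complex.ofReal_mul, Complex.ofReal_re]
    nlinarith
  set A : ℂ → ℂ := laplaceMoment (fun x ↦ (besselJ 1 x : ℂ) * g x) 0 with hA
  have hAT : EqOn A T W := by
    refine AnalyticOnNhd.eqOn_of_preconnected_of_eventuallyEq (z₀ := 1) ?_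
      ((hT.mono hWU).analyticOnNhd hWopen)
      hWconv.isPreconnected ?_ ?_
    · refine DifferentiableOn.analyticOnNhd (fun z hz ↦ ?_) hWopen
      exact (hasDerivAt_laplaceMoment hK 0
        (Complex.mem_reProdIm.1 hz).1.1).differentiableAt.differentiableWithinAt
    · refine Complex.mem_reProdIm.2 ⟨⟨?_, ?_⟩, ⟨?_, ?_⟩⟩ <;> simp [hδ0]
    · filter_upwards [(isOpen_lt continuous_const Complex.continuous_re).mem_nhds
        (show τ < (1 : ℂ).re by simpa using hτ1)] with s hs
      have hs : τ < s.re := hs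
      rw [hA, ← (hasSum_laplaceMoment_besselJ_mul hg hd hτ0 hs).tsum_eq, hTdef]
      refine tsum_congr fun n ↦ ?_
      rw [iteratedDeriv_besselSymbol n (hτ0.trans hs), ← mul_assoc ((-1 : ℂ) ^ n), ← mul_pow]
      simp
  have hT0 : T 0 = g 0 := by
    simp only [hTdef]
    rw [tsum_eq_single 0]
    · simp [besselSymbol]
    · intro n hn
      rcases Nat.even_or_odd n with h | h
      · rw [iteratedDeriv_besselSymbol_zero_of_even h hn, mul_zero, mul_zero]
      · rw [iteratedDeriv_zero_of_odd heven h, mul_zero, zero_mul]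
  have hTlim : Tendsto (fun t : ℝ ↦ T t) (𝓝[>] 0) (𝓝 (g 0)) := by
    rw [← hT0]
    have h0 : (0 : ℂ) ∈ U := ⟨by simp, by simp, by simpa using hδ0⟩
    have hc := (hT.differentiableAt (hUopen.mem_nhds h0)).continuousAt.tendsto
    have hr : Tendsto (fun t : ℝ ↦ (t : ℂ)) (𝓝[>] 0) (𝓝 0) :=
      (Complex.continuous_ofReal.tendsto' 0 0 Complex.ofReal_zero).mono_left nhdsWithin_le_nhds
    exact hc.comp hr
  have hAlim : Tendsto (fun t : ℝ ↦ A t) (𝓝[>] 0)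
      (𝓝 (∫ x in Ioi (0 : ℝ), (besselJ 1 x : ℂ) * g x)) := by
    refine tendsto_integral_filter_of_dominated_convergence
      (fun x ↦ ‖(besselJ 1 x : ℂ) * g x‖) ?_ ?_ hJg.norm ?_
    · filter_upwards [self_mem_nhdsWithin] with t ht
      exact (integrableOn_laplaceMoment hK 0 (by simpa using ht)).aestronglyMeasurable
    · filter_upwards [self_mem_nhdsWithin] with t (ht : 0 < t)
      refine (ae_restrict_iff' measurableSet_Ioi).2 (ae_of_all _ fun x (hx : 0 < x) ↦ ?_)
      rw [pow_zero, one_mul, norm_mul, Complex.norm_exp]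
      refine mul_le_of_le_one_left (norm_nonneg _) (Real.exp_le_one_iff.2 ?_)
      rw [← Complex.ofReal_neg, ← Complex.ofReal_mul, Complex.ofReal_re]
      nlinarith
    · refine ae_of_all _ fun x ↦ ?_
      have : Continuous fun t : ℝ ↦
          (x : ℂ) ^ 0 * Complex.exp (-(t : ℂ) * x) * ((besselJ 1 x : ℂ) * g x) := by fun_prop
      exact (this.tendsto' 0 _ (by simp)).mono_left nhdsWithin_le_nhds
  refine tendsto_nhds_unique hAlim (hTlim.congr' ?_)
  filter_upwards [Ioo_mem_nhdsGT (show (0 : ℝ) < 2 by norm_num)] with t ht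
  exact (hAT (Complex.mem_reProdIm.2 ⟨by simpa using ht, by simpa using hδ0⟩)).symm

lemma prod_one_add_sq_div_le_exp {r : ℝ} (hr : 0 ≤ r) (n : ℕ) :
    ∏ j ∈ Finset.range n, (1 + r ^ 2 / ((j : ℝ) + 1) ^ 2) ≤ Real.exp (π * r) := by
  rcases hr.eq_or_lt with rfl | hr
  · simp
  have hlim : Tendsto (fun n ↦ π * r * ∏ j ∈ Finset.range n, (1 + r ^ 2 / ((j : ℝ) + 1) ^ 2))
      atTop (𝓝 (Real.sinh (π * r))) := by
    have h := (Complex.tendsto_euler_sin_prod (r * Complex.I)).norm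
    have e : Complex.sin (π * (r * Complex.I)) = ((Real.sinh (π * r) : ℝ) : ℂ) * Complex.I := by
      rw [← mul_assoc, Complex.sin_mul_I]
      push_cast
      rfl
    rw [e, norm_mul, Complex.norm_I, mul_one, Complex.norm_real,
      Real.norm_of_nonneg (Real.sinh_nonneg_iff.2 (by positivity))] at h
    refine h.congr fun n ↦ ?_
    rw [norm_mul, norm_mul, norm_mul, Complex.norm_I, mul_one, Complex.norm_real,
      Complex.norm_real, Real.norm_of_nonneg hr.le, Real.norm_of_nonneg pi_pos.le, norm_prod]
    congr 1
    refine Finset.prod_congr rfl fun j _ ↦ ?_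
    have : (1 - ((r : ℂ) * Complex.I) ^ 2 / ((j : ℂ) + 1) ^ 2)
        = ((1 + r ^ 2 / ((j : ℝ) + 1) ^ 2 : ℝ) : ℂ) := by
      push_cast
      rw [mul_pow, Complex.I_sq]
      ring
    rw [this, Complex.norm_real, Real.norm_of_nonneg (by positivity)]
  have hmono : Monotone fun n ↦
      π * r * ∏ j ∈ Finset.range n, (1 + r ^ 2 / ((j : ℝ) + 1) ^ 2) := by
    refine monotone_nat_of_le_succ fun n ↦ ?_
    rw [Finset.prod_range_succ]
    have : 0 ≤ ∏ j ∈ Finset.range n, (1 + r ^ 2 / ((j : ℝ) + 1) ^ 2) :=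
      Finset.prod_nonneg fun j _ ↦ by positivity
    gcongr
    exact le_mul_of_one_le_right this (le_add_of_nonneg_right (by positivity))
  have h1 := hmono.ge_of_tendsto hlim n
  have hx : 0 < π * r := by positivity
  have h2 : Real.sinh (π * r) ≤ π * r * Real.exp (π * r) := by
    rw [Real.sinh_eq]
    have h3 := Real.add_one_le_exp (-(2 * (π * r)))
    have h4 : Real.exp (-(π * r)) = Real.exp (-(2 * (π * r))) * Real.exp (π * r) := by
      rw [← Real.exp_add]; congr 1; ring
    nlinarith [Real.exp_pos (π * r)]
  exact le_of_mul_le_mul_left (h1.trans h2) hx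

lemma inv_GammaSeq_mul_GammaSeq {a : ℝ} (ha : 0 < a) (z : ℂ) {n : ℕ} (hn : n ≠ 0) :
    (Complex.GammaSeq (a + z) n * Complex.GammaSeq (a - z) n)⁻¹
      = (Complex.GammaSeq a n ^ 2)⁻¹
        * ∏ j ∈ Finset.range (n + 1), (1 - z ^ 2 / ((a : ℂ) + j) ^ 2) := by
  have hn' : (n : ℂ) ≠ 0 := Nat.cast_ne_zero.2 hn
  have hpow : (n : ℂ) ^ ((a : ℂ) + z) * (n : ℂ) ^ ((a : ℂ) - z) = ((n : ℂ) ^ (a : ℂ)) ^ 2 := by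
    rw [← Complex.cpow_add _ _ hn', pow_two, ← Complex.cpow_add _ _ hn']
    congr 1
    ring
  have hne : ∀ j : ℕ, (a : ℂ) + j ≠ 0 := fun j ↦ by
    exact_mod_cast (show (0 : ℝ) < a + j by positivity).ne'
  have hprod : (∏ j ∈ Finset.range (n + 1), ((a : ℂ) + z + j))
      * ∏ j ∈ Finset.range (n + 1), ((a : ℂ) - z + j)
      = (∏ j ∈ Finset.range (n + 1), ((a : ℂ) + j)) ^ 2
        * ∏ j ∈ Finset.range (n + 1), (1 - z ^ 2 / ((a : ℂ) + j) ^ 2) := by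
    rw [← Finset.prod_mul_distrib, ← Finset.prod_pow, ← Finset.prod_mul_distrib]
    refine Finset.prod_congr rfl fun j _ ↦ ?_
    have := hne j
    field_simp
    ring
  simp only [Complex.GammaSeq]
  rw [div_mul_div_comm, inv_div, hprod, div_pow, inv_div, mul_mul_mul_comm, hpow]
  ring

lemma norm_inv_Gamma_mul_Gamma_le {a : ℝ} (ha : 0 < a) (z : ℂ) :
    ‖(Complex.Gamma (a + z) * Complex.Gamma (a - z))⁻¹‖
      ≤ ‖(Complex.Gamma a ^ 2)⁻¹‖ * ((1 + ‖z‖ ^ 2 / a ^ 2) * Real.exp (π * ‖z‖)) := by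
  by_cases h0 : Complex.Gamma (a + z) * Complex.Gamma (a - z) = 0
  · rw [h0, inv_zero, norm_zero]
    positivity
  have hΓ : Complex.Gamma a ^ 2 ≠ 0 := pow_ne_zero _ (Complex.Gamma_ne_zero_of_re_pos (by simpa))
  have l1 := (((Complex.GammaSeq_tendsto_Gamma (a + z)).mul
    (Complex.GammaSeq_tendsto_Gamma (a - z))).inv₀ h0).norm
  have l2 := ((((Complex.GammaSeq_tendsto_Gamma a).pow 2).inv₀ hΓ).norm).mul_const
    ((1 + ‖z‖ ^ 2 / a ^ 2) * Real.exp (π * ‖z‖))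
  refine le_of_tendsto_of_tendsto l1 l2 ?_
  filter_upwards [eventually_ne_atTop 0] with n hn
  rw [inv_GammaSeq_mul_GammaSeq ha z hn, norm_mul]
  gcongr
  rw [norm_prod, Finset.prod_range_succ']
  have hfac : ∀ j : ℕ, ‖1 - z ^ 2 / ((a : ℂ) + j) ^ 2‖ ≤ 1 + ‖z‖ ^ 2 / (a + j) ^ 2 := by
    intro j
    refine (norm_sub_le _ _).trans_eq ?_
    have : ((a : ℂ) + j) = ((a + j : ℝ) : ℂ) := by push_cast; rfl
    rw [norm_one, norm_div, norm_pow, norm_pow, this, Complex.norm_real,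
      Real.norm_of_nonneg (by positivity)]
  rw [mul_comm]
  gcongr
  · simpa using hfac 0
  · refine (Finset.prod_le_prod (fun j _ ↦ norm_nonneg _) fun j _ ↦ ?_).trans
      (prod_one_add_sq_div_le_exp (norm_nonneg z) n)
    refine (hfac (j + 1)).trans ?_
    have hj : (j : ℝ) + 1 ≤ a + (j + 1 : ℕ) := by push_cast; linarith
    gcongr

/-- The entire function extending `gammaProd` to the complex plane. -/
noncomputable def complexGammaProd (M : ℕ) (α β : ℕ → ℝ) (z : ℂ) : ℂ :=
  ∏ k ∈ Finset.range M, (Complex.Gamma (α k + β k * z) * Complex.Gamma (α k - β k * z))⁻¹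

lemma complexGammaProd_ofReal (M : ℕ) (α β : ℕ → ℝ) (x : ℝ) :
    complexGammaProd M α β x = (gammaProd M α β x : ℂ) := by
  simp only [complexGammaProd, gammaProd]
  push_cast
  refine Finset.prod_congr rfl fun k _ ↦ ?_
  rw [← Complex.Gamma_ofReal, ← Complex.Gamma_ofReal]
  push_cast
  rfl

lemma complexGammaProd_neg (M : ℕ) (α β : ℕ → ℝ) (z : ℂ) :
    complexGammaProd M α β (-z) = complexGammaProd M α β z := by
  refine Finset.prod_congr rfl fun k _ ↦ ?_
  rw [mul_neg, sub_neg_eq_add, ← sub_eq_add_neg, mul_comm]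

lemma differentiable_complexGammaProd (M : ℕ) (α β : ℕ → ℝ) :
    Differentiable ℂ (complexGammaProd M α β) := by
  unfold complexGammaProd
  refine Differentiable.fun_finsetProd fun k _ ↦ ?_
  simp only [mul_inv]
  have h1 : Differentiable ℂ fun z : ℂ ↦ (α k : ℂ) + β k * z := by fun_prop
  have h2 : Differentiable ℂ fun z : ℂ ↦ (α k : ℂ) - β k * z := by fun_prop
  exact (Complex.differentiable_one_div_Gamma.comp h1).mul
    (Complex.differentiable_one_div_Gamma.comp h2)

lemma continuous_gammaProd (M : ℕ) (α β : ℕ → ℝ) : Continuous (gammaProd M α β) := by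
  have h := Complex.continuous_re.comp
    ((differentiable_complexGammaProd M α β).continuous.comp Complex.continuous_ofReal)
  refine h.congr fun x ↦ ?_
  simp [complexGammaProd_ofReal]

lemma exists_norm_complexGammaProd_le (M : ℕ) {α β : ℕ → ℝ}
    (hα : ∀ k ∈ Finset.range M, 0 < α k) (hβ : ∀ k ∈ Finset.range M, 0 < β k)
    {ε : ℝ} (hε : 0 < ε) :
    ∃ C, ∀ z, ‖complexGammaProd M α β z‖
      ≤ C * Real.exp ((π + ε) * (∑ k ∈ Finset.range M, β k) * ‖z‖) := by
  refine ⟨∏ k ∈ Finset.range M, (‖(Complex.Gamma (α k) ^ 2)⁻¹‖ * (1 + 2 / ((α k) ^ 2 * ε ^ 2))),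
    fun z ↦ ?_⟩
  rw [complexGammaProd, norm_prod, Finset.mul_sum, Finset.sum_mul, Real.exp_sum,
    ← Finset.prod_mul_distrib]
  refine Finset.prod_le_prod (fun k _ ↦ norm_nonneg _) fun k hk ↦ ?_
  have ha := hα k hk
  have hb := hβ k hk
  refine (norm_inv_Gamma_mul_Gamma_le ha (β k * z)).trans ?_
  rw [norm_mul, Complex.norm_real, Real.norm_of_nonneg hb.le]
  set r := β k * ‖z‖ with hr
  have hr0 : 0 ≤ r := by positivity
  have e : (π + ε) * β k * ‖z‖ = ε * r + π * r := by rw [hr]; ring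
  rw [e, Real.exp_add, mul_assoc, ← mul_assoc (1 + 2 / ((α k) ^ 2 * ε ^ 2))]
  gcongr
  have h1 := Real.pow_div_factorial_le_exp (ε * r) (by positivity) 2
  have h2 : (1 : ℝ) ≤ Real.exp (ε * r) := Real.one_le_exp (by positivity)
  have h3 : r ^ 2 / (α k) ^ 2 = 2 / ((α k) ^ 2 * ε ^ 2) * ((ε * r) ^ 2 / (Nat.factorial 2 : ℝ)) := by
    simp only [Nat.factorial]
    push_cast
    field_simp
  rw [h3, add_mul, one_mul]
  gcongr

lemma isTheta_Gamma_add_of_mem_Ico {a : ℝ} (ha0 : 0 ≤ a) (ha1 : a < 1) :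
    (fun x : ℝ ↦ Real.Gamma (x + a)) =Θ[atTop] fun x ↦ x ^ a * Real.Gamma x := by
  rcases ha0.eq_or_lt with rfl | ha0
  · simp only [add_zero, Real.rpow_zero, one_mul]
    exact Asymptotics.isTheta_rfl
  constructor
  · refine Asymptotics.IsBigO.of_bound 1 ?_
    filter_upwards [eventually_gt_atTop 0] with x hx
    have hΓ := Real.Gamma_pos_of_pos hx
    rw [Real.norm_of_nonneg (Real.Gamma_pos_of_pos (by positivity)).le,
      Real.norm_of_nonneg (by positivity), one_mul]
    have h := Real.Gamma_mul_add_mul_le_rpow_Gamma_mul_rpow_Gamma hx (show 0 < x + 1 by positivity)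
      (sub_pos.2 ha1) ha0 (by ring)
    rw [Real.Gamma_add_one hx.ne', Real.mul_rpow hx.le hΓ.le, show (1 - a) * x + a * (x + 1) = x + a
      by ring, mul_left_comm, ← Real.rpow_add hΓ, sub_add_cancel, Real.rpow_one] at h
    exact h
  · refine Asymptotics.IsBigO.of_bound 2 ?_
    filter_upwards [eventually_ge_atTop 1] with x hx
    have hx0 : 0 < x := by linarith
    have hΓ := Real.Gamma_pos_of_pos hx0
    have hΓa := Real.Gamma_pos_of_pos (show 0 < x + a by positivity)
    rw [Real.norm_of_nonneg hΓa.le, Real.norm_of_nonneg (by positivity)]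
    have h := Real.Gamma_mul_add_mul_le_rpow_Gamma_mul_rpow_Gamma (show 0 < x + a by positivity)
      (show 0 < x + a + 1 by positivity) ha0 (sub_pos.2 ha1) (by ring)
    rw [Real.Gamma_add_one (show x + a ≠ 0 by positivity), Real.mul_rpow (by positivity) hΓa.le,
      show a * (x + a) + (1 - a) * (x + a + 1) = x + 1 by ring, mul_left_comm, ← Real.rpow_add hΓa,
      add_sub_cancel, Real.rpow_one, Real.Gamma_add_one hx0.ne'] at h
    have h2 : (x + a) ^ (1 - a) ≤ 2 * x ^ (1 - a) := by
      calc (x + a) ^ (1 - a) ≤ (2 * x) ^ (1 - a) := by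
            apply Real.rpow_le_rpow (by positivity) (by linarith) (by linarith)
        _ = 2 ^ (1 - a) * x ^ (1 - a) := Real.mul_rpow (by norm_num) hx0.le
        _ ≤ 2 * x ^ (1 - a) := by
            gcongr
            exact Real.rpow_le_self_of_one_le (by norm_num) (by linarith)
    have h3 : x = x ^ a * x ^ (1 - a) := by
      rw [← Real.rpow_add hx0, add_sub_cancel, Real.rpow_one]
    have hp : 0 < x ^ (1 - a) := by positivity
    refine le_of_mul_le_mul_left ?_ hp
    calc x ^ (1 - a) * (x ^ a * Real.Gamma x) = x * Real.Gamma x := by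
          rw [← mul_assoc, mul_comm (x ^ (1 - a)), ← h3]
      _ ≤ (x + a) ^ (1 - a) * Real.Gamma (x + a) := h
      _ ≤ 2 * x ^ (1 - a) * Real.Gamma (x + a) := by gcongr
      _ = x ^ (1 - a) * (2 * Real.Gamma (x + a)) := by ring

lemma isTheta_Gamma_add_one_iff (a : ℝ) :
    ((fun x : ℝ ↦ Real.Gamma (x + (a + 1))) =Θ[atTop] fun x ↦ x ^ (a + 1) * Real.Gamma x) ↔
      ((fun x : ℝ ↦ Real.Gamma (x + a)) =Θ[atTop] fun x ↦ x ^ a * Real.Gamma x) := by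
  have hlin : (fun x : ℝ ↦ x + a) =Θ[atTop] fun x : ℝ ↦ x :=
    (Asymptotics.IsEquivalent.add_isLittleO Asymptotics.IsEquivalent.refl
      (Asymptotics.isLittleO_const_id_atTop a)).isTheta
  have e1 : (fun x : ℝ ↦ Real.Gamma (x + (a + 1))) =ᶠ[atTop]
      fun x ↦ (x + a) * Real.Gamma (x + a) := by
    filter_upwards [eventually_gt_atTop (-a)] with x hx
    rw [← add_assoc, Real.Gamma_add_one (by linarith)]
  have e2 : (fun x : ℝ ↦ x ^ (a + 1) * Real.Gamma x) =ᶠ[atTop]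
      fun x ↦ x * (x ^ a * Real.Gamma x) := by
    filter_upwards [eventually_gt_atTop 0] with x hx
    rw [Real.rpow_add_one hx.ne']
    ring
  constructor
  · intro h
    have h' := hlin.inv.mul (e1.symm.trans_isTheta (h.trans_eventuallyEq e2))
    refine EventuallyEq.trans_isTheta ?_ (h'.trans_eventuallyEq ?_)
    · filter_upwards [eventually_gt_atTop (-a)] with x hx
      rw [inv_mul_cancel_left₀ (by linarith)]
    · filter_upwards [eventually_gt_atTop 0] with x hx
      rw [inv_mul_cancel_left₀ hx.ne']
  · exact fun h ↦ e1.trans_isTheta ((hlin.mul h).trans_eventuallyEq e2.symm)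

lemma isTheta_Gamma_add (a : ℝ) :
    (fun x : ℝ ↦ Real.Gamma (x + a)) =Θ[atTop] fun x ↦ x ^ a * Real.Gamma x := by
  have h : ∀ n : ℤ, (fun x : ℝ ↦ Real.Gamma (x + (Int.fract a + n))) =Θ[atTop]
      fun x ↦ x ^ (Int.fract a + n : ℝ) * Real.Gamma x := by
    intro n
    induction n using Int.induction_on with
    | zero => simpa using isTheta_Gamma_add_of_mem_Ico (Int.fract_nonneg a) (Int.fract_lt_one a)
    | succ n ih =>
      have := (isTheta_Gamma_add_one_iff _).2 ih
      push_cast at this ⊢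
      simpa only [add_assoc] using this
    | pred n ih =>
      refine (isTheta_Gamma_add_one_iff _).1 ?_
      push_cast at ih ⊢
      rw [add_assoc, sub_add_cancel]
      exact ih
  simpa using h ⌊a⌋

lemma isBigO_inv_Gamma_mul_Gamma (a : ℝ) :
    (fun x : ℝ ↦ (Real.Gamma (a + x) * Real.Gamma (a - x))⁻¹) =O[atTop]
      fun x ↦ x ^ (1 - 2 * a) := by
  have h1 := ((isTheta_Gamma_add (1 - a)).isBigO).mul (isTheta_Gamma_add a).inv.isBigO
  have h2 : (fun x : ℝ ↦ (Real.Gamma (a + x) * Real.Gamma (a - x))⁻¹) =O[atTop]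
      fun x ↦ Real.Gamma (x + (1 - a)) * (Real.Gamma (x + a))⁻¹ := by
    refine Asymptotics.IsBigO.of_bound π⁻¹ ?_
    filter_upwards [eventually_gt_atTop (a - 1)] with x hx
    have hΓ : 0 < Real.Gamma (x + (1 - a)) := Real.Gamma_pos_of_pos (by linarith)
    have hr := Real.Gamma_mul_Gamma_one_sub (a - x)
    rw [show 1 - (a - x) = x + (1 - a) by ring] at hr
    have e : (Real.Gamma (a - x))⁻¹
        = Real.Gamma (x + (1 - a)) * (Real.sin (π * (a - x)) / π) := by
      rw [← inv_div π, ← hr, mul_inv, mul_comm (Real.Gamma (a - x))⁻¹,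
        mul_inv_cancel_left₀ hΓ.ne']
    rw [mul_inv, e, add_comm a x, norm_mul, norm_mul, norm_mul, norm_div, Real.norm_of_nonneg
      pi_pos.le]
    have hs : ‖Real.sin (π * (a - x))‖ ≤ 1 := Real.abs_sin_le_one _
    calc ‖(Real.Gamma (x + a))⁻¹‖ * (‖Real.Gamma (x + (1 - a))‖ * (‖Real.sin (π * (a - x))‖ / π))
        ≤ ‖(Real.Gamma (x + a))⁻¹‖ * (‖Real.Gamma (x + (1 - a))‖ * (1 / π)) := by gcongr
      _ = π⁻¹ * (‖Real.Gamma (x + (1 - a))‖ * ‖(Real.Gamma (x + a))⁻¹‖) := by ring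
  refine (h2.trans h1).congr' EventuallyEq.rfl ?_
  filter_upwards [eventually_gt_atTop 0] with x hx
  have hΓ := (Real.Gamma_pos_of_pos hx).ne'
  have e : x ^ (1 - 2 * a) = x ^ (1 - a) * (x ^ a)⁻¹ := by
    rw [show 1 - 2 * a = (1 - a) - a by ring, Real.rpow_sub hx (1 - a) a, div_eq_mul_inv]
  rw [e, mul_inv, mul_mul_mul_comm, mul_inv_cancel₀ hΓ, mul_one]

lemma isBigO_gammaProd (M : ℕ) (α : ℕ → ℝ) {β : ℕ → ℝ}
    (hβ : ∀ k ∈ Finset.range M, 0 < β k) :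
    gammaProd M α β =O[atTop] fun x ↦ x ^ (-(2 * ∑ k ∈ Finset.range M, α k - M)) := by
  have h : gammaProd M α β =O[atTop]
      fun x ↦ ∏ k ∈ Finset.range M, x ^ (1 - 2 * α k) := by
    refine Asymptotics.IsBigO.finsetProd fun k hk ↦ ?_
    have hb := hβ k hk
    have h1 := (isBigO_inv_Gamma_mul_Gamma (α k)).comp_tendsto
      (tendsto_id.const_mul_atTop hb)
    refine h1.trans (Asymptotics.IsBigO.of_bound (β k ^ (1 - 2 * α k)) ?_)
    filter_upwards [eventually_gt_atTop 0] with x hx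
    simp only [Function.comp, id]
    rw [Real.mul_rpow hb.le hx.le, norm_mul, Real.norm_of_nonneg (by positivity)]
  refine h.congr' EventuallyEq.rfl ?_
  filter_upwards [eventually_gt_atTop 0] with x hx
  rw [← Real.rpow_sum_of_pos hx, Finset.sum_sub_distrib, ← Finset.mul_sum]
  simp

lemma integrableOn_rpow_mul_gammaProd (M : ℕ) (α : ℕ → ℝ) {β : ℕ → ℝ}
    (hβ : ∀ k ∈ Finset.range M, 0 < β k) {s : ℝ} (hs0 : 0 < s)
    (hs : s < 2 * ∑ k ∈ Finset.range M, α k - M) :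
    IntegrableOn (fun x ↦ x ^ (s - 1) * gammaProd M α β x) (Ioi 0) := by
  refine mellin_convergent_of_isBigO_scalar (b := 0)
    (continuous_gammaProd M α β |>.locallyIntegrable.locallyIntegrableOn _)
    (isBigO_gammaProd M α hβ) hs ?_ hs0
  simp only [neg_zero, Real.rpow_zero]
  exact ((continuous_gammaProd M α β).tendsto 0).mono_left nhdsWithin_le_nhds |>.isBigO_one ℝ

lemma norm_pow_mul_besselJ_mul_le {k : ℕ} {C : ℝ}
    (hC : ∀ x, 0 < x → |besselJ k x| ≤ C * x ^ (-(1 / 2) : ℝ)) (hC0 : 0 < C) (n : ℕ)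
    {l₀ l x : ℝ} (hl₀ : 0 < l₀) (hl : l₀ ≤ l) (hx : 0 < x) (y : ℝ) :
    ‖x ^ n * besselJ k (l * x) * y‖
      ≤ C * l₀ ^ (-(1 / 2) : ℝ) * ‖x ^ ((n + 1 / 2 : ℝ) - 1) * y‖ := by
  have hl' : 0 < l := hl₀.trans_le hl
  have h1 : |besselJ k (l * x)| ≤ C * (l₀ ^ (-(1 / 2) : ℝ) * x ^ (-(1 / 2) : ℝ)) := by
    refine (hC _ (by positivity)).trans ?_
    rw [Real.mul_rpow hl'.le hx.le]
    have := Real.rpow_le_rpow_of_nonpos hl₀ hl (by norm_num : (-(1 / 2) : ℝ) ≤ 0)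
    gcongr
  have e : x ^ ((n + 1 / 2 : ℝ) - 1) = x ^ n * x ^ (-(1 / 2) : ℝ) := by
    rw [← Real.rpow_natCast, ← Real.rpow_add hx]
    ring_nf
  rw [norm_mul, norm_mul, norm_mul, e, Real.norm_eq_abs (besselJ _ _),
    Real.norm_of_nonneg (by positivity : 0 ≤ x ^ n),
    Real.norm_of_nonneg (by positivity : 0 ≤ x ^ n * x ^ (-(1 / 2) : ℝ))]
  calc x ^ n * |besselJ k (l * x)| * ‖y‖
      ≤ x ^ n * (C * (l₀ ^ (-(1 / 2) : ℝ) * x ^ (-(1 / 2) : ℝ))) * ‖y‖ := by gcongr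
    _ = _ := by ring

lemma continuous_pow_mul_besselJ_mul_gammaProd (M : ℕ) (α β : ℕ → ℝ) (n k : ℕ) (l : ℝ) :
    Continuous fun x ↦ x ^ n * besselJ k (l * x) * gammaProd M α β x :=
  ((continuous_pow n).mul ((continuous_besselJ k).comp (continuous_const_mul l))).mul
    (continuous_gammaProd M α β)

lemma integrableOn_pow_mul_besselJ_mul_gammaProd (M : ℕ) (α : ℕ → ℝ) {β : ℕ → ℝ}
    (hβ : ∀ k ∈ Finset.range M, 0 < β k) {n : ℕ} (k : ℕ)
    (hn : (n : ℝ) + 1 / 2 < 2 * ∑ k ∈ Finset.range M, α k - M) {l : ℝ} (hl : 0 < l) :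
    IntegrableOn (fun x ↦ x ^ n * besselJ k (l * x) * gammaProd M α β x) (Ioi 0) := by
  obtain ⟨C, hC0, hC⟩ := exists_besselJ_bound k
  refine Integrable.mono'
    ((integrableOn_rpow_mul_gammaProd M α hβ (by positivity) hn).norm.const_mul
      (C * l ^ (-(1 / 2) : ℝ)))
    (continuous_pow_mul_besselJ_mul_gammaProd M α β n k l).aestronglyMeasurable ?_
  filter_upwards [ae_restrict_mem measurableSet_Ioi] with x hx
  exact norm_pow_mul_besselJ_mul_le hC hC0 n hl le_rfl hx _

/-- The integral of `J₁(lx)` against a product of reciprocal Gamma functions whose exponential type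
is smaller than `l`. -/
lemma integral_besselJ_one_mul_gammaProd (M : ℕ) {α β : ℕ → ℝ}
    (hα : ∀ k ∈ Finset.range M, 0 < α k) (hβ : ∀ k ∈ Finset.range M, 0 < β k)
    (hn : 1 / 2 < 2 * ∑ k ∈ Finset.range M, α k - M) (hβ0 : 0 < ∑ k ∈ Finset.range M, β k)
    {l : ℝ} (hl : π * ∑ k ∈ Finset.range M, β k < l) :
    ∫ x in Ioi (0 : ℝ), besselJ 1 (l * x) * gammaProd M α β x = gammaProd M α β 0 / l := by
  have hl0 : 0 < l := lt_trans (by positivity) hl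
  set γ : ℕ → ℝ := fun k ↦ β k / l with hγ
  have hγpos : ∀ k ∈ Finset.range M, 0 < γ k := fun k hk ↦ div_pos (hβ k hk) hl0
  have hsum : ∑ k ∈ Finset.range M, γ k = (∑ k ∈ Finset.range M, β k) / l :=
    (Finset.sum_div _ _ _).symm
  set S := ∑ k ∈ Finset.range M, γ k with hS
  have hS0 : 0 < S := hsum ▸ div_pos hβ0 hl0
  have hπS : π * S < 1 := by
    rw [hsum, ← mul_div_assoc, div_lt_one hl0]
    exact hl
  have hscale : ∀ x, gammaProd M α β x = gammaProd M α γ (l * x) := by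
    intro x
    simp only [gammaProd, hγ]
    refine Finset.prod_congr rfl fun k _ ↦ ?_
    rw [← mul_assoc, div_mul_cancel₀ _ hl0.ne']
  have hε : 0 < (1 - π * S) / (2 * S) := div_pos (by linarith) (by positivity)
  obtain ⟨C, hC⟩ := exists_norm_complexGammaProd_le M hα hγpos hε
  have hσ : (π + (1 - π * S) / (2 * S)) * S = (1 + π * S) / 2 := by
    field_simp
    ring
  rw [← hS, hσ] at hC
  have hcast : ∀ x : ℝ, (besselJ 1 x : ℂ) * complexGammaProd M α γ x
      = ((besselJ 1 x * gammaProd M α γ x : ℝ) : ℂ) := by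
    intro x
    rw [complexGammaProd_ofReal]
    push_cast
    rfl
  have hJg : IntegrableOn (fun x ↦ besselJ 1 x * gammaProd M α γ x) (Ioi 0) := by
    have := integrableOn_pow_mul_besselJ_mul_gammaProd M α hγpos (n := 0) 1 (by simpa using hn)
      one_pos
    simpa using this
  have key := integral_besselJ_one_mul (differentiable_complexGammaProd M α γ)
    (complexGammaProd_neg M α γ) (by positivity) (by linarith) hC
    (by simp only [hcast]; exact hJg.ofReal (𝕜 := ℂ))
  simp only [hcast] at key
  rw [integral_complex_ofReal, ← Complex.ofReal_zero, complexGammaProd_ofReal] at key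
  have key' : ∫ x in Ioi (0 : ℝ), besselJ 1 x * gammaProd M α γ x = gammaProd M α γ 0 := by
    exact_mod_cast key
  simp only [hscale]
  rw [integral_comp_mul_left_Ioi (fun x ↦ besselJ 1 x * gammaProd M α γ x) 0 hl0, mul_zero,
    key', smul_eq_mul, div_eq_inv_mul]

lemma hasDerivAt_inv_pow_mul_besselJ (k : ℕ) {l x : ℝ} (hl : l ≠ 0) (hx : x ≠ 0) :
    HasDerivAt (fun t ↦ (t ^ k)⁻¹ * besselJ k (t * x))
      (-((l ^ k)⁻¹ * (x * besselJ (k + 1) (l * x)))) l := by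
  have h1 : HasDerivAt (fun t : ℝ ↦ (t ^ k)⁻¹) (-(k * l ^ (k - 1)) / (l ^ k) ^ 2) l :=
    (hasDerivAt_pow k l).inv (pow_ne_zero _ hl)
  have h2 := (hasDerivAt_besselJ_down k (mul_ne_zero hl hx)).comp l
    ((hasDerivAt_id l).mul_const x)
  refine (h1.mul h2).congr_deriv ?_
  simp only [Function.comp, id]
  rcases k with _ | k
  · simp
    ring
  · have := pow_ne_zero k hl
    simp only [Nat.add_sub_cancel]
    field_simp
    ring

/-- Differentiation in the scale parameter raises the order of the Bessel function. -/
lemma hasDerivAt_inv_pow_mul_integral_besselJ (M : ℕ) (α : ℕ → ℝ) {β : ℕ → ℝ}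
    (hβ : ∀ k ∈ Finset.range M, 0 < β k) {n : ℕ} (k : ℕ)
    (hn : ((n + 1 : ℕ) : ℝ) + 1 / 2 < 2 * ∑ k ∈ Finset.range M, α k - M) {l : ℝ} (hl : 0 < l) :
    HasDerivAt (fun t ↦ (t ^ k)⁻¹ *
        ∫ x in Ioi (0 : ℝ), x ^ n * besselJ k (t * x) * gammaProd M α β x)
      (-((l ^ k)⁻¹ *
        ∫ x in Ioi (0 : ℝ), x ^ (n + 1) * besselJ (k + 1) (l * x) * gammaProd M α β x)) l := by
  obtain ⟨C, hC0, hC⟩ := exists_besselJ_bound (k + 1)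
  have hball : ∀ t ∈ Metric.ball l (l / 2), l / 2 ≤ t := by
    intro t ht
    rw [Metric.mem_ball, Real.dist_eq, abs_lt] at ht
    linarith
  have hn' : (n : ℝ) + 1 / 2 < 2 * ∑ k ∈ Finset.range M, α k - M := by
    push_cast at hn
    linarith
  have h := hasDerivAt_integral_of_dominated_loc_of_deriv_le (μ := volume.restrict (Ioi (0 : ℝ)))
    (F := fun t x ↦ (t ^ k)⁻¹ * (x ^ n * besselJ k (t * x) * gammaProd M α β x))
    (F' := fun t x ↦ -((t ^ k)⁻¹ * (x ^ (n + 1) * besselJ (k + 1) (t * x) * gammaProd M α β x)))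
    (bound := fun x ↦ ((l / 2) ^ k)⁻¹ * (C * (l / 2) ^ (-(1 / 2) : ℝ) *
      ‖x ^ (((n + 1 : ℕ) + 1 / 2 : ℝ) - 1) * gammaProd M α β x‖))
    (x₀ := l) (Metric.ball_mem_nhds l (half_pos hl))
    (Eventually.of_forall fun t ↦ (continuous_const.mul
      (continuous_pow_mul_besselJ_mul_gammaProd M α β n k t)).aestronglyMeasurable)
    ((integrableOn_pow_mul_besselJ_mul_gammaProd M α hβ k hn' hl).const_mul _)
    (continuous_const.mul
      (continuous_pow_mul_besselJ_mul_gammaProd M α β (n + 1) (k + 1) l)).neg.aestronglyMeasurable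
    ?_ ((((integrableOn_rpow_mul_gammaProd M α hβ (by positivity) hn).norm).const_mul _).const_mul _)
    ?_
  · have h2 := h.2
    simp only [integral_const_mul, integral_neg] at h2
    exact h2
  · filter_upwards [ae_restrict_mem measurableSet_Ioi] with x hx t ht
    have htl := hball t ht
    rw [norm_neg, norm_mul]
    refine mul_le_mul ?_ (norm_pow_mul_besselJ_mul_le hC hC0 (n + 1) (half_pos hl) htl hx _)
      (norm_nonneg _) (by positivity)
    have ht0 : 0 < t := (half_pos hl).trans_le htl
    rw [Real.norm_of_nonneg (by positivity)]
    gcongr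
  · filter_upwards [ae_restrict_mem measurableSet_Ioi] with x hx t ht
    have ht0 : 0 < t := (half_pos hl).trans_le (hball t ht)
    refine (((hasDerivAt_inv_pow_mul_besselJ k ht0.ne' (ne_of_gt hx)).const_mul
      (x ^ n)).mul_const (gammaProd M α β x)).congr_deriv ?_ |>.congr_of_eventuallyEq
      (Eventually.of_forall fun s ↦ ?_)
    · ring
    · ring

lemma integral_pow_mul_besselJ_mul_gammaProd (M : ℕ) {α β : ℕ → ℝ}
    (hα : ∀ k ∈ Finset.range M, 0 < α k) (hβ : ∀ k ∈ Finset.range M, 0 < β k)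
    (hβ0 : 0 < ∑ k ∈ Finset.range M, β k) (n : ℕ)
    (hn : (n : ℝ) + 1 / 2 < 2 * ∑ k ∈ Finset.range M, α k - M)
    {l : ℝ} (hl : π * ∑ k ∈ Finset.range M, β k < l) :
    ∫ x in Ioi (0 : ℝ), x ^ n * besselJ (n + 1) (l * x) * gammaProd M α β x
      = gammaProd M α β 0 * 2 ^ n * n.factorial / l ^ (n + 1) := by
  induction n generalizing l with
  | zero =>
    simpa using integral_besselJ_one_mul_gammaProd M hα hβ (by simpa using hn) hβ0 hl
  | succ n ih =>
    have hl0 : 0 < l := lt_trans (by positivity) hl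
    have hn' : (n : ℝ) + 1 / 2 < 2 * ∑ k ∈ Finset.range M, α k - M := by
      push_cast at hn
      linarith
    have h1 := hasDerivAt_inv_pow_mul_integral_besselJ M α hβ (n + 1) hn hl0
    have h2 : HasDerivAt (fun t : ℝ ↦ gammaProd M α β 0 * 2 ^ n * n.factorial
        * (t ^ (2 * n + 2))⁻¹)
        (gammaProd M α β 0 * 2 ^ n * n.factorial *
          (-((2 * n + 2 : ℕ) * l ^ (2 * n + 1)) / (l ^ (2 * n + 2)) ^ 2)) l :=
      ((hasDerivAt_pow (2 * n + 2) l).inv (pow_ne_zero _ hl0.ne')).const_mul _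
    have h3 : (fun t : ℝ ↦ gammaProd M α β 0 * 2 ^ n * n.factorial * (t ^ (2 * n + 2))⁻¹) =ᶠ[𝓝 l]
        fun t ↦ (t ^ (n + 1))⁻¹ *
          ∫ x in Ioi (0 : ℝ), x ^ n * besselJ (n + 1) (t * x) * gammaProd M α β x := by
      filter_upwards [lt_mem_nhds hl] with t ht
      rw [ih hn' ht, show 2 * n + 2 = (n + 1) + (n + 1) by ring, pow_add t]
      field_simp
    have h4 := (h1.congr_of_eventuallyEq h3).unique h2
    have hne := pow_ne_zero (n + 1) hl0.ne'
    rw [neg_eq_iff_eq_neg, inv_mul_eq_iff_eq_mul₀ hne] at h4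
    rw [h4, Nat.factorial_succ]
    push_cast
    field_simp
    ring

lemma continuousAt_integral_pow_mul_besselJ_mul_gammaProd (M : ℕ) (α : ℕ → ℝ) {β : ℕ → ℝ}
    (hβ : ∀ k ∈ Finset.range M, 0 < β k) {n : ℕ} (k : ℕ)
    (hn : (n : ℝ) + 1 / 2 < 2 * ∑ k ∈ Finset.range M, α k - M) {l : ℝ} (hl : 0 < l) :
    ContinuousAt
      (fun t ↦ ∫ x in Ioi (0 : ℝ), x ^ n * besselJ k (t * x) * gammaProd M α β x) l := by
  obtain ⟨C, hC0, hC⟩ := exists_besselJ_bound k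
  refine continuousAt_of_dominated
    (bound := fun x ↦ C * (l / 2) ^ (-(1 / 2) : ℝ) *
      ‖x ^ ((n + 1 / 2 : ℝ) - 1) * gammaProd M α β x‖)
    (Eventually.of_forall fun t ↦
      (continuous_pow_mul_besselJ_mul_gammaProd M α β n k t).aestronglyMeasurable) ?_
    ((integrableOn_rpow_mul_gammaProd M α hβ (by positivity) hn).norm.const_mul _)
    (Eventually.of_forall fun x ↦ ?_)
  · filter_upwards [lt_mem_nhds (half_lt_self hl)] with t ht
    filter_upwards [ae_restrict_mem measurableSet_Ioi] with x hx
    exact norm_pow_mul_besselJ_mul_le hC hC0 n (half_pos hl) ht.le hx _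
  · exact ((continuous_const.mul ((continuous_besselJ k).comp
      (continuous_mul_const x))).mul continuous_const).continuousAt

theorem hankel_gamma_first_term_even_order
    (M : ℕ) (hM : 1 ≤ M) (α β : ℕ → ℝ)
    (hα : ∀ k ∈ Finset.range M, 0 < α k) (hβ : ∀ k ∈ Finset.range M, 0 < β k)
    (m : ℕ)
    (hαsum : (m : ℝ) + (1 / 2) * ((M : ℝ) + 3 / 2) < ∑ k ∈ Finset.range M, α k)
    (lam : ℝ) (hlam : π * ∑ k ∈ Finset.range M, β k ≤ lam) :
    ∫ x in Set.Ioi (0 : ℝ), x ^ (2 * m + 1) * besselJ (2 * m + 2) (lam * x) * gammaProd M α β x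
      = ((Nat.factorial (2 * m + 1) : ℝ) / (2 * ∏ k ∈ Finset.range M, (Real.Gamma (α k)) ^ 2))
          * (2 / lam) ^ (2 * (m + 1)) := by
  have hβ0 : 0 < ∑ k ∈ Finset.range M, β k :=
    Finset.sum_pos hβ ⟨0, Finset.mem_range.2 hM⟩
  have hlam0 : 0 < lam := lt_of_lt_of_le (by positivity) hlam
  have hn : ((2 * m + 1 : ℕ) : ℝ) + 1 / 2 < 2 * ∑ k ∈ Finset.range M, α k - M := by
    push_cast
    linarith
  have h1 := (continuousAt_integral_pow_mul_besselJ_mul_gammaProd M α hβ (2 * m + 2) hn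
    hlam0).mono_left (nhdsWithin_le_nhds (s := Ioi lam))
  have h2 : Tendsto (fun t : ℝ ↦ gammaProd M α β 0 * 2 ^ (2 * m + 1) * (2 * m + 1).factorial
      / t ^ (2 * m + 2)) (𝓝[>] lam) (𝓝 (gammaProd M α β 0 * 2 ^ (2 * m + 1)
        * (2 * m + 1).factorial / lam ^ (2 * m + 2))) :=
    ((continuousAt_const.div (continuousAt_id.pow _)
      (pow_ne_zero _ hlam0.ne')).tendsto).mono_left nhdsWithin_le_nhds
  have h3 := tendsto_nhds_unique (h1.congr' (by
    filter_upwards [self_mem_nhdsWithin] with t ht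
    exact integral_pow_mul_besselJ_mul_gammaProd M hα hβ hβ0 (2 * m + 1) hn
      (hlam.trans_lt ht))) h2
  have h0 : gammaProd M α β 0 = (∏ k ∈ Finset.range M, Real.Gamma (α k) ^ 2)⁻¹ := by
    simp only [gammaProd, mul_zero, add_zero, sub_zero, Finset.prod_inv_distrib, sq]
  refine h3.trans ?_
  rw [h0, div_pow, show 2 * (m + 1) = 2 * m + 2 by ring, pow_succ 2 (2 * m + 1)]
  field_simp
end
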